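/- arXiv:2011.03948 — 4 statements merged into one kernel-verified Lean document; each statement's English description precedes it below -/
import Mathlib

section
/- Let n, r, d be positive integers with r ≥ 2. Let G be a graph on n vertices with minimum degree δ(G) ≥ (1/2 + 1/(2r))·n + 6dr². Then for every r-colouring of the edges of G there exists a Hamilton cycle H in G whose edge set contains at least |E(H)|/r + d edges of the same colour (i.e., a d-unbalanced Hamilton cycle). -/
/-- The number of edges in the list `l` receiving colour `c` under the colouring `col`. -/
def colourCount {V : Type*} {r : ℕ} (col : Sym2 V → Fin r) (l : List (Sym2 V)) (c : Fin r) : ℕ :=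
  l.countP (fun e => col e = c)

namespace ColourBias

section Lists

variable {V : Type*}

/-- The edges joining consecutive entries of a list. -/
def pathEdges : List V → List (Sym2 V)
  | a :: b :: t => s(a, b) :: pathEdges (b :: t)
  | _ => []

/-- The edges joining cyclically consecutive entries of a list. -/
def cycleEdges : List V → Multiset (Sym2 V)
  | [] => 0
  | a :: t => ↑(pathEdges (a :: t ++ [a]))

@[simp] lemma pathEdges_nil : pathEdges ([] : List V) = [] := rfl

@[simp] lemma pathEdges_singleton (a : V) : pathEdges [a] = [] := rfl

@[simp] lemma pathEdges_cons_cons (a b : V) (t : List V) :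
    pathEdges (a :: b :: t) = s(a, b) :: pathEdges (b :: t) := rfl

lemma pathEdges_append_cons (A : List V) (x : V) (B : List V) :
    pathEdges (A ++ x :: B) = pathEdges (A ++ [x]) ++ pathEdges (x :: B) := by
  induction A with
  | nil => simp
  | cons a A ih => cases A with
    | nil => simp
    | cons b A => simpa using ih

lemma pathEdges_append_cons_cons (A : List V) (x y : V) (B : List V) :
    pathEdges (A ++ x :: y :: B) =
      pathEdges (A ++ [x]) ++ s(x, y) :: pathEdges (y :: B) := by
  rw [pathEdges_append_cons, pathEdges_cons_cons]

lemma pathEdges_reverse (l : List V) : pathEdges l.reverse = (pathEdges l).reverse := by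
  induction l with
  | nil => rfl
  | cons a l ih => cases l with
    | nil => rfl
    | cons b t =>
      simp only [List.reverse_cons, List.append_assoc, List.cons_append, List.nil_append,
        pathEdges_cons_cons] at ih ⊢
      rw [pathEdges_append_cons, ih, pathEdges_cons_cons, Sym2.eq_swap]
      rfl

lemma length_pathEdges (l : List V) : (pathEdges l).length = l.length - 1 := by
  induction l with
  | nil => rfl
  | cons a l ih => cases l with
    | nil => rfl
    | cons b t => simpa using ih

lemma card_cycleEdges (l : List V) : (cycleEdges l).card = l.length := by
  cases l with
  | nil => rfl
  | cons a t => simp [cycleEdges, length_pathEdges, -List.cons_append]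

lemma mem_of_mem_pathEdges {l : List V} {e : Sym2 V} {v : V} (he : e ∈ pathEdges l)
    (hv : v ∈ e) : v ∈ l := by
  induction l with
  | nil => simp at he
  | cons a l ih => cases l with
    | nil => simp at he
    | cons b t =>
      rw [pathEdges_cons_cons, List.mem_cons] at he
      rcases he with rfl | he
      · rcases Sym2.mem_iff.1 hv with rfl | rfl <;> simp
      · exact List.mem_cons_of_mem _ (ih he)

lemma exists_split_of_mem_pathEdges {l : List V} {e : Sym2 V} (he : e ∈ pathEdges l) :
    ∃ A a b B, l = A ++ a :: b :: B ∧ e = s(a, b) := by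
  induction l with
  | nil => simp at he
  | cons x l ih => cases l with
    | nil => simp at he
    | cons y t =>
      rw [pathEdges_cons_cons, List.mem_cons] at he
      rcases he with rfl | he
      · exact ⟨[], x, y, t, rfl, rfl⟩
      · obtain ⟨A, a, b, B, h, rfl⟩ := ih he
        exact ⟨x :: A, a, b, B, by rw [h]; rfl, rfl⟩

lemma nodup_pathEdges {l : List V} (hl : l.Nodup) : (pathEdges l).Nodup := by
  induction l with
  | nil => simp
  | cons a l ih => cases l with
    | nil => simp
    | cons b t =>
      rw [pathEdges_cons_cons, List.nodup_cons]
      refine ⟨fun h => ?_, ih hl.of_cons⟩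
      exact (List.nodup_cons.1 hl).1 (mem_of_mem_pathEdges h (Sym2.mem_mk_left a b))

lemma cycleEdges_append_comm (A B : List V) : cycleEdges (A ++ B) = cycleEdges (B ++ A) := by
  cases A with
  | nil => simp
  | cons a A => cases B with
    | nil => simp
    | cons b B =>
      have h1 := pathEdges_append_cons (a :: A) b (B ++ [a])
      have h2 := pathEdges_append_cons (b :: B) a (A ++ [b])
      simp only [List.cons_append, cycleEdges, List.append_assoc] at h1 h2 ⊢
      rw [h1, h2, ← Multiset.coe_add, ← Multiset.coe_add, add_comm]

lemma cycleEdges_eq_cons {L : List V} {p q : V} (hp : L.head? = some p)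
    (hq : L.getLast? = some q) : cycleEdges L = s(q, p) ::ₘ ↑(pathEdges L) := by
  obtain ⟨T, rfl⟩ := List.getLast?_eq_some_iff.1 hq
  have h : cycleEdges (T ++ [q]) = ↑(pathEdges (T ++ q :: p :: [])) := by
    cases T with
    | nil => simp_all [cycleEdges]
    | cons a T => simp_all [cycleEdges]
  rw [h, pathEdges_append_cons_cons, ← Multiset.coe_add, pathEdges_singleton,
    Multiset.coe_singleton, add_comm, Multiset.singleton_add]

lemma cycleEdges_cons_concat (a : V) (A : List V) (b : V) :
    cycleEdges (a :: A ++ [b]) = s(b, a) ::ₘ ↑(pathEdges (a :: A ++ [b])) :=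
  cycleEdges_eq_cons rfl List.getLast?_concat

lemma exists_rotation_of_mem_cycleEdges {l : List V} {e : Sym2 V} (hl : 2 ≤ l.length)
    (he : e ∈ cycleEdges l) :
    ∃ a m b, (a :: m ++ [b]).Perm l ∧ cycleEdges (a :: m ++ [b]) = cycleEdges l ∧
      e = s(b, a) := by
  cases l with
  | nil => simp at hl
  | cons x t =>
    rcases List.eq_nil_or_concat t with rfl | ⟨m, y, rfl⟩
    · simp at hl
    · rw [List.concat_eq_append, ← List.cons_append] at he ⊢
      have he' := he
      rw [cycleEdges_cons_concat, Multiset.mem_cons] at he'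
      rcases he' with rfl | he'
      · exact ⟨x, m, y, .refl _, rfl, rfl⟩
      · obtain ⟨A, a, b, B, h, rfl⟩ := exists_split_of_mem_pathEdges (by simpa using he')
        have h1 : b :: (B ++ A) ++ [a] = b :: B ++ (A ++ [a]) := by simp
        have h2 : x :: m ++ [y] = A ++ [a] ++ b :: B := by simpa using h
        refine ⟨b, B ++ A, a, ?_, ?_, rfl⟩
        · rw [h1, h2]
          exact List.perm_append_comm
        · rw [h1, h2, cycleEdges_append_comm]

/-- Reversing a final segment of a cyclic ordering exchanges two edges. -/
lemma cycleEdges_reverse_segment {A B : List V} {x y h e : V}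
    (hh : (A ++ [x]).head? = some h) (he : (y :: B).getLast? = some e) :
    s(x, y) ::ₘ s(e, h) ::ₘ cycleEdges (A ++ [x] ++ (y :: B).reverse) =
      s(x, e) ::ₘ s(y, h) ::ₘ cycleEdges (A ++ [x] ++ y :: B) := by
  have key : ∀ {b c : V} {S : List V}, (b :: S).getLast? = some c →
      cycleEdges (A ++ [x] ++ b :: S) =
        (↑(pathEdges (A ++ [x])) + ↑(pathEdges (b :: S)) + {s(x, b)} + {s(c, h)} :
          Multiset (Sym2 V)) := by
    intro b c S hc
    rw [cycleEdges_eq_cons (p := h) (q := c) (by simp_all)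
      (by rwa [List.getLast?_append_of_ne_nil _ (by simp)]), List.append_assoc,
      List.singleton_append, pathEdges_append_cons_cons, ← Multiset.singleton_add,
      ← Multiset.coe_add, ← Multiset.cons_coe, ← Multiset.singleton_add]
    abel
  obtain ⟨T, hT⟩ := List.getLast?_eq_some_iff.1 he
  have hrev : (y :: B).reverse = e :: T.reverse := by rw [hT]; simp
  rw [key he, hrev, key (c := y) (by rw [← hrev]; simp), ← hrev, pathEdges_reverse,
    Multiset.coe_reverse]
  simp only [← Multiset.singleton_add]
  abel

end Lists

section Posa

variable {V : Type*} {G : SimpleGraph V}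

lemma countP_dropLast_add_countP_tail_le (p q : V → Bool) (s : Sym2 V → Bool) (l : List V)
    (h : ∀ A a b B, l = A ++ a :: b :: B → p a → q b → s s(a, b)) :
    l.dropLast.countP p + l.tail.countP q ≤ l.length - 1 + (pathEdges l).countP s := by
  induction l with
  | nil => simp
  | cons x l ih => cases l with
    | nil => simp
    | cons y t =>
      have h1 := ih fun A a b B hl => h (x :: A) a b B (by rw [hl]; rfl)
      have h2 := h [] x y t rfl
      simp only [List.dropLast_cons_cons, List.tail_cons, List.countP_cons, pathEdges_cons_cons,
        List.length_cons] at h1 ⊢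
      split_ifs <;> first | omega | simp_all

variable [Fintype V] [DecidableRel G.Adj]

lemma countP_adj_eq_degree {l : List V} (hl : l.Nodup) (hm : ∀ v, v ∈ l) (v : V) :
    l.countP (fun w => G.Adj v w) = G.degree v := by
  classical
  rw [← G.card_neighborFinset_eq_degree, List.countP_eq_length_filter,
    ← List.toFinset_card_of_nodup (hl.filter _)]
  congr 1
  ext w
  simp [hm]

lemma card_eq_length {l : List V} (hl : l.Nodup) (hm : ∀ v, v ∈ l) :
    l.length = Fintype.card V := by
  classical
  rw [← List.toFinset_card_of_nodup hl, ← Finset.card_univ]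
  congr 1
  ext w
  simp [hm]

lemma exists_crossing [DecidableEq V] (F : Finset (Sym2 V)) {D : ℕ} (hD : ∀ v, D ≤ G.degree v)
    (hF : Fintype.card V + F.card ≤ 2 * D) {h e : V} {m : List V}
    (hl : (h :: m ++ [e]).Nodup) (hm : ∀ v, v ∈ h :: m ++ [e]) :
    ∃ A x y B, h :: m ++ [e] = A ++ x :: y :: B ∧ G.Adj e x ∧ G.Adj h y ∧ s(x, y) ∉ F := by
  by_contra! hcon
  have h1 := countP_dropLast_add_countP_tail_le (fun w => G.Adj e w) (fun w => G.Adj h w)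
    (fun z => z ∈ F) (h :: m ++ [e]) (fun A a b B hs ha hb => by
      simpa using hcon A a b B hs (by simpa using ha) (by simpa using hb))
  have h2 : (h :: m ++ [e]).dropLast.countP (fun w => G.Adj e w) = G.degree e := by
    rw [← countP_adj_eq_degree hl hm e, List.dropLast_concat, List.countP_append]
    simp
  have h3 : (h :: m ++ [e]).tail.countP (fun w => G.Adj h w) = G.degree h := by
    rw [← countP_adj_eq_degree hl hm h]
    simp [List.countP_cons]
  have h4 : (pathEdges (h :: m ++ [e])).countP (fun z => z ∈ F) ≤ F.card := by
    rw [List.countP_eq_length_filter,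
      ← List.toFinset_card_of_nodup ((nodup_pathEdges hl).filter _)]
    exact Finset.card_le_card fun z => by simp
  have h5 := card_eq_length hl hm
  have h6 : 0 < (h :: m ++ [e]).length := by simp
  have := hD e
  have := hD h
  omega

/-- **Pósa's theorem**: a cyclic ordering of the vertices can be rearranged into a Hamilton cycle
while keeping a prescribed small set of edges. -/
lemma exists_hamilton_containing [DecidableEq V] (F : Finset (Sym2 V)) {D : ℕ}
    (hD : ∀ v, D ≤ G.degree v) (hF : Fintype.card V + F.card ≤ 2 * D)
    (hV : 2 ≤ Fintype.card V) (hFG : ∀ e ∈ F, e ∈ G.edgeSet)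
    {l : List V} (hl : l.Nodup) (hm : ∀ v, v ∈ l) (hlF : ∀ e ∈ F, e ∈ cycleEdges l) :
    ∃ l' : List V, l'.Nodup ∧ (∀ v, v ∈ l') ∧ (∀ e ∈ F, e ∈ cycleEdges l') ∧
      ∀ e ∈ cycleEdges l', e ∈ G.edgeSet := by
  induction hk : (cycleEdges l).countP (fun e => e ∉ G.edgeSet) using Nat.strong_induction_on
    generalizing l with
  | _ k ih =>
    by_cases hgood : ∀ e ∈ cycleEdges l, e ∈ G.edgeSet
    · exact ⟨l, hl, hm, hlF, hgood⟩
    push Not at hgood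
    obtain ⟨f, hf, hfG⟩ := hgood
    obtain ⟨h, m, e, hp, hc, rfl⟩ := exists_rotation_of_mem_cycleEdges
      (by rwa [card_eq_length hl hm]) hf
    obtain ⟨A, x, y, B, hs, hex, hhy, hxyF⟩ := exists_crossing (G := G) F hD hF
      (hp.nodup_iff.2 hl) fun v => hp.mem_iff.2 (hm v)
    have hs' : h :: m ++ [e] = (A ++ [x]) ++ y :: B := by rw [hs]; simp
    have hhead : (A ++ [x]).head? = some h := by
      have := congrArg List.head? hs
      cases A <;> simp_all
    have hlast : (y :: B).getLast? = some e := by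
      have h1 : (h :: m ++ [e]).getLast? = some e := List.getLast?_concat
      rwa [hs', List.getLast?_append_of_ne_nil _ (by simp)] at h1
    have key := cycleEdges_reverse_segment hhead hlast
    rw [← hs', hc] at key
    have hp' : (A ++ [x] ++ (y :: B).reverse).Perm l :=
      ((List.Perm.append_left _ (List.reverse_perm _)).trans (by rw [← hs'])).trans hp
    refine ih _ ?_ (hp'.nodup_iff.2 hl) (fun v => hp'.mem_iff.2 (hm v)) ?_ rfl
    · have h1 := congrArg (Multiset.countP (fun e => e ∉ G.edgeSet)) key
      simp only [Multiset.countP_cons, SimpleGraph.mem_edgeSet, hex.symm, hhy.symm] at h1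
      rw [SimpleGraph.mem_edgeSet] at hfG
      simp only [hfG] at h1
      simp at h1 hk ⊢
      split_ifs at h1 <;> omega
    · intro z hz
      have h1 : z ∈ s(x, e) ::ₘ s(y, h) ::ₘ cycleEdges l := by simp [hlF z hz]
      rw [← key] at h1
      simp only [Multiset.mem_cons] at h1
      rcases h1 with rfl | rfl | h1
      · exact absurd hz hxyF
      · exact absurd (hFG _ hz) hfG
      · exact h1

end Posa

section Switch

variable {V : Type*}

/-- Moving `x` from between `u` and `w` to between `y` and `z` in a cyclic ordering. -/
lemma exists_perm_move {l : List V} (hl : l.Nodup) {x y z u w : V}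
    (hd : [y, z, u, x, w].Nodup) (hx : x ∈ l) (hyz : s(y, z) ∈ cycleEdges l)
    (hux : s(u, x) ∈ cycleEdges l) (hxw : s(x, w) ∈ cycleEdges l) :
    ∃ l' : List V, l'.Perm l ∧
      cycleEdges l' + {s(u, x), s(x, w), s(y, z)} =
        cycleEdges l + {s(y, x), s(x, z), s(u, w)} := by
  obtain ⟨t, htl, htE⟩ : ∃ t, (x :: t).Perm l ∧ cycleEdges (x :: t) = cycleEdges l := by
    obtain ⟨A, B, rfl⟩ := List.append_of_mem hx
    exact ⟨B ++ A, (List.perm_append_comm (l₁ := x :: B)), cycleEdges_append_comm (x :: B) A⟩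
  rw [← htE] at hyz hux hxw ⊢
  have ht : (x :: t).Nodup := htl.nodup_iff.2 hl
  have hxt := (List.nodup_cons.1 ht).1
  simp only [List.nodup_cons, List.mem_cons, List.not_mem_nil, not_or, or_false] at hd
  obtain ⟨⟨-, -, hyx, -⟩, ⟨-, hzx, -⟩, ⟨hux', huw⟩, hxw', -⟩ := hd
  obtain ⟨p, m, rfl⟩ : ∃ p m, t = p :: m := by
    cases t with
    | nil => simp [cycleEdges] at hux; simp_all
    | cons p m => exact ⟨p, m, rfl⟩
  obtain ⟨q, hq⟩ : ∃ q, (p :: m).getLast? = some q :=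
    ⟨_, List.getLast?_eq_some_getLast (by simp)⟩
  have hE : cycleEdges (x :: p :: m) = s(q, x) ::ₘ s(x, p) ::ₘ ↑(pathEdges (p :: m)) := by
    rw [cycleEdges_eq_cons (p := x) (q := q) rfl (by rwa [List.getLast?_cons_cons])]
    rfl
  have hend : ∀ v, v ≠ x → s(x, v) ∈ cycleEdges (x :: p :: m) → v = q ∨ v = p := by
    intro v hv h
    rw [hE] at h
    simp only [Multiset.mem_cons, Sym2.eq_iff, Multiset.mem_coe] at h
    rcases h with h | h | h
    · grind
    · grind
    · exact absurd (mem_of_mem_pathEdges h (Sym2.mem_mk_left x v)) hxt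
  have hu := hend u hux' (by rwa [Sym2.eq_swap])
  have hw := hend w (Ne.symm hxw') hxw
  have hyzm : s(y, z) ∈ pathEdges (p :: m) := by
    rw [hE] at hyz
    simp only [Multiset.mem_cons, Sym2.eq_iff, Multiset.mem_coe] at hyz
    rcases hyz with h | h | h
    · grind
    · grind
    · exact h
  obtain ⟨A, a, b, B, hs, hab⟩ := exists_split_of_mem_pathEdges hyzm
  refine ⟨A ++ a :: x :: b :: B, ?_, ?_⟩
  · refine List.Perm.trans ?_ htl
    rw [hs]
    have h := List.perm_middle (a := x) (l₁ := A ++ [a]) (l₂ := b :: B)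
    simpa using h
  · have hp' : (A ++ a :: x :: b :: B).head? = some p := by
      have := congrArg List.head? hs
      cases A <;> simp_all
    have hq' : (A ++ a :: x :: b :: B).getLast? = some q := by
      rw [hs, List.getLast?_append_of_ne_nil _ (by simp)] at hq
      rw [List.getLast?_append_of_ne_nil _ (by simp)]
      simpa [List.getLast?_cons_cons] using hq
    have h1 : ({s(u, x), s(x, w)} : Multiset (Sym2 V)) = {s(q, x), s(x, p)} := by
      rcases hu with rfl | rfl <;> rcases hw with rfl | rfl
      · exact absurd rfl huw
      · rfl
      · rw [Multiset.pair_comm, Sym2.eq_swap, Sym2.eq_swap (a := x)]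
      · exact absurd rfl huw
    have h2 : s(u, w) = s(q, p) := by
      rcases hu with rfl | rfl <;> rcases hw with rfl | rfl
      · exact absurd rfl huw
      · rfl
      · exact Sym2.eq_swap
      · exact absurd rfl huw
    have h3 : ({s(y, x), s(x, z)} : Multiset (Sym2 V)) = {s(a, x), s(x, b)} := by
      rcases Sym2.eq_iff.1 hab with ⟨rfl, rfl⟩ | ⟨rfl, rfl⟩
      · rfl
      · rw [Multiset.pair_comm, Sym2.eq_swap, Sym2.eq_swap (a := x)]
    rw [cycleEdges_eq_cons hp' hq', hE, hs, pathEdges_append_cons_cons, pathEdges_cons_cons,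
      pathEdges_append_cons_cons, ← Multiset.coe_add, ← Multiset.coe_add]
    have h4 : ({s(u, x), s(x, w), s(y, z)} : Multiset (Sym2 V)) =
        {s(q, x), s(x, p)} + {s(a, b)} := by rw [← h1, ← hab]; rfl
    have h5 : ({s(y, x), s(x, z), s(u, w)} : Multiset (Sym2 V)) =
        {s(a, x), s(x, b)} + {s(q, p)} := by rw [← h3, ← h2]; rfl
    rw [h4, h5]
    simp only [← Multiset.cons_coe, ← Multiset.singleton_add, Multiset.insert_eq_cons]
    abel

/-- Two edge-disjoint triangles `xyz` and `xuw` sharing only the vertex `x`. -/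
structure Bowtie (V : Type*) where
  /-- the common vertex -/
  x : V
  /-- a vertex of the first triangle -/
  y : V
  /-- a vertex of the first triangle -/
  z : V
  /-- a vertex of the second triangle -/
  u : V
  /-- a vertex of the second triangle -/
  w : V

namespace Bowtie

/-- The vertices of a bowtie. -/
def verts (g : Bowtie V) : List V := [g.y, g.z, g.u, g.x, g.w]

/-- The edges of the first state of a bowtie. -/
def oldEdges (g : Bowtie V) : List (Sym2 V) := [s(g.u, g.x), s(g.x, g.w), s(g.y, g.z)]

end Bowtie

variable {C : Type*} [DecidableEq C]

/-- The number of spokes of colour `a` at `x` minus the number of opposite edges of colour `a` in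
the triangle `xyz`. -/
def triangleSign (col : Sym2 V → C) (a : C) (x y z : V) : ℤ :=
  (if col s(x, y) = a then 1 else 0) + (if col s(x, z) = a then 1 else 0) -
    (if col s(y, z) = a then 1 else 0)

/-- A bowtie of `G` whose switch gains edges of colour `a`. -/
structure Bowtie.Gains (g : Bowtie V) (G : SimpleGraph V) (col : Sym2 V → C) (a : C) : Prop where
  nodup : g.verts.Nodup
  xy : G.Adj g.x g.y
  xz : G.Adj g.x g.z
  yz : G.Adj g.y g.z
  xu : G.Adj g.x g.u
  xw : G.Adj g.x g.w
  uw : G.Adj g.u g.w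
  lt : triangleSign col a g.x g.u g.w < triangleSign col a g.x g.y g.z

variable {G : SimpleGraph V} {col : Sym2 V → C} {a : C}

lemma exists_switch_all {gs : List (Bowtie V)} (hgs : ∀ g ∈ gs, g.Gains G col a)
    (hd : (gs.flatMap Bowtie.verts).Nodup) {l : List V} (hl : l.Nodup) (hm : ∀ v, v ∈ l)
    (hlG : ∀ e ∈ cycleEdges l, e ∈ G.edgeSet)
    (hold : ∀ g ∈ gs, ∀ e ∈ g.oldEdges, e ∈ cycleEdges l) :
    ∃ l' : List V, l'.Nodup ∧ (∀ v, v ∈ l') ∧ (∀ e ∈ cycleEdges l', e ∈ G.edgeSet) ∧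
      (cycleEdges l).countP (fun e => col e = a) + gs.length ≤
        (cycleEdges l').countP (fun e => col e = a) := by
  induction gs generalizing l with
  | nil => exact ⟨l, hl, hm, hlG, le_rfl⟩
  | cons g gs ih =>
    have hg := hgs g (by simp)
    have hog := hold g (by simp)
    simp only [Bowtie.oldEdges, List.mem_cons, List.not_mem_nil, or_false, forall_eq_or_imp,
      forall_eq] at hog
    obtain ⟨l', hp, hE⟩ := exists_perm_move hl hg.nodup (hm g.x) hog.2.2 hog.1 hog.2.1
    rw [List.flatMap_cons, List.nodup_append] at hd
    obtain ⟨l'', h1, h2, h3, h4⟩ := ih (fun g' hg' => hgs g' (by simp [hg'])) hd.2.1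
      (hp.nodup_iff.2 hl) (fun v => hp.mem_iff.2 (hm v)) (fun e he => by
        have h : e ∈ cycleEdges l + {s(g.y, g.x), s(g.x, g.z), s(g.u, g.w)} := by
          rw [← hE]; exact Multiset.mem_add.2 (Or.inl he)
        simp only [Multiset.mem_add, Multiset.insert_eq_cons, Multiset.mem_cons,
          Multiset.mem_singleton] at h
        rcases h with h | rfl | rfl | rfl
        exacts [hlG e h, hg.xy.symm, hg.xz, hg.uw]) (fun g' hg' e he => by
        have h : e ∈ cycleEdges l' + {s(g.u, g.x), s(g.x, g.w), s(g.y, g.z)} := by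
          rw [hE]; exact Multiset.mem_add.2 (Or.inl (hold g' (by simp [hg']) e he))
        have hne : ∀ v ∈ g.verts, v ∉ e := by
          intro v hv hve
          refine hd.2.2 v hv v (List.mem_flatMap.2 ⟨g', hg', ?_⟩) rfl
          simp only [Bowtie.oldEdges, List.mem_cons, List.not_mem_nil, or_false] at he
          rcases he with rfl | rfl | rfl <;>
            rcases Sym2.mem_iff.1 hve with rfl | rfl <;> simp [Bowtie.verts]
        simp only [Multiset.mem_add, Multiset.insert_eq_cons, Multiset.mem_cons,
          Multiset.mem_singleton] at h
        rcases h with h | rfl | rfl | rfl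
        · exact h
        · exact absurd (Sym2.mem_mk_left _ _) (hne g.u (by simp [Bowtie.verts]))
        · exact absurd (Sym2.mem_mk_left _ _) (hne g.x (by simp [Bowtie.verts]))
        · exact absurd (Sym2.mem_mk_left _ _) (hne g.y (by simp [Bowtie.verts])))
    refine ⟨l'', h1, h2, h3, ?_⟩
    have hcount := congrArg (Multiset.countP (fun e => col e = a)) hE
    have hlt := hg.lt
    simp only [Multiset.countP_add, Multiset.insert_eq_cons, ← Multiset.cons_zero,
      Multiset.countP_cons, Multiset.countP_zero] at hcount
    rw [Sym2.eq_swap (a := g.u), Sym2.eq_swap (a := g.y) (b := g.x)] at hcount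
    simp only [triangleSign] at hlt
    rw [List.length_cons]
    split_ifs at hcount hlt <;> omega

lemma exists_bowties_or_cover (G : SimpleGraph V) (col : Sym2 V → C) (a : C) [DecidableEq V]
    (t : ℕ) :
    (∃ gs : List (Bowtie V), gs.length = t ∧ (∀ g ∈ gs, g.Gains G col a) ∧
      (gs.flatMap Bowtie.verts).Nodup) ∨
    ∃ R : Finset V, R.card ≤ 5 * t ∧ ∀ g : Bowtie V, g.Gains G col a → ∃ v ∈ g.verts, v ∈ R := by
  induction t with
  | zero => exact Or.inl ⟨[], by simp⟩
  | succ t ih =>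
    rcases ih with ⟨gs, hlen, hg, hd⟩ | ⟨R, hR, h⟩
    · by_cases hex : ∃ g : Bowtie V, g.Gains G col a ∧ ∀ v ∈ g.verts, v ∉ gs.flatMap Bowtie.verts
      · obtain ⟨g, hga, hgv⟩ := hex
        refine Or.inl ⟨g :: gs, by simp [hlen], by simpa using ⟨hga, hg⟩, ?_⟩
        rw [List.flatMap_cons, List.nodup_append]
        exact ⟨hga.nodup, hd, fun v hv v' hv' heq => hgv v hv (heq ▸ hv')⟩
      · push Not at hex
        refine Or.inr ⟨(gs.flatMap Bowtie.verts).toFinset, ?_, fun g hga => ?_⟩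
        · refine (List.toFinset_card_le _).trans ?_
          have : (gs.flatMap Bowtie.verts).length = 5 * t := by
            rw [← hlen, List.length_flatMap]
            simp [Bowtie.verts, mul_comm]
          omega
        · obtain ⟨v, hv, hv'⟩ := hex g hga
          exact ⟨v, hv, List.mem_toFinset.2 hv'⟩
    · exact Or.inr ⟨R, by omega, h⟩

lemma mem_pathEdges_append {A B : List V} {e : Sym2 V}
    (h : e ∈ pathEdges A ∨ e ∈ pathEdges B) : e ∈ pathEdges (A ++ B) := by
  cases B with
  | nil => simpa using h
  | cons b B =>
    rcases List.eq_nil_or_concat A with rfl | ⟨A, a, rfl⟩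
    · simpa using h
    · rw [List.concat_eq_append] at h ⊢
      rw [List.append_assoc, List.singleton_append, pathEdges_append_cons_cons]
      simp only [List.mem_append, List.mem_cons]
      tauto

lemma mem_cycleEdges_of_mem_pathEdges {l : List V} {e : Sym2 V} (h : e ∈ pathEdges l) :
    e ∈ cycleEdges l := by
  cases l with
  | nil => simp at h
  | cons a t => exact Multiset.mem_coe.2 (mem_pathEdges_append (Or.inl h))

lemma oldEdges_subset_pathEdges (gs : List (Bowtie V)) :
    ∀ g ∈ gs, ∀ e ∈ g.oldEdges, e ∈ pathEdges (gs.flatMap Bowtie.verts) := by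
  induction gs with
  | nil => simp
  | cons g gs ih =>
    intro g' hg' e he
    rw [List.flatMap_cons]
    rcases List.mem_cons.1 hg' with rfl | hg'
    · refine mem_pathEdges_append (Or.inl ?_)
      simp only [Bowtie.oldEdges, List.mem_cons, List.not_mem_nil, or_false] at he
      rcases he with rfl | rfl | rfl <;> simp [Bowtie.verts]
    · exact mem_pathEdges_append (Or.inr (ih g' hg' e he))

/-- Disjoint bowties gaining colour `a` yield two Hamilton cycles whose numbers of edges of
colour `a` are far apart. -/
lemma exists_hamilton_pair [Fintype V] [DecidableEq V] [DecidableRel G.Adj]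
    {gs : List (Bowtie V)} (hgs : ∀ g ∈ gs, g.Gains G col a)
    (hd : (gs.flatMap Bowtie.verts).Nodup) {D : ℕ} (hD : ∀ v, D ≤ G.degree v)
    (hn : Fintype.card V + 3 * gs.length ≤ 2 * D) (hV : 2 ≤ Fintype.card V) :
    ∃ l l' : List V, (l.Nodup ∧ (∀ v, v ∈ l) ∧ ∀ e ∈ cycleEdges l, e ∈ G.edgeSet) ∧
      (l'.Nodup ∧ (∀ v, v ∈ l') ∧ ∀ e ∈ cycleEdges l', e ∈ G.edgeSet) ∧
      (cycleEdges l).countP (fun e => col e = a) + gs.length ≤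
        (cycleEdges l').countP (fun e => col e = a) := by
  set base := gs.flatMap Bowtie.verts ++
    (Finset.univ.toList.filter fun v => v ∉ gs.flatMap Bowtie.verts) with hbase
  obtain ⟨l, h1, h2, h3, h4⟩ := exists_hamilton_containing (G := G)
    (gs.flatMap Bowtie.oldEdges).toFinset hD
    (le_trans (Nat.add_le_add_left (by
      refine (List.toFinset_card_le _).trans ?_
      rw [List.length_flatMap]
      simp [Bowtie.oldEdges, mul_comm]) _) hn) hV (by
      intro e he
      obtain ⟨g, hg, he⟩ := List.mem_flatMap.1 (List.mem_toFinset.1 he)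
      have hg := hgs g hg
      simp only [Bowtie.oldEdges, List.mem_cons, List.not_mem_nil, or_false] at he
      rcases he with rfl | rfl | rfl
      exacts [hg.xu.symm, hg.xw, hg.yz]) (l := base) (by
      refine List.nodup_append.2 ⟨hd, (Finset.nodup_toList _).filter _, ?_⟩
      rintro v hv _ hv' rfl
      simp only [List.mem_filter, decide_eq_true_eq] at hv'
      exact hv'.2 hv) (by
      intro v
      simp only [hbase, List.mem_append, List.mem_filter, Finset.mem_toList, Finset.mem_univ,
        decide_eq_true_eq, true_and]
      tauto) (by
      intro e he
      obtain ⟨g, hg, he⟩ := List.mem_flatMap.1 (List.mem_toFinset.1 he)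
      exact mem_cycleEdges_of_mem_pathEdges
        (mem_pathEdges_append (Or.inl (oldEdges_subset_pathEdges gs g hg e he))))
  obtain ⟨l', h5, h6, h7, h8⟩ := exists_switch_all hgs hd h1 h2 h4 fun g hg e he =>
    h3 e (List.mem_toFinset.2 (List.mem_flatMap.2 ⟨g, hg, he⟩))
  exact ⟨l, l', ⟨h1, h2, h4⟩, ⟨h5, h6, h7⟩, h8⟩

end Switch

section Structure

variable {V C : Type*} [DecidableEq V] [DecidableEq C] {G : SimpleGraph V} {col : Sym2 V → C}

/-- If no bowtie outside `R` gains an edge of any colour, then outside `R` and some independent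
set all edges have the same colour. -/
lemma exists_independent_monochromatic [Fintype V] (R : Finset V)
    (hR : ∀ a, ∀ g : Bowtie V, g.Gains G col a → ∃ v ∈ g.verts, v ∈ R)
    (hc : ∀ x y, ∀ S : Finset V, S.card ≤ R.card + 4 → ∃ z ∉ S, G.Adj x z ∧ G.Adj y z)
    (hne : ∃ x, x ∉ R) :
    ∃ a, ∃ I : Finset V, (∀ x ∈ I, ∀ y ∈ I, ¬ G.Adj x y) ∧
      ∀ x y, x ∉ R → y ∉ R → x ∉ I → y ∉ I → G.Adj x y → col s(x, y) = a := by
  have avoid : ∀ x y, ∀ b c d e : V, ∃ z, z ∉ R ∧ z ≠ b ∧ z ≠ c ∧ z ≠ d ∧ z ≠ e ∧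
      G.Adj x z ∧ G.Adj y z := by
    intro x y b c d e
    obtain ⟨z, hz, h1, h2⟩ := hc x y (R ∪ {b, c, d, e})
      ((Finset.card_union_le _ _).trans (Nat.add_le_add_left Finset.card_le_four _))
    simp only [Finset.mem_union, Finset.mem_insert, Finset.mem_singleton, not_or] at hz
    exact ⟨z, hz.1, hz.2.1, hz.2.2.1, hz.2.2.2.1, hz.2.2.2.2, h1, h2⟩
  have disj : ∀ a x y z u w, x ∉ R → y ∉ R → z ∉ R → u ∉ R → w ∉ R →
      y ≠ u → y ≠ w → z ≠ u → z ≠ w → G.Adj x y → G.Adj x z → G.Adj y z → G.Adj x u →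
      G.Adj x w → G.Adj u w → triangleSign col a x y z ≤ triangleSign col a x u w := by
    intro a x y z u w hx hy hz hu hw hyu hyw hzu hzw xy xz yz xu xw uw
    by_contra! hlt
    obtain ⟨v, hv, hvR⟩ := hR a ⟨x, y, z, u, w⟩
      ⟨by simp [Bowtie.verts, hyu, hyw, hzu, hzw, xy.ne', xz.ne', yz.ne, xu.ne', xw.ne, uw.ne],
        xy, xz, yz, xu, xw, uw, hlt⟩
    simp only [Bowtie.verts, List.mem_cons, List.not_mem_nil, or_false] at hv
    rcases hv with rfl | rfl | rfl | rfl | rfl <;> contradiction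
  have const : ∀ a x y z u w, x ∉ R → y ∉ R → z ∉ R → u ∉ R → w ∉ R →
      G.Adj x y → G.Adj x z → G.Adj y z → G.Adj x u → G.Adj x w → G.Adj u w →
      triangleSign col a x y z ≤ triangleSign col a x u w := by
    intro a x y z u w hx hy hz hu hw xy xz yz xu xw uw
    obtain ⟨p, hp, py, pz, pu, pw, xp, -⟩ := avoid x x y z u w
    obtain ⟨q, hq, qy, qz, qu, qw, xq, pq⟩ := avoid x p y z u w
    exact (disj a x y z p q hx hy hz hp hq py.symm qy.symm pz.symm qz.symm xy xz yz xp xq pq).trans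
      (disj a x p q u w hx hp hq hu hw pu pw qu qw xp xq pq xu xw uw)
  have triangle : ∀ x, ∃ y z, y ∉ R ∧ z ∉ R ∧ G.Adj x y ∧ G.Adj x z ∧ G.Adj y z := by
    intro x
    obtain ⟨y, hy, -, -, -, -, xy, -⟩ := avoid x x x x x x
    obtain ⟨z, hz, -, -, -, -, xz, yz⟩ := avoid x y x x x x
    exact ⟨y, z, hy, hz, xy, xz, yz⟩
  choose p q hp hq xp xq pq using triangle
  obtain ⟨f, hf⟩ : ∃ f : C → V → ℤ, ∀ a x y z, x ∉ R → y ∉ R → z ∉ R → G.Adj x y → G.Adj x z →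
      G.Adj y z → triangleSign col a x y z = f a x :=
    ⟨fun a x => triangleSign col a x (p x) (q x), fun a x y z hx hy hz xy xz yz =>
      le_antisymm
        (const a x y z _ _ hx hy hz (hp x) (hq x) xy xz yz (xp x) (xq x) (pq x))
        (const a x _ _ y z hx (hp x) (hq x) hy hz (xp x) (xq x) (pq x) xy xz yz)⟩
  have edge : ∀ a x y, x ∉ R → y ∉ R → G.Adj x y →
      f a x + f a y = 2 * if col s(x, y) = a then 1 else 0 := by
    intro a x y hx hy xy
    obtain ⟨z, hz, -, -, -, -, xz, yz⟩ := avoid x y x x x x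
    rw [← hf a x y z hx hy hz xy xz yz, ← hf a y x z hy hx hz xy.symm yz xz]
    simp only [triangleSign, Sym2.eq_swap (a := y) (b := x)]
    ring
  obtain ⟨x₀, hx₀⟩ := hne
  obtain ⟨a, ha⟩ : ∃ a, f a x₀ % 2 = 1 := by
    have h := fun a => hf a x₀ _ _ hx₀ (hp x₀) (hq x₀) (xp x₀) (xq x₀) (pq x₀)
    by_cases h1 : col s(p x₀, q x₀) = col s(x₀, p x₀)
    · refine ⟨col s(x₀, q x₀), ?_⟩
      rw [← h, triangleSign, h1]
      simp
    · by_cases h2 : col s(x₀, q x₀) = col s(x₀, p x₀)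
      · refine ⟨col s(p x₀, q x₀), ?_⟩
        rw [← h, triangleSign, h2]
        simp [Ne.symm h1]
      · refine ⟨col s(x₀, p x₀), ?_⟩
        rw [← h, triangleSign]
        simp [h1, h2]
  have odd : ∀ x, x ∉ R → f a x = 1 ∨ f a x = -1 := by
    intro x hx
    obtain ⟨w, hw, -, -, -, -, h1, h2⟩ := avoid x₀ x x x x x
    have e1 := edge a x₀ w hx₀ hw h1
    have e2 := edge a x w hx hw h2
    have e3 := hf a x _ _ hx (hp x) (hq x) (xp x) (xq x) (pq x)
    rw [triangleSign] at e3
    split_ifs at e3 <;> omega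
  refine ⟨a, Finset.univ.filter fun x => x ∉ R ∧ f a x = -1, ?_, ?_⟩
  · intro x hx y hy xy
    simp only [Finset.mem_filter, Finset.mem_univ, true_and] at hx hy
    have := edge a x y hx.1 hy.1 xy
    split_ifs at this <;> omega
  · intro x y hx hy hxI hyI xy
    simp only [Finset.mem_filter, Finset.mem_univ, true_and, not_and] at hxI hyI
    have h1 := (odd x hx).resolve_right (hxI hx)
    have h2 := (odd y hy).resolve_right (hyI hy)
    have := edge a x y hx hy xy
    by_contra hcol
    rw [if_neg hcol] at this
    omega

end Structure

section Counting

variable {V : Type*}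

lemma countP_pathEdges_le (p : V → Bool) (s : Sym2 V → Bool)
    (h : ∀ x y, s s(x, y) → p x ∨ p y) (l : List V) :
    (pathEdges l).countP s ≤ l.dropLast.countP p + l.tail.countP p := by
  induction l with
  | nil => simp
  | cons x l ih => cases l with
    | nil => simp
    | cons y t =>
      have h1 := h x y
      simp only [List.dropLast_cons_cons, List.tail_cons, List.countP_cons,
        pathEdges_cons_cons] at ih ⊢
      split_ifs <;> first | omega | simp_all

lemma countP_cycleEdges_le [DecidableEq V] (S : Finset V) (s : Sym2 V → Prop) [DecidablePred s]
    (h : ∀ x y, s s(x, y) → x ∈ S ∨ y ∈ S) {l : List V} (hl : l.Nodup) :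
    (cycleEdges l).countP s ≤ 2 * S.card := by
  cases l with
  | nil => simp [cycleEdges]
  | cons a t =>
    have hS : (a :: t).countP (fun v => v ∈ S) ≤ S.card := by
      rw [List.countP_eq_length_filter, ← List.toFinset_card_of_nodup (hl.filter _)]
      exact Finset.card_le_card fun z => by simp
    have h1 := countP_pathEdges_le (fun v => v ∈ S) (fun e => s e) (by simpa using h)
      (a :: t ++ [a])
    rw [List.dropLast_concat] at h1
    have h2 : (a :: t ++ [a]).tail.countP (fun v => v ∈ S) =
        (a :: t).countP (fun v => v ∈ S) := by
      simp [List.countP_cons]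
    rw [cycleEdges, Multiset.coe_countP]
    omega

variable {G : SimpleGraph V}

lemma exists_walk_of_pathEdges (l : List V) (a b : V)
    (hG : ∀ e ∈ pathEdges (a :: l ++ [b]), e ∈ G.edgeSet) :
    ∃ p : G.Walk a b, p.support = a :: l ++ [b] ∧ p.edges = pathEdges (a :: l ++ [b]) := by
  induction l generalizing a with
  | nil =>
    have h : G.Adj a b := hG s(a, b) (by simp)
    exact ⟨.cons h .nil, rfl, rfl⟩
  | cons c l ih =>
    have h : G.Adj a c := hG s(a, c) (by simp)
    obtain ⟨p, h1, h2⟩ := ih c fun e he => hG e (by simp_all)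
    exact ⟨.cons h p, by simp_all, by simp_all⟩

lemma exists_isHamiltonianCycle [DecidableEq V] {l : List V} (hl : l.Nodup) (hm : ∀ v, v ∈ l)
    (hG : ∀ e ∈ cycleEdges l, e ∈ G.edgeSet) (h3 : 3 ≤ l.length) :
    ∃ (v : V) (p : G.Walk v v), p.IsHamiltonianCycle ∧ (p.edges : Multiset (Sym2 V)) =
      cycleEdges l := by
  obtain ⟨a, b, c, t, rfl⟩ : ∃ a b c t, l = a :: b :: c :: t := by
    rcases l with _ | ⟨a, _ | ⟨b, _ | ⟨c, t⟩⟩⟩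
    · simp at h3
    · simp at h3
    · simp at h3
    · exact ⟨a, b, c, t, rfl⟩
  have hG' : ∀ e ∈ pathEdges (a :: b :: c :: t ++ [a]), e ∈ G.edgeSet := hG
  have hab : G.Adj a b := hG' s(a, b) (by simp)
  obtain ⟨p, hs, he⟩ := exists_walk_of_pathEdges (c :: t) b a fun e he => hG' e (by simp_all)
  have hperm : p.support.Perm (a :: b :: c :: t) := by
    rw [hs]; exact List.perm_append_singleton a (b :: c :: t)
  have hnd : p.support.Nodup := hperm.nodup_iff.2 hl
  refine ⟨a, .cons hab p, ?_, ?_⟩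
  · rw [SimpleGraph.Walk.isHamiltonianCycle_iff_isCycle_and_support_count_tail_eq_one,
      SimpleGraph.Walk.cons_isCycle_iff]
    refine ⟨⟨SimpleGraph.Walk.IsPath.mk' hnd, ?_⟩, fun v => ?_⟩
    · rw [he]
      intro h
      simp only [List.cons_append, pathEdges_cons_cons, List.mem_cons] at h
      simp only [List.nodup_cons, List.mem_cons, not_or] at hl
      rcases h with h | h
      · grind
      · have := mem_of_mem_pathEdges h (Sym2.mem_mk_right a b)
        grind
    · rw [SimpleGraph.Walk.support_cons, List.tail_cons]
      exact List.count_eq_one_of_mem hnd (hperm.mem_iff.2 (hm v))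
  · rw [SimpleGraph.Walk.edges_cons, he]
    rfl

lemma exists_common_neighbor [Fintype V] [DecidableEq V] [DecidableRel G.Adj] {D : ℕ}
    (hD : ∀ v, D ≤ G.degree v) (S : Finset V) (hS : Fintype.card V + S.card < 2 * D) (x y : V) :
    ∃ z ∉ S, G.Adj x z ∧ G.Adj y z := by
  have h1 := Finset.card_union_add_card_inter (G.neighborFinset x) (G.neighborFinset y)
  have h2 := Finset.card_le_univ (G.neighborFinset x ∪ G.neighborFinset y)
  rw [G.card_neighborFinset_eq_degree, G.card_neighborFinset_eq_degree] at h1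
  have := hD x
  have := hD y
  obtain ⟨z, hz, hzS⟩ := Finset.exists_mem_notMem_of_card_lt_card
    (s := S) (t := G.neighborFinset x ∩ G.neighborFinset y) (by omega)
  simp only [Finset.mem_inter, SimpleGraph.mem_neighborFinset] at hz
  exact ⟨z, hzS, hz⟩

lemma card_add_le_of_independent [Fintype V] [DecidableEq V] [DecidableRel G.Adj] {D : ℕ}
    (hD : ∀ v, D ≤ G.degree v) (hDV : D ≤ Fintype.card V) (I : Finset V)
    (hI : ∀ x ∈ I, ∀ y ∈ I, ¬ G.Adj x y) : I.card + D ≤ Fintype.card V := by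
  rcases I.eq_empty_or_nonempty with rfl | ⟨x, hx⟩
  · simpa using hDV
  · have h1 : Disjoint I (G.neighborFinset x) := by
      rw [Finset.disjoint_left]
      intro y hy hxy
      exact hI x hx y hy (by simpa using hxy)
    have h2 := Finset.card_le_univ (I ∪ G.neighborFinset x)
    rw [Finset.card_union_of_disjoint h1, G.card_neighborFinset_eq_degree] at h2
    have := hD x
    omega

end Counting

section Main

lemma sum_countP_eq_card {α C : Type*} [Fintype C] [DecidableEq C] (col : α → C)
    (s : Multiset α) : ∑ c, s.countP (fun e => col e = c) = s.card := by
  induction s using Multiset.induction_on with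
  | empty => simp
  | cons a s ih => simp [Multiset.countP_cons, Finset.sum_add_distrib, ih]

variable {n r d D : ℕ}

lemma minDegree_bounds (hr : 2 ≤ r) (hδ : ((1 : ℝ) / 2 + 1 / (2 * r)) * n + 6 * d * r ^ 2 ≤ D) :
    (n : ℝ) / r + n + 12 * (d * r ^ 2) ≤ 2 * D ∧ n + 12 * (d * r ^ 2) ≤ 2 * D := by
  have hr0 : (0 : ℝ) < r := by positivity
  have h1 : (n : ℝ) / r + n + 12 * (d * r ^ 2) ≤ 2 * D := by
    have : ((1 : ℝ) / 2 + 1 / (2 * r)) * n = (n / r + n) / 2 := by field_simp; ring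
    linarith
  refine ⟨h1, ?_⟩
  have h2 : (0 : ℝ) ≤ n / r := by positivity
  have h3 : (n : ℝ) + 12 * (d * r ^ 2) ≤ 2 * D := by linarith
  exact_mod_cast h3

lemma exists_unbalanced_of_pair {C : Type*} [Fintype C] [DecidableEq C] (hr : 2 ≤ r)
    (hC : Fintype.card C = r) {V : Type*} (col : Sym2 V → C) (a : C) {s s' : Multiset (Sym2 V)}
    (hs : s.card = n)
    (h : s.countP (fun e => col e = a) + r * d ≤ s'.countP (fun e => col e = a)) :
    (∃ c, (n : ℝ) / r + d ≤ s.countP (fun e => col e = c)) ∨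
      (n : ℝ) / r + d ≤ s'.countP (fun e => col e = a) := by
  by_contra! hcon
  obtain ⟨h1, h2⟩ := hcon
  have hr0 : (0 : ℝ) < r := by positivity
  have hsum : ((∑ c, s.countP (fun e => col e = c) : ℕ) : ℝ) = n := by
    rw [sum_countP_eq_card, hs]
  rw [← Finset.add_sum_erase _ _ (Finset.mem_univ a)] at hsum
  push_cast at hsum
  have hle := Finset.sum_le_card_nsmul (Finset.univ.erase a)
    (fun c => ((s.countP (fun e => col e = c) : ℕ) : ℝ)) ((n : ℝ) / r + d)
    (fun c _ => (h1 c).le)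
  rw [Finset.card_erase_of_mem (Finset.mem_univ a), Finset.card_univ, hC, nsmul_eq_mul,
    Nat.cast_sub (by omega)] at hle
  have h' : ((s.countP (fun e => col e = a) : ℕ) : ℝ) + r * d ≤
      (s'.countP (fun e => col e = a) : ℕ) := by exact_mod_cast h
  have : (r : ℝ) * (n / r) = n := by field_simp
  push_cast at hle
  nlinarith

lemma exists_unbalanced_ordering (hr : 2 ≤ r) (hd : 0 < d) {G : SimpleGraph (Fin n)}
    [DecidableRel G.Adj] (hn : 0 < n)
    (hδ : ((1 : ℝ) / 2 + 1 / (2 * r)) * n + 6 * d * r ^ 2 ≤ G.minDegree)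
    (col : Sym2 (Fin n) → Fin r) :
    ∃ l : List (Fin n), (l.Nodup ∧ (∀ v, v ∈ l) ∧ ∀ e ∈ cycleEdges l, e ∈ G.edgeSet) ∧
      ∃ c, (n : ℝ) / r + d ≤ (cycleEdges l).countP (fun e => col e = c) := by
  obtain ⟨hreal, hnat⟩ := minDegree_bounds hr hδ
  have hD := G.minDegree_le_degree
  have hDn : G.minDegree < n := by
    simpa using (hD ⟨0, hn⟩).trans_lt (G.degree_lt_card_verts ⟨0, hn⟩)
  have hcard : Fintype.card (Fin n) = n := Fintype.card_fin n
  have hK1 : r * d ≤ d * r ^ 2 := by nlinarith [Nat.mul_le_mul_left (r * d) (show 1 ≤ r by omega)]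
  have hK4 : 4 * d ≤ d * r ^ 2 := by nlinarith [Nat.mul_le_mul_left d (Nat.pow_le_pow_left hr 2)]
  have hlen : ∀ {l : List (Fin n)}, l.Nodup → (∀ v, v ∈ l) → (cycleEdges l).card = n :=
    fun h1 h2 => by rw [card_cycleEdges, card_eq_length h1 h2, hcard]
  by_cases hgad : ∃ a, ∃ gs : List (Bowtie (Fin n)), gs.length = r * d ∧
      (∀ g ∈ gs, g.Gains G col a) ∧ (gs.flatMap Bowtie.verts).Nodup
  · obtain ⟨a, gs, hgl, hgs, hgd⟩ := hgad
    obtain ⟨l, l', hl, hl', hll'⟩ := exists_hamilton_pair hgs hgd hD (by rw [hcard]; omega)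
      (by rw [hcard]; omega)
    rw [hgl] at hll'
    rcases exists_unbalanced_of_pair hr (Fintype.card_fin r) col a (hlen hl.1 hl.2.1) hll' with h | h
    exacts [⟨l, hl, h⟩, ⟨l', hl', a, h⟩]
  · push Not at hgad
    have hcover : ∀ a, ∃ R : Finset (Fin n), R.card ≤ 5 * (r * d) ∧
        ∀ g : Bowtie (Fin n), g.Gains G col a → ∃ v ∈ g.verts, v ∈ R := fun a =>
      (exists_bowties_or_cover G col a (r * d)).resolve_left
        fun ⟨gs, h1, h2, h3⟩ => hgad a gs h1 h2 h3
    choose R hRc hR using hcover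
    have hRcard : (Finset.univ.biUnion R).card ≤ 5 * (d * r ^ 2) := by
      refine (Finset.card_biUnion_le_card_mul _ _ _ fun a _ => hRc a).trans (le_of_eq ?_)
      rw [Finset.card_univ, Fintype.card_fin]
      ring
    obtain ⟨a, I, hI, hmono⟩ := exists_independent_monochromatic (G := G) (col := col)
      (Finset.univ.biUnion R)
      (fun a g hg => by
        obtain ⟨v, hv, hvR⟩ := hR a g hg
        exact ⟨v, hv, Finset.mem_biUnion.2 ⟨a, Finset.mem_univ a, hvR⟩⟩)
      (fun x y S hS => exists_common_neighbor hD S (by rw [hcard]; omega) x y)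
      (by
        by_contra! hall
        have := Finset.card_le_card (fun x _ => hall x : Finset.univ ⊆ Finset.univ.biUnion R)
        rw [Finset.card_univ, hcard] at this
        omega)
    have hIcard := card_add_le_of_independent hD (by rw [hcard]; omega) I hI
    rw [hcard] at hIcard
    obtain ⟨l, h1, h2, -, h3⟩ := exists_hamilton_containing (G := G) ∅ hD
      (by rw [hcard, Finset.card_empty]; omega) (by rw [hcard]; omega) (by simp)
      (Finset.nodup_toList Finset.univ) (by simp) (by simp)
    refine ⟨l, ⟨h1, h2, h3⟩, a, ?_⟩
    have hbad := countP_cycleEdges_le (Finset.univ.biUnion R ∪ I)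
      (fun e => e ∈ G.edgeSet ∧ ¬ col e = a) (fun x y hxy => by
        by_contra! hcon
        simp only [Finset.mem_union, not_or] at hcon
        exact hxy.2 (hmono x y hcon.1.1 hcon.2.1 hcon.1.2 hcon.2.2 hxy.1)) h1
    have hsplit := Multiset.card_eq_countP_add_countP (fun e => col e = a) (cycleEdges l)
    rw [hlen h1 h2, Multiset.countP_congr (p := fun e => ¬ col e = a)
      (p' := fun e => e ∈ G.edgeSet ∧ ¬ col e = a) rfl
      (fun e he => by simp [h3 e he])] at hsplit
    have hun := Finset.card_union_le (Finset.univ.biUnion R) I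
    have hfin : 2 * G.minDegree ≤
        n + 10 * (d * r ^ 2) + (cycleEdges l).countP (fun e => col e = a) := by omega
    have hfin' : 2 * (G.minDegree : ℝ) ≤
        n + 10 * (d * r ^ 2) + ((cycleEdges l).countP (fun e => col e = a) : ℕ) := by
      exact_mod_cast hfin
    have hK4' : 4 * (d : ℝ) ≤ d * r ^ 2 := by exact_mod_cast hK4
    have hd0 : (0 : ℝ) ≤ d := by positivity
    linarith

end Main

end ColourBias

theorem colour_bias_hamilton {n r d : ℕ} (hn : 0 < n) (hr : 2 ≤ r) (hd : 0 < d)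
    (G : SimpleGraph (Fin n)) [DecidableRel G.Adj]
    (hδ : ((1 : ℝ) / 2 + 1 / (2 * r)) * n + 6 * d * r ^ 2 ≤ G.minDegree)
    (col : Sym2 (Fin n) → Fin r) :
    ∃ (v : Fin n) (C : G.Walk v v), C.IsHamiltonianCycle ∧
      ∃ c : Fin r, (C.edges.length : ℝ) / r + d ≤ colourCount col C.edges c := by
  obtain ⟨l, ⟨hl, hm, hG⟩, c, hc⟩ := ColourBias.exists_unbalanced_ordering hr hd hn hδ col
  have hlen : l.length = n := by rw [ColourBias.card_eq_length hl hm, Fintype.card_fin]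
  have hn3 : 3 ≤ n := by
    have h1 := (ColourBias.minDegree_bounds hr hδ).2
    have h2 : G.minDegree < n := by
      simpa using (G.minDegree_le_degree ⟨0, hn⟩).trans_lt (G.degree_lt_card_verts ⟨0, hn⟩)
    have : 0 < d * r ^ 2 := by positivity
    omega
  obtain ⟨v, p, hp, hE⟩ := ColourBias.exists_isHamiltonianCycle hl hm hG (by omega)
  refine ⟨v, p, hp, c, ?_⟩
  have h1 : p.edges.length = n := by
    rw [← Multiset.coe_card, hE, ColourBias.card_cycleEdges, hlen]
  have h2 : colourCount col p.edges c =
      (ColourBias.cycleEdges l).countP (fun e => col e = c) := by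
    rw [← hE, Multiset.coe_countP, colourCount]
  rw [h1, h2]
  exact hc
end

section
/- Let 0 < c < 1/4 and let n be a sufficiently large positive integer. If G is an n-vertex graph with minimum degree δ(G) ≥ (3/4 + c)·n, then for every 2-colouring of the edges of G there is a Hamilton cycle in G with at least (1/2 + c/64)·n edges of the same colour. -/
namespace ColourBias

section PairSum

variable {α : Type*}

/-- The sum of `f` over all pairs of consecutive entries of a list. -/
def pairSum (f : α → α → ℕ) : List α → ℕ
  | [] => 0
  | [_] => 0
  | x :: y :: l => f x y + pairSum f (y :: l)

@[simp] lemma pairSum_singleton (f : α → α → ℕ) (x : α) : pairSum f [x] = 0 := rfl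

@[simp] lemma pairSum_cons_cons (f : α → α → ℕ) (x y : α) (l : List α) :
    pairSum f (x :: y :: l) = f x y + pairSum f (y :: l) := rfl

lemma pairSum_append_cons (f : α → α → ℕ) (a : List α) (u : α) (b : List α) :
    pairSum f (a ++ u :: b) = pairSum f (a ++ [u]) + pairSum f (u :: b) := by
  induction a with
  | nil => simp
  | cons x a ih =>
    cases a with
    | nil => simp
    | cons y a => simp only [List.cons_append, pairSum_cons_cons] at ih ⊢; omega

lemma pairSum_reverse {f : α → α → ℕ} (hf : ∀ x y, f x y = f y x) (l : List α) :
    pairSum f l.reverse = pairSum f l := by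
  induction l with
  | nil => rfl
  | cons x l ih =>
    cases l with
    | nil => rfl
    | cons y l =>
      have h := pairSum_append_cons f l.reverse y [x]
      simp only [List.reverse_cons, List.append_assoc, List.cons_append, List.nil_append,
        pairSum_cons_cons, pairSum_singleton] at h ih ⊢
      rw [h, ih, hf x y]; omega

lemma pairSum_mono {f g : α → α → ℕ} (h : ∀ x y, f x y ≤ g x y) (l : List α) :
    pairSum f l ≤ pairSum g l := by
  induction l with
  | nil => simp [pairSum]
  | cons x l ih =>
    cases l with
    | nil => simp
    | cons y l => have := h x y; simp only [pairSum_cons_cons]; omega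

lemma pairSum_add (f g : α → α → ℕ) (l : List α) :
    pairSum (fun x y => f x y + g x y) l = pairSum f l + pairSum g l := by
  induction l with
  | nil => simp [pairSum]
  | cons x l ih =>
    cases l with
    | nil => simp
    | cons y l => simp only [pairSum_cons_cons]; omega

lemma pairSum_one (x : α) (l : List α) : pairSum (fun _ _ => 1) (x :: l) = l.length := by
  induction l generalizing x with
  | nil => simp
  | cons y l ih => simp [ih]; omega

lemma pairSum_vertex_le (g h : α → ℕ) (l : List α) :
    pairSum (fun x y => g x + h y) l ≤ (l.dropLast.map g).sum + (l.tail.map h).sum := by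
  induction l with
  | nil => simp [pairSum]
  | cons x l ih =>
    cases l with
    | nil => simp
    | cons y l =>
      simp only [pairSum_cons_cons, List.dropLast_cons_cons, List.map_cons, List.sum_cons,
        List.tail_cons] at ih ⊢
      omega

lemma exists_pair_ne_zero {f : α → α → ℕ} {l : List α} (h : pairSum f l ≠ 0) :
    ∃ a u v b, l = a ++ u :: v :: b ∧ f u v ≠ 0 := by
  induction l with
  | nil => simp [pairSum] at h
  | cons x l ih =>
    cases l with
    | nil => simp at h
    | cons y l =>
      by_cases hxy : f x y = 0
      · obtain ⟨a, u, v, b, hl, hf⟩ := ih (by simpa [hxy] using h)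
        exact ⟨x :: a, u, v, b, by simp [hl], hf⟩
      · exact ⟨[], x, y, l, rfl, hxy⟩

lemma exists_pair_eq_zero {f : α → α → ℕ} {l : List α} (h : pairSum f l + 1 < l.length) :
    ∃ a u v b, l = a ++ u :: v :: b ∧ f u v = 0 := by
  induction l with
  | nil => simp at h
  | cons x l ih =>
    cases l with
    | nil => simp at h
    | cons y l =>
      by_cases hxy : f x y = 0
      · exact ⟨[], x, y, l, rfl, hxy⟩
      · simp only [pairSum_cons_cons, List.length_cons] at h ih
        obtain ⟨a, u, v, b, hl, hf⟩ := ih (by omega)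
        exact ⟨x :: a, u, v, b, by simp [hl], hf⟩

/-- The sum of `f` over all cyclically consecutive pairs of entries of a list. -/
def cycleSum (f : α → α → ℕ) (l : List α) : ℕ := pairSum f (l ++ l.head?.toList)

lemma cycleSum_cons (f : α → α → ℕ) (x : α) (l : List α) :
    cycleSum f (x :: l) = pairSum f (x :: l ++ [x]) := rfl

lemma cycleSum_concat (f : α → α → ℕ) (v u : α) (c : List α) :
    cycleSum f (v :: c ++ [u]) = pairSum f (v :: c ++ [u]) + f u v := by
  have h := pairSum_append_cons f (v :: c) u [v]
  simpa [cycleSum] using h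

lemma cycleSum_append_comm (f : α → α → ℕ) (a b : List α) :
    cycleSum f (a ++ b) = cycleSum f (b ++ a) := by
  cases a with
  | nil => simp
  | cons x a =>
    cases b with
    | nil => simp
    | cons u b =>
      have h₁ := pairSum_append_cons f (x :: a) u (b ++ [x])
      have h₂ := pairSum_append_cons f (u :: b) x (a ++ [u])
      simp only [List.cons_append, List.append_assoc, cycleSum_cons] at h₁ h₂ ⊢
      omega

lemma exists_rotation_of_cycleSum_ne_zero {f : α → α → ℕ} {l : List α} (hl : 2 ≤ l.length)
    (h : cycleSum f l ≠ 0) :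
    ∃ v c u, (v :: c ++ [u]).Perm l ∧ cycleSum f (v :: c ++ [u]) = cycleSum f l ∧ f u v ≠ 0 := by
  obtain _ | ⟨x, m⟩ := l
  · simp at hl
  obtain ⟨a, u, v, b, hab, huv⟩ := exists_pair_ne_zero h
  simp only [List.head?_cons, Option.toList_some] at hab
  obtain rfl | ⟨b', z, rfl⟩ := List.eq_nil_or_concat' b
  · have hab' : x :: m ++ [x] = (a ++ [u]) ++ [v] := by simpa using hab
    obtain ⟨h₁, h₂⟩ := List.append_inj' hab' rfl
    obtain rfl : x = v := by simpa using h₂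
    obtain _ | ⟨y, a⟩ := a
    · simp at h₁; simp [h₁] at hl
    · obtain rfl : x = y := by simpa using congrArg List.head? h₁
      exact ⟨x, a, u, by rw [h₁], by rw [h₁], huv⟩
  · have hab' : x :: m ++ [x] = ((a ++ [u]) ++ (v :: b')) ++ [z] := by simpa using hab
    obtain ⟨h₁, -⟩ := List.append_inj' hab' rfl
    refine ⟨v, b' ++ a, u, ?_, ?_, huv⟩
    · rw [h₁]
      have : v :: (b' ++ a) ++ [u] = (v :: b') ++ (a ++ [u]) := by simp
      rw [this]
      exact List.perm_append_comm
    · rw [h₁, cycleSum_append_comm f (a ++ [u])]; simp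

/-- Ore's theorem in list form, proved by reversing segments to remove bad pairs:
`f u v = 0` means that `u` and `v` are adjacent. -/
theorem exists_perm_cycleSum_eq_zero {f : α → α → ℕ} (hf : ∀ x y, f x y = f y x) {k : ℕ}
    (l : List α) (hk : 2 * k + 1 < l.length) (hdeg : ∀ u ∈ l, (l.map (f · u)).sum ≤ k) :
    ∃ l' : List α, l'.Perm l ∧ cycleSum f l' = 0 := by
  suffices H : ∀ N, ∀ m : List α, m.Perm l → cycleSum f m ≤ N →
      ∃ l' : List α, l'.Perm l ∧ cycleSum f l' = 0 from H _ l (List.Perm.refl l) le_rfl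
  intro N
  induction N with
  | zero => exact fun m hm h => ⟨m, hm, by omega⟩
  | succ N ih =>
    intro m hm hN
    by_cases h0 : cycleSum f m = 0
    · exact ⟨m, hm, h0⟩
    obtain ⟨v, c, u, hp, hc, huv⟩ :=
      exists_rotation_of_cycleSum_ne_zero (by have := hm.length_eq; omega) h0
    have hpl := hp.trans hm
    have hsum : ∀ w ∈ l, ((v :: c ++ [u]).map (f · w)).sum ≤ k := fun w hw =>
      ((hpl.map (f · w)).sum_eq).trans_le (hdeg w hw)
    have hu := hsum u (hpl.subset (by simp))
    have hv := hsum v (hpl.subset (by simp))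
    have hle := pairSum_vertex_le (f · u) (f · v) (v :: c ++ [u])
    have hlen := hpl.length_eq
    obtain ⟨a, p, q, b, hab, hpq⟩ := exists_pair_eq_zero
      (f := fun x y => f x u + f y v) (l := v :: c ++ [u]) (by
        rw [List.dropLast_concat] at hle
        simp only [List.map_append, List.map_cons, List.sum_append, List.sum_cons, List.tail_cons,
          List.cons_append] at hle hu hv hlen ⊢
        omega)
    have hpu : f p u = 0 := by omega
    have hqv : f q v = 0 := by omega
    obtain _ | ⟨y, a⟩ := a
    · obtain ⟨rfl, -⟩ : v = p ∧ _ := by simpa using hab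
      exact absurd (hf _ _ ▸ hpu) huv
    obtain rfl : v = y := by simpa using congrArg List.head? hab
    obtain rfl | ⟨b', z, rfl⟩ := List.eq_nil_or_concat' b
    · have hab' : v :: c ++ [u] = (v :: a ++ [p]) ++ [q] := by simpa using hab
      obtain rfl : u = q := by simpa using (List.append_inj' hab' rfl).2
      exact absurd hqv huv
    have hab' : v :: c ++ [u] = (v :: a ++ p :: q :: b') ++ [z] := by simpa using hab
    obtain rfl : u = z := by simpa using (List.append_inj' hab' rfl).2
    refine ih (v :: (a ++ p :: u :: b'.reverse) ++ [q]) (List.Perm.trans ?_ hpl) ?_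
    · rw [hab]
      have h₁ : v :: (a ++ p :: u :: b'.reverse) ++ [q]
          = (v :: a ++ [p]) ++ (q :: (b' ++ [u])).reverse := by simp
      have h₂ : v :: a ++ p :: q :: (b' ++ [u])
          = (v :: a ++ [p]) ++ (q :: (b' ++ [u])) := by simp
      rw [h₁, h₂]
      exact List.Perm.append_left _ (List.reverse_perm _)
    · have e₁ := cycleSum_concat f v u c
      have e₂ := cycleSum_concat f v q (a ++ p :: u :: b'.reverse)
      have e₃ := pairSum_append_cons f (v :: a) p (q :: (b' ++ [u]))
      have e₄ := pairSum_append_cons f (v :: a) p (u :: b'.reverse ++ [q])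
      have e₅ := pairSum_reverse hf (q :: (b' ++ [u]))
      have e₆ : v :: (a ++ p :: u :: b'.reverse) ++ [q]
          = v :: a ++ p :: (u :: b'.reverse ++ [q]) := by simp
      have e₇ : (q :: (b' ++ [u])).reverse = u :: b'.reverse ++ [q] := by simp
      rw [← hc, e₁, hab] at hN
      rw [e₇] at e₅
      rw [e₂, e₆, e₄]
      simp only [List.cons_append, pairSum_cons_cons] at hN e₃ e₅ ⊢
      omega

end PairSum

section HamiltonCycles

variable {V : Type*}

open Classical in
/-- The indicator function of non-adjacency. -/
noncomputable def nonAdj (G : SimpleGraph V) (x y : V) : ℕ := if G.Adj x y then 0 else 1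

/-- The indicator function of the pairs coloured `i`. -/
def colourInd (col : Sym2 V → Fin 2) (i : Fin 2) (x y : V) : ℕ := if col s(x, y) = i then 1 else 0

variable {G : SimpleGraph V}

lemma nonAdj_eq_zero {x y : V} : nonAdj G x y = 0 ↔ G.Adj x y := by
  simp [nonAdj]

lemma nonAdj_comm (x y : V) : nonAdj G x y = nonAdj G y x := by
  classical exact if_congr (G.adj_comm x y) rfl rfl

lemma colourInd_comm (col : Sym2 V → Fin 2) (i : Fin 2) (x y : V) :
    colourInd col i x y = colourInd col i y x := by
  simp [colourInd, Sym2.eq_swap]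

lemma colourInd_le_one (col : Sym2 V → Fin 2) (i : Fin 2) (x y : V) : colourInd col i x y ≤ 1 := by
  unfold colourInd; split_ifs <;> simp

lemma colourInd_add (col : Sym2 V → Fin 2) (x y : V) :
    colourInd col 0 x y + colourInd col 1 x y = 1 := by
  unfold colourInd; generalize col s(x, y) = j; fin_cases j <;> simp

lemma exists_walk_of_pairSum_eq_zero (x y : V) (m : List V)
    (h : pairSum (nonAdj G) (x :: m ++ [y]) = 0) :
    ∃ p : G.Walk x y, p.support = x :: m ++ [y] := by
  induction m generalizing x with
  | nil =>
    have hxy : G.Adj x y := nonAdj_eq_zero.1 (by simpa using h)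
    exact ⟨.cons hxy .nil, by simp⟩
  | cons z m ih =>
    simp only [List.cons_append, pairSum_cons_cons, Nat.add_eq_zero_iff] at h ih
    obtain ⟨p, hp⟩ := ih z h.2
    exact ⟨.cons (nonAdj_eq_zero.1 h.1) p, by simp [hp]⟩

lemma colourCount_edges (col : Sym2 V → Fin 2) (i : Fin 2) {x y : V} (p : G.Walk x y) :
    colourCount col p.edges i = pairSum (colourInd col i) p.support := by
  induction p with
  | nil => simp [colourCount]
  | @cons u v w h p ih =>
    rw [SimpleGraph.Walk.edges_cons, SimpleGraph.Walk.support_cons, ← p.cons_tail_support,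
      pairSum_cons_cons, p.cons_tail_support, ← ih, colourCount, List.countP_cons, add_comm]
    simp [colourInd, colourCount]

/-- The list `l` is a cyclic ordering of all vertices with consecutive vertices adjacent. -/
def IsHamiltonList (G : SimpleGraph V) (l : List V) : Prop :=
  l.Nodup ∧ (∀ v, v ∈ l) ∧ cycleSum (nonAdj G) l = 0

lemma IsHamiltonList.length_eq [Fintype V] {l : List V} (hl : IsHamiltonList G l) :
    l.length = Fintype.card V := by
  classical
  rw [← List.toFinset_card_of_nodup hl.1, ← Finset.card_univ]
  congr 1; ext v; simp [hl.2.1]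

lemma IsHamiltonList.exists_isHamiltonianCycle [Fintype V] [DecidableEq V] {l : List V}
    (hl : IsHamiltonList G l) (hcard : 3 ≤ Fintype.card V) :
    ∃ (v : V) (C : G.Walk v v), C.IsHamiltonianCycle ∧
      ∀ (col : Sym2 V → Fin 2) (i : Fin 2),
        colourCount col C.edges i = cycleSum (colourInd col i) l := by
  have hlen := hl.length_eq
  obtain _ | ⟨x, m⟩ := l
  · simp at hlen; omega
  obtain ⟨C, hC⟩ := exists_walk_of_pairSum_eq_zero x x m hl.2.2
  have hClen : C.length = Fintype.card V := by
    have := C.length_support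
    rw [hC] at this
    simp only [List.length_append, List.length_cons, List.length_nil] at this hlen
    omega
  have hnil : ¬ C.Nil := by
    rw [SimpleGraph.Walk.not_nil_iff_lt_length]; omega
  refine ⟨x, C, ?_, fun col i => by rw [colourCount_edges, hC]; rfl⟩
  rw [SimpleGraph.Walk.isHamiltonianCycle_iff_isCycle_and_length_eq,
    SimpleGraph.Walk.isCycle_iff_isPath_tail_and_le_length, SimpleGraph.Walk.isPath_def,
    SimpleGraph.Walk.support_tail_of_not_nil _ hnil, hC]
  refine ⟨⟨?_, by omega⟩, hClen⟩
  have hp : (m ++ [x]).Perm (x :: m) := List.perm_append_singleton x m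
  simpa using hp.nodup_iff.2 hl.1

end HamiltonCycles

section Blocks

variable {V : Type*}

/-- A piece of a Hamilton cycle in two versions with the same end vertices. -/
structure Block (V : Type*) where
  first : V
  last : V
  upper : List V
  lower : List V

/-- Both versions of the block are paths of `G` from `first` to `last` on the same vertices. -/
structure Block.IsBlock (G : SimpleGraph V) (B : Block V) : Prop where
  upper_first : ∃ s, B.upper = B.first :: s
  upper_last : ∃ s, B.upper = s ++ [B.last]
  lower_first : ∃ s, B.lower = B.first :: s
  lower_last : ∃ s, B.lower = s ++ [B.last]
  perm : B.lower.Perm B.upper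
  upper_adj : pairSum (nonAdj G) B.upper = 0
  lower_adj : pairSum (nonAdj G) B.lower = 0

/-- A block on five vertices whose upper version has larger weight than its lower version. -/
structure Block.IsGadget (G : SimpleGraph V) (f : V → V → ℕ) (B : Block V) : Prop
    extends B.IsBlock G where
  length_eq : B.upper.length = 5
  nodup : B.upper.Nodup
  lt : pairSum f B.lower < pairSum f B.upper

/-- The block consisting of a single vertex. -/
def Block.single (v : V) : Block V := ⟨v, v, [v], [v]⟩

lemma Block.isBlock_single (G : SimpleGraph V) (v : V) : (Block.single v).IsBlock G where
  upper_first := ⟨[], rfl⟩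
  upper_last := ⟨[], rfl⟩
  lower_first := ⟨[], rfl⟩
  lower_last := ⟨[], rfl⟩
  perm := .refl _
  upper_adj := rfl
  lower_adj := rfl

lemma pairSum_flatMap {β : Type*} (f : V → V → ℕ) {st en : β → V} {blk : β → List V} (y : β)
    (m : List β) (x : β) (hst : ∀ b ∈ x :: m, ∃ s, blk b = st b :: s)
    (hen : ∀ b ∈ x :: m, ∃ s, blk b = s ++ [en b]) :
    pairSum f ((x :: m).flatMap blk ++ [st y]) =
      ((x :: m).map fun b => pairSum f (blk b)).sum +
        pairSum (fun b b' => f (en b) (st b')) (x :: m ++ [y]) := by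
  induction m generalizing x with
  | nil =>
    obtain ⟨s, hs⟩ := hen x (by simp)
    have := pairSum_append_cons f s (en x) [st y]
    simpa [hs] using this
  | cons z m ih =>
    obtain ⟨s, hs⟩ := hen x (by simp)
    obtain ⟨r, hr⟩ := hst z (by simp)
    have ih' := ih z (fun b hb => hst b (List.mem_cons_of_mem _ hb))
      (fun b hb => hen b (List.mem_cons_of_mem _ hb))
    have h := pairSum_append_cons f s (en x) (st z :: (r ++ m.flatMap blk ++ [st y]))
    simp only [List.flatMap_cons, List.map_cons, List.sum_cons, hr, hs, List.append_assoc,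
      List.cons_append, List.nil_append, pairSum_cons_cons] at ih' h ⊢
    omega

lemma cycleSum_flatMap {β : Type*} (f : V → V → ℕ) {st en : β → V} {blk : β → List V} (l : List β)
    (hst : ∀ b ∈ l, ∃ s, blk b = st b :: s) (hen : ∀ b ∈ l, ∃ s, blk b = s ++ [en b]) :
    cycleSum f (l.flatMap blk) =
      (l.map fun b => pairSum f (blk b)).sum + cycleSum (fun b b' => f (en b) (st b')) l := by
  obtain _ | ⟨x, m⟩ := l
  · rfl
  rw [cycleSum_cons, ← pairSum_flatMap f x m x hst hen, cycleSum]
  obtain ⟨s, hs⟩ := hst x (by simp)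
  simp [hs]

variable {G : SimpleGraph V}

lemma sum_map_first_le (g : V → ℕ) {bs : List (Block V)} (hbs : ∀ B ∈ bs, B.IsBlock G) :
    (bs.map fun B => g B.first).sum ≤ ((bs.flatMap Block.upper).map g).sum := by
  induction bs with
  | nil => simp
  | cons B bs ih =>
    obtain ⟨s, hs⟩ := (hbs B (by simp)).upper_first
    have := ih fun B hB => hbs B (List.mem_cons_of_mem _ hB)
    simp only [List.map_cons, List.sum_cons, List.flatMap_cons, hs, List.cons_append,
      List.map_append, List.sum_append]
    omega

lemma sum_map_last_le (g : V → ℕ) {bs : List (Block V)} (hbs : ∀ B ∈ bs, B.IsBlock G) :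
    (bs.map fun B => g B.last).sum ≤ ((bs.flatMap Block.upper).map g).sum := by
  induction bs with
  | nil => simp
  | cons B bs ih =>
    obtain ⟨s, hs⟩ := (hbs B (by simp)).upper_last
    have := ih fun B hB => hbs B (List.mem_cons_of_mem _ hB)
    simp only [List.map_cons, List.sum_cons, List.flatMap_cons, hs, List.map_nil, List.sum_nil,
      List.map_append, List.sum_append]
    omega

lemma sum_map_le_sum_univ [Fintype V] (g : V → ℕ) {l : List V} (hl : l.Nodup) :
    (l.map g).sum ≤ ∑ v, g v := by
  classical
  rw [← List.sum_toFinset g hl]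
  exact Finset.sum_le_sum_of_subset (Finset.subset_univ _)

lemma flatMap_perm_flatMap {α β : Type*} {f g : α → List β} {l : List α}
    (h : ∀ a ∈ l, (f a).Perm (g a)) : (l.flatMap f).Perm (l.flatMap g) := by
  induction l with
  | nil => simp
  | cons a l ih =>
    simp only [List.flatMap_cons]
    exact (h a (by simp)).append (ih fun b hb => h b (List.mem_cons_of_mem _ hb))

/-- If every vertex has few non-neighbours, any partition of the vertices into blocks can be
arranged into a Hamilton cycle, on which all blocks may be switched simultaneously. -/
theorem exists_cycles_of_blocks [Fintype V] {bs : List (Block V)} (hbs : ∀ B ∈ bs, B.IsBlock G)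
    (hnodup : (bs.flatMap Block.upper).Nodup) (hmem : ∀ v, v ∈ bs.flatMap Block.upper) {k : ℕ}
    (hdeg : ∀ v, ∑ w, nonAdj G v w ≤ k) (hk : 4 * k + 1 < bs.length) :
    ∃ U L : List V, IsHamiltonList G U ∧ IsHamiltonList G L ∧
      ∀ f : V → V → ℕ, ∃ c,
        cycleSum f U = (bs.map fun B => pairSum f B.upper).sum + c ∧
        cycleSum f L = (bs.map fun B => pairSum f B.lower).sum + c := by
  obtain ⟨l, hl, hl0⟩ := exists_perm_cycleSum_eq_zero
    (f := fun B B' : Block V => nonAdj G B.last B'.first + nonAdj G B'.last B.first)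
    (fun _ _ => add_comm _ _) (k := 2 * k) bs (by omega) (fun u hu => by
      have h₁ := (sum_map_last_le (nonAdj G u.first) hbs).trans
        ((sum_map_le_sum_univ _ hnodup).trans (hdeg _))
      have h₂ := (sum_map_first_le (nonAdj G u.last) hbs).trans
        ((sum_map_le_sum_univ _ hnodup).trans (hdeg _))
      rw [List.sum_map_add]
      simp only [nonAdj_comm _ u.first]
      omega)
  have hlB : ∀ B ∈ l, B.IsBlock G := fun B hB => hbs B (hl.subset hB)
  have hU : (l.flatMap Block.upper).Perm (bs.flatMap Block.upper) := hl.flatMap_right _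
  have hL : (l.flatMap Block.lower).Perm (bs.flatMap Block.upper) :=
    (flatMap_perm_flatMap fun B hB => (hlB B hB).perm).trans hU
  have hsumU (f : V → V → ℕ) := cycleSum_flatMap f l (fun B hB => (hlB B hB).upper_first)
    (fun B hB => (hlB B hB).upper_last)
  have hsumL (f : V → V → ℕ) := cycleSum_flatMap f l (fun B hB => (hlB B hB).lower_first)
    (fun B hB => (hlB B hB).lower_last)
  have hzero : cycleSum (fun B B' : Block V => nonAdj G B.last B'.first) l = 0 :=
    Nat.le_zero.1 ((pairSum_mono (fun _ _ => Nat.le_add_right _ _) _).trans hl0.le)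
  refine ⟨l.flatMap Block.upper, l.flatMap Block.lower,
    ⟨hU.nodup_iff.2 hnodup, fun v => hU.mem_iff.2 (hmem v), ?_⟩,
    ⟨hL.nodup_iff.2 hnodup, fun v => hL.mem_iff.2 (hmem v), ?_⟩,
    fun f => ⟨cycleSum (fun B B' => f B.last B'.first) l, ?_, ?_⟩⟩
  · rw [hsumU, hzero, add_zero, List.sum_eq_zero_iff]
    simpa using fun B hB => (hlB B hB).upper_adj
  · rw [hsumL, hzero, add_zero, List.sum_eq_zero_iff]
    simpa using fun B hB => (hlB B hB).lower_adj
  · rw [hsumU, (hl.map _).sum_eq]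
  · rw [hsumL, (hl.map _).sum_eq]

/-- Either there are `k` disjoint gadgets, or few vertices meet all gadgets. -/
lemma exists_gadgets_or_cover (G : SimpleGraph V) (f : V → V → ℕ) (k : ℕ) :
    (∃ gs : List (Block V), gs.length = k ∧ (∀ B ∈ gs, B.IsGadget G f) ∧
      (gs.flatMap Block.upper).Nodup) ∨
    ∃ S : Finset V, S.card ≤ 5 * k ∧ ∀ B : Block V, B.IsGadget G f → ∃ v ∈ B.upper, v ∈ S := by
  classical
  induction k with
  | zero => exact .inl ⟨[], by simp⟩
  | succ k ih =>
    obtain ⟨gs, hlen, hgs, hnodup⟩ | ⟨S, hS, hcov⟩ := ih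
    · by_cases h : ∃ B : Block V, B.IsGadget G f ∧ ∀ v ∈ B.upper, v ∉ gs.flatMap Block.upper
      · obtain ⟨B, hB, hBd⟩ := h
        refine .inl ⟨B :: gs, by simp [hlen], by simpa using ⟨hB, hgs⟩, ?_⟩
        rw [List.flatMap_cons, List.nodup_append']
        exact ⟨hB.nodup, hnodup, fun v h₁ h₂ => hBd v h₁ h₂⟩
      · push Not at h
        refine .inr ⟨(gs.flatMap Block.upper).toFinset, ?_, by simpa using h⟩
        refine (List.toFinset_card_le _).trans ?_
        rw [List.length_flatMap, List.map_congr_left fun B hB => (hgs B hB).length_eq]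
        simp [hlen]; omega
    · exact .inr ⟨S, by omega, hcov⟩

/-- A four-cycle of distinct vertices with unequal opposite sums yields a gadget. -/
lemma exists_gadget {f : V → V → ℕ} (hf : ∀ x y, f x y = f y x) {x y a b d : V}
    (hnodup : [a, x, b, y, d].Nodup) (hxa : G.Adj x a) (hxb : G.Adj x b) (hxd : G.Adj x d)
    (hya : G.Adj y a) (hyb : G.Adj y b) (hyd : G.Adj y d)
    (hne : f x a + f y d ≠ f x d + f y a) :
    ∃ B : Block V, B.IsGadget G f ∧ ∀ v ∈ B.upper, v ∈ [a, x, b, y, d] := by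
  wlog h : f x d + f y a < f x a + f y d generalizing x y
  · obtain ⟨B, hB, hBm⟩ := this (x := y) (y := x) (by simp at hnodup ⊢; tauto) hya hyb hyd hxa hxb
      hxd (by omega) (by omega)
    exact ⟨B, hB, fun v hv => by have := hBm v hv; simp at this ⊢; tauto⟩
  refine ⟨⟨a, d, [a, x, b, y, d], [a, y, b, x, d]⟩, ⟨⟨⟨_, rfl⟩, ⟨[a, x, b, y], rfl⟩, ⟨_, rfl⟩,
    ⟨[a, y, b, x], rfl⟩, ?_, ?_, ?_⟩, rfl, hnodup, ?_⟩, fun v hv => hv⟩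
  · refine .cons _ ?_
    exact ((List.reverse_perm [y, b, x]).symm.append_right [d])
  · simp [nonAdj_eq_zero, hxa.symm, hxb, hyb.symm, hyd]
  · simp [nonAdj_eq_zero, hya.symm, hyb, hxb.symm, hxd]
  · simp only [pairSum_cons_cons, pairSum_singleton, hf a, hf b]
    omega

end Blocks

section Counting

variable {V : Type*} {G : SimpleGraph V}

lemma cycleSum_mono {f g : V → V → ℕ} (h : ∀ x y, f x y ≤ g x y) (l : List V) :
    cycleSum f l ≤ cycleSum g l :=
  pairSum_mono h _

lemma cycleSum_add (f g : V → V → ℕ) (l : List V) :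
    cycleSum (fun x y => f x y + g x y) l = cycleSum f l + cycleSum g l :=
  pairSum_add f g _

lemma cycleSum_one (l : List V) : cycleSum (fun _ _ => 1) l = l.length := by
  obtain _ | ⟨x, m⟩ := l
  · rfl
  · simpa [cycleSum_cons] using pairSum_one x (m ++ [x])

lemma cycleSum_vertex_le (g : V → ℕ) (l : List V) :
    cycleSum (fun x y => g x + g y) l ≤ 2 * (l.map g).sum := by
  obtain _ | ⟨x, m⟩ := l
  · simp [cycleSum, pairSum]
  · have h := pairSum_vertex_le g g (x :: m ++ [x])
    rw [List.dropLast_concat] at h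
    simp only [List.cons_append, List.tail_cons, List.map_append, List.map_cons, List.map_nil,
      List.sum_append, List.sum_cons, List.sum_nil, cycleSum_cons] at h ⊢
    omega

variable [Fintype V]

lemma IsHamiltonList.cycleSum_colourInd_add {l : List V} (hl : IsHamiltonList G l)
    (col : Sym2 V → Fin 2) :
    cycleSum (colourInd col 0) l + cycleSum (colourInd col 1) l = Fintype.card V := by
  simp only [← cycleSum_add, colourInd_add, cycleSum_one, hl.length_eq]

/-- If all edges avoiding `T` are counted by `f`, then a Hamilton cycle has large `f`-sum. -/
lemma IsHamiltonList.card_le_cycleSum_add {l : List V} (hl : IsHamiltonList G l) {f : V → V → ℕ}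
    {T : Finset V} (hT : ∀ x y, G.Adj x y → x ∉ T → y ∉ T → 1 ≤ f x y) :
    Fintype.card V ≤ cycleSum f l + 2 * T.card := by
  classical
  let g : V → ℕ := fun x => if x ∈ T then 1 else 0
  have hle : cycleSum (fun _ _ => 1) l ≤
      cycleSum (fun x y => f x y + ((g x + g y) + nonAdj G x y)) l := by
    refine cycleSum_mono (fun x y => ?_) l
    by_cases hxy : G.Adj x y
    · by_cases hx : x ∈ T
      · simp only [g, hx, if_true]; omega
      · by_cases hy : y ∈ T
        · simp only [g, hy, if_true]; omega
        · have := hT x y hxy hx hy; omega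
    · have : nonAdj G x y = 1 := by simp [nonAdj, hxy]
      omega
  have hg : (l.map g).sum ≤ T.card := (sum_map_le_sum_univ g hl.1).trans (by simp [g])
  have hv := cycleSum_vertex_le g l
  rw [cycleSum_add, cycleSum_add (fun x y => g x + g y), cycleSum_one, hl.length_eq, hl.2.2] at hle
  omega

lemma exists_cycles_of_gadgets {f : V → V → ℕ} {gs : List (Block V)}
    (hgs : ∀ B ∈ gs, B.IsGadget G f) (hnodup : (gs.flatMap Block.upper).Nodup) {k : ℕ}
    (hdeg : ∀ v, ∑ w, nonAdj G v w ≤ k) (hk : 4 * k + 1 + 4 * gs.length < Fintype.card V) :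
    ∃ U L : List V, IsHamiltonList G U ∧ IsHamiltonList G L ∧
      cycleSum f L + gs.length ≤ cycleSum f U := by
  classical
  set T := (gs.flatMap Block.upper).toFinset with hT
  have hTcard : T.card = 5 * gs.length := by
    rw [hT, List.toFinset_card_of_nodup hnodup, List.length_flatMap,
      List.map_congr_left fun B hB => (hgs B hB).length_eq]
    simp [mul_comm]
  set bs := gs ++ Tᶜ.toList.map Block.single with hbs
  have hflat : bs.flatMap Block.upper = gs.flatMap Block.upper ++ Tᶜ.toList := by
    simp [hbs, List.flatMap_append, List.flatMap_map, Block.single]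
  have hcard := T.card_add_card_compl
  obtain ⟨U, L, hU, hL, hsum⟩ := exists_cycles_of_blocks (G := G) (bs := bs) (k := k)
    (fun B hB => by
      rw [hbs, List.mem_append, List.mem_map] at hB
      obtain hB | ⟨v, -, rfl⟩ := hB
      · exact (hgs B hB).toIsBlock
      · exact Block.isBlock_single G v)
    (by
      rw [hflat, List.nodup_append']
      refine ⟨hnodup, Finset.nodup_toList _, fun v h₁ h₂ => ?_⟩
      rw [Finset.mem_toList, Finset.mem_compl, hT, List.mem_toFinset] at h₂
      exact h₂ h₁)
    (fun v => by
      rw [hflat, List.mem_append, Finset.mem_toList, Finset.mem_compl, hT, List.mem_toFinset]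
      exact em _)
    hdeg (by simp only [hbs, List.length_append, List.length_map, Finset.length_toList]; omega)
  refine ⟨U, L, hU, hL, ?_⟩
  obtain ⟨c, hc₁, hc₂⟩ := hsum f
  have hgain : ∀ gs : List (Block V), (∀ B ∈ gs, B.IsGadget G f) →
      (gs.map fun B => pairSum f B.lower).sum + gs.length ≤
        (gs.map fun B => pairSum f B.upper).sum := by
    intro gs hgs
    induction gs with
    | nil => simp
    | cons B gs ih =>
      have h₁ := (hgs B (by simp)).lt
      have h₂ := ih fun B hB => hgs B (List.mem_cons_of_mem _ hB)
      simp only [List.map_cons, List.sum_cons, List.length_cons]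
      omega
  have hfin := hgain gs hgs
  simp only [hbs, List.map_append, List.sum_append, List.map_map] at hc₁ hc₂
  have hs : ((fun B : Block V => pairSum f B.lower) ∘ Block.single) =
      (fun B : Block V => pairSum f B.upper) ∘ Block.single := rfl
  rw [hs] at hc₂
  omega

lemma exists_common_neighbour {k : ℕ} (hdeg : ∀ v, ∑ w, nonAdj G v w ≤ k) {T : Finset V}
    (hT : 3 * k + T.card < Fintype.card V) (u v w : V) :
    ∃ z ∉ T, G.Adj u z ∧ G.Adj v z ∧ G.Adj w z := by
  classical
  by_contra! h
  have hle : ∑ _z : V, 1 ≤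
      ∑ z, (nonAdj G u z + nonAdj G v z + nonAdj G w z + if z ∈ T then 1 else 0) := by
    refine Finset.sum_le_sum fun z _ => ?_
    have := h z
    unfold nonAdj
    split_ifs <;> simp_all
  have hc : ∑ z, (if z ∈ T then 1 else 0) = T.card := by simp
  simp only [Finset.sum_add_distrib, hc, Finset.card_univ, Finset.sum_const, smul_eq_mul,
    mul_one] at hle
  have := hdeg u
  have := hdeg v
  have := hdeg w
  omega

lemma card_le_of_independent {k : ℕ} (hdeg : ∀ v, ∑ w, nonAdj G v w ≤ k) {A : Finset V}
    (hA : ∀ x ∈ A, ∀ y ∈ A, ¬ G.Adj x y) : A.card ≤ k := by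
  obtain rfl | ⟨x, hx⟩ := A.eq_empty_or_nonempty
  · simp
  calc A.card = ∑ w ∈ A, nonAdj G x w := by
        rw [Finset.card_eq_sum_ones]
        exact Finset.sum_congr rfl fun w hw => by simp [nonAdj, hA x hx w hw]
    _ ≤ ∑ w, nonAdj G x w := Finset.sum_le_sum_of_subset (Finset.subset_univ _)
    _ ≤ k := hdeg x

/-- If all gadgets meet a small set `S`, then outside `S` and a further independent set, all edges
have the same value under `f`. -/
lemma exists_independent_of_cover {f : V → V → ℕ} (hf : ∀ x y, f x y = f y x)
    (hf₁ : ∀ x y, f x y ≤ 1) {k : ℕ} (hdeg : ∀ v, ∑ w, nonAdj G v w ≤ k) {S : Finset V}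
    (hS : 3 * k + S.card + 2 < Fintype.card V)
    (hcov : ∀ B : Block V, B.IsGadget G f → ∃ v ∈ B.upper, v ∈ S) :
    ∃ A : Finset V, A.card ≤ k ∧
      ∃ j, ∀ x y, G.Adj x y → x ∉ S → y ∉ S → x ∉ A → y ∉ A → f x y = j := by
  classical
  have hbal : ∀ x y a d, x ∉ S → y ∉ S → a ∉ S → d ∉ S → G.Adj x a → G.Adj x d → G.Adj y a →
      G.Adj y d → f x a + f y d = f x d + f y a := by
    intro x y a d hx hy ha hd hxa hxd hya hyd
    by_contra hne
    have hxy : x ≠ y := by rintro rfl; omega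
    have had : a ≠ d := by rintro rfl; omega
    have hT := Finset.card_union_le S {a, d}
    have hc := Finset.card_le_two (a := a) (b := d)
    obtain ⟨b, hb, hxb, hyb, -⟩ :=
      exists_common_neighbour hdeg (T := S ∪ {a, d}) (by omega) x y y
    simp only [Finset.mem_union, Finset.mem_insert, Finset.mem_singleton, not_or] at hb
    obtain ⟨B, hB, hBm⟩ := exists_gadget (x := x) (y := y) (a := a) (b := b) (d := d) hf (by
      have := hxa.ne; have := hxb.ne; have := hxd.ne
      have := hya.ne; have := hyb.ne; have := hyd.ne
      simp only [List.nodup_cons, List.mem_cons, List.not_mem_nil, List.nodup_nil, or_false,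
        not_false_eq_true, and_true, not_or]
      grind) hxa hxb hxd hya hyb hyd hne
    obtain ⟨v, hv, hvS⟩ := hcov B hB
    have := hBm v hv
    simp only [List.mem_cons, List.not_mem_nil, or_false] at this
    obtain rfl | rfl | rfl | rfl | rfl := this <;> tauto
  have hcommon := exists_common_neighbour hdeg (T := S) (by omega)
  obtain ⟨x₀, hx₀⟩ : ∃ x, x ∉ S := by
    by_contra! h
    have : S.card = Fintype.card V := by
      rw [Finset.eq_univ_of_forall h, Finset.card_univ]
    omega
  choose z hzS hz hz₀ using fun x => hcommon x x₀ x
  let u : V → ℤ := fun x => f x (z x) - f x₀ (z x)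
  have hu : ∀ x w, x ∉ S → w ∉ S → G.Adj x w → G.Adj x₀ w → u x = f x w - f x₀ w := by
    intro x w hx hw hxw hw₀
    have := hbal x x₀ (z x) w hx hx₀ (hzS x) hw (hz x) hxw (hz₀ x).1 hw₀
    simp only [u]; omega
  have hdiff : ∀ x x' y, x ∉ S → x' ∉ S → y ∉ S → G.Adj x y → G.Adj x' y →
      u x - u x' = f x y - f x' y := by
    intro x x' y hx hx' hy hxy hxy'
    obtain ⟨w, hw, h₁, h₂, h₃⟩ := hcommon x x' x₀
    have e₁ := hu x w hx hw h₁ h₃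
    have e₂ := hu x' w hx' hw h₂ h₃
    have e₃ := hbal x x' w y hx hx' hw hy h₁ hxy h₂ hxy'
    omega
  have hclose : ∀ x x', x ∉ S → x' ∉ S → u x - u x' ≤ 1 := by
    intro x x' hx hx'
    obtain ⟨w, hw, h₁, h₂, -⟩ := hcommon x x' x
    have := hdiff x x' w hx hx' hw h₁ h₂
    have := hf₁ x w
    omega
  have hconst : ∀ x y x' y', x ∉ S → y ∉ S → x' ∉ S → y' ∉ S → G.Adj x y → G.Adj x' y' →
      (f x y : ℤ) - u x - u y = f x' y' - u x' - u y' := by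
    intro x y x' y' hx hy hx' hy' hxy hxy'
    obtain ⟨w, hw, h₁, h₂, -⟩ := hcommon x x' x
    have e₁ := hdiff y w x hy hw hx hxy.symm h₁.symm
    have e₂ := hdiff y' w x' hy' hw hx' hxy'.symm h₂.symm
    have e₃ := hdiff x x' w hx hx' hw h₁ h₂
    rw [hf y x, hf w x] at e₁
    rw [hf y' x', hf w x'] at e₂
    omega
  by_cases hlevel : ∃ a b, a ∉ S ∧ b ∉ S ∧ G.Adj a b ∧ u a = u b
  · obtain ⟨a, b, ha, hb, hab, huab⟩ := hlevel
    refine ⟨Finset.univ.filter fun x => x ∉ S ∧ u x ≠ u a, ?_, f a b, ?_⟩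
    · refine card_le_of_independent hdeg fun x hx y hy hxy => ?_
      simp only [Finset.mem_filter, Finset.mem_univ, true_and] at hx hy
      have := hconst x y a b hx.1 hy.1 ha hb hxy hab
      have := hclose x y hx.1 hy.1
      have := hclose y x hy.1 hx.1
      have := hclose a y ha hy.1
      have := hclose y a hy.1 ha
      have := hf₁ x y
      have := hf₁ a b
      omega
    · intro x y hxy hx hy hxA hyA
      simp only [Finset.mem_filter, Finset.mem_univ, true_and, not_and, not_not] at hxA hyA
      have := hconst x y a b hx hy ha hb hxy hab
      have := hxA hx
      have := hyA hy
      omega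
  · push Not at hlevel
    refine ⟨Finset.univ.filter fun x => x ∉ S ∧ u x = u x₀, ?_, 0, ?_⟩
    · refine card_le_of_independent hdeg fun x hx y hy hxy => ?_
      simp only [Finset.mem_filter, Finset.mem_univ, true_and] at hx hy
      exact hlevel x y hx.1 hy.1 hxy (hx.2.trans hy.2.symm)
    · intro x y hxy hx hy hxA hyA
      simp only [Finset.mem_filter, Finset.mem_univ, true_and, not_and] at hxA hyA
      have := hxA hx
      have := hyA hy
      have := hlevel x y hx hy hxy
      have := hclose x y hx hy
      have := hclose y x hy hx
      have := hclose x x₀ hx hx₀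
      have := hclose x₀ x hx₀ hx
      have := hclose y x₀ hy hx₀
      have := hclose x₀ y hx₀ hy
      omega

lemma sum_nonAdj_add_degree [DecidableRel G.Adj] (v : V) :
    ∑ w, nonAdj G v w + G.degree v = Fintype.card V := by
  have h : G.degree v = ∑ w, if G.Adj v w then 1 else 0 := by
    rw [← G.card_neighborFinset_eq_degree, G.neighborFinset_eq_filter]; simp
  rw [h, ← Finset.sum_add_distrib, ← Finset.card_univ, Finset.card_eq_sum_ones]
  refine Finset.sum_congr rfl fun w _ => ?_
  unfold nonAdj; split_ifs <;> rfl

/-- A quantitative form of the colour-bias theorem: `k` bounds the number of non-neighbours of each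
vertex and `t` is the number of gadgets used. -/
theorem exists_isHamiltonList_colour_bias (col : Sym2 V → Fin 2) {k t : ℕ}
    (hdeg : ∀ v, ∑ w, nonAdj G v w ≤ k) (h₁ : 4 * k + 1 + 4 * t < Fintype.card V)
    (h₂ : 3 * k + 5 * t + 2 < Fintype.card V) :
    ∃ l, IsHamiltonList G l ∧ ∃ i,
      (Fintype.card V + t ≤ 2 * cycleSum (colourInd col i) l ∨
        Fintype.card V ≤ cycleSum (colourInd col i) l + 2 * (k + 5 * t)) := by
  classical
  obtain ⟨gs, rfl, hgs, hnodup⟩ | ⟨S, hS, hcov⟩ := exists_gadgets_or_cover G (colourInd col 0) t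
  · obtain ⟨U, L, hU, hL, hUL⟩ := exists_cycles_of_gadgets hgs hnodup hdeg h₁
    have := hL.cycleSum_colourInd_add col
    by_cases h : Fintype.card V + gs.length ≤ 2 * cycleSum (colourInd col 0) U
    · exact ⟨U, hU, 0, .inl h⟩
    · exact ⟨L, hL, 1, .inl (by omega)⟩
  · obtain ⟨A, hA, j, hj⟩ := exists_independent_of_cover (colourInd_comm col 0)
      (colourInd_le_one col 0) hdeg (by omega) hcov
    obtain ⟨l, -, hl, -⟩ := exists_cycles_of_gadgets (G := G) (f := colourInd col 0) (gs := [])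
      (by simp) (by simp) hdeg (by simp only [List.length_nil]; omega)
    have hcard := Finset.card_union_le S A
    have key : ∀ i, (∀ x y, G.Adj x y → x ∉ S ∪ A → y ∉ S ∪ A → 1 ≤ colourInd col i x y) →
        Fintype.card V ≤ cycleSum (colourInd col i) l + 2 * (k + 5 * t) := fun i hi => by
      have := hl.card_le_cycleSum_add hi
      omega
    simp only [Finset.mem_union, not_or] at key
    by_cases hj₀ : j = 0
    · refine ⟨l, hl, 1, .inr (key 1 fun x y hxy hx hy => ?_)⟩
      have := hj x y hxy hx.1 hy.1 hx.2 hy.2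
      have := colourInd_add col x y
      omega
    · refine ⟨l, hl, 0, .inr (key 0 fun x y hxy hx hy => ?_)⟩
      have := hj x y hxy hx.1 hy.1 hx.2 hy.2
      omega

end Counting

end ColourBias

open ColourBias

theorem colour_bias_hamilton_two_colours (c : ℝ) (hc₀ : 0 < c) (hc : c < 1 / 4) :
    ∃ n₀ : ℕ, ∀ n : ℕ, n₀ ≤ n →
      ∀ (G : SimpleGraph (Fin n)) (_ : DecidableRel G.Adj),
        ((3 : ℝ) / 4 + c) * n ≤ G.minDegree →
        ∀ col : Sym2 (Fin n) → Fin 2,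
          ∃ (v : Fin n) (C : G.Walk v v), C.IsHamiltonianCycle ∧
            ∃ i : Fin 2, ((1 : ℝ) / 2 + c / 64) * n ≤ colourCount col C.edges i := by
  refine ⟨⌈100 / c⌉₊, fun n hn G _ hδ col => ?_⟩
  have hcn : 100 ≤ c * n := by
    have := (Nat.le_ceil (100 / c)).trans (Nat.cast_le.2 hn)
    rwa [div_le_iff₀' hc₀] at this
  have hn' : 4 * (c * n) ≤ n := by nlinarith
  set t := ⌈c * n / 32⌉₊ with ht
  have ht₁ : c * n / 32 ≤ t := Nat.le_ceil _
  have ht₂ : (t : ℝ) < c * n / 32 + 1 := Nat.ceil_lt_add_one (by positivity)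
  have hδn : G.minDegree ≤ n := by
    have : NeZero n := ⟨by rintro rfl; norm_num at hcn⟩
    have h₁ := G.minDegree_le_degree 0
    have h₂ := sum_nonAdj_add_degree (G := G) 0
    rw [Fintype.card_fin] at h₂
    omega
  obtain ⟨k, hk⟩ := Nat.exists_eq_add_of_le' hδn
  have hkR : (n : ℝ) = k + G.minDegree := by exact_mod_cast hk
  have hdeg : ∀ v, ∑ w, nonAdj G v w ≤ k := fun v => by
    have h₁ := G.minDegree_le_degree v
    have h₂ := sum_nonAdj_add_degree (G := G) v
    rw [Fintype.card_fin] at h₂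
    omega
  have hk₁ : 4 * k + 1 + 4 * t < n := by
    have : (4 * k + 1 + 4 * t : ℝ) < n := by linarith
    exact_mod_cast this
  have hk₂ : 3 * k + 5 * t + 2 < n := by
    have : (3 * k + 5 * t + 2 : ℝ) < n := by linarith
    exact_mod_cast this
  obtain ⟨l, hl, i, hi⟩ := exists_isHamiltonList_colour_bias (G := G) col hdeg
    (by rwa [Fintype.card_fin]) (by rwa [Fintype.card_fin])
  obtain ⟨v, C, hC, hCcol⟩ := hl.exists_isHamiltonianCycle (by rw [Fintype.card_fin]; omega)
  refine ⟨v, C, hC, i, ?_⟩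
  rw [hCcol]
  rw [Fintype.card_fin] at hi
  obtain hi | hi := hi
  · have : (n + t : ℝ) ≤ 2 * cycleSum (colourInd col i) l := by exact_mod_cast hi
    linarith
  · have : (n : ℝ) ≤ cycleSum (colourInd col i) l + 2 * (k + 5 * t) := by exact_mod_cast hi
    linarith
end

section
/- Let n and t be positive integers with 1 ≤ t ≤ n/2, let G be an n-vertex graph with minimum degree δ(G) ≥ n/2 + t, and let E' be a set of edges of G that forms a linear forest in G with |E'| ≤ 2t. Then there is a Hamilton cycle in G containing every edge of E'. -/
namespace LinearForestHamilton

variable {V : Type*}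

/-- The unordered pairs of consecutive entries of a list. -/
def pairs : List V → List (Sym2 V)
  | [] => []
  | [_] => []
  | a :: b :: l => s(a, b) :: pairs (b :: l)

lemma pairs_append_cons_cons (A B : List V) (x y : V) :
    pairs (A ++ x :: y :: B) = pairs (A ++ [x]) ++ s(x, y) :: pairs (y :: B) := by
  induction A with
  | nil => simp [pairs]
  | cons a A ih =>
    cases A with
    | nil => simp [pairs]
    | cons c A => simpa [pairs] using ih

lemma pairs_append {A B : List V} {x y : V} (hx : A.getLast? = some x) (hy : B.head? = some y) :
    pairs (A ++ B) = pairs A ++ s(x, y) :: pairs B := by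
  obtain ⟨A, rfl⟩ := List.getLast?_eq_some_iff.1 hx
  obtain ⟨B, rfl⟩ := List.head?_eq_some_iff.1 hy
  simpa using pairs_append_cons_cons A B x y

lemma pairs_reverse (l : List V) : pairs l.reverse = (pairs l).reverse := by
  induction l with
  | nil => rfl
  | cons a l ih =>
    cases l with
    | nil => rfl
    | cons b l =>
      rw [List.reverse_cons, pairs_append (x := b) (y := a) (by simp) (by simp), ih]
      simp [pairs, Sym2.eq_swap]

lemma mem_pairs_append {A B : List V} {e : Sym2 V} :
    e ∈ pairs (A ++ B) ↔ e ∈ pairs A ∨ e ∈ pairs B ∨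
      ∃ x y, A.getLast? = some x ∧ B.head? = some y ∧ e = s(x, y) := by
  cases hx : A.getLast? with
  | none => simp [List.getLast?_eq_none_iff.1 hx, pairs]
  | some x =>
    cases hy : B.head? with
    | none => simp [List.head?_eq_none_iff.1 hy, pairs]
    | some y =>
      rw [pairs_append hx hy]
      simp
      tauto

lemma exists_split_of_mem_pairs {l : List V} {e : Sym2 V} (he : e ∈ pairs l) :
    ∃ A B x y, l = A ++ B ∧ A.getLast? = some x ∧ B.head? = some y ∧ e = s(x, y) := by
  induction l with
  | nil => simp [pairs] at he
  | cons a l ih =>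
    cases l with
    | nil => simp [pairs] at he
    | cons b l =>
      rcases List.mem_cons.1 he with rfl | he
      · exact ⟨[a], b :: l, a, b, rfl, rfl, rfl, rfl⟩
      · obtain ⟨A, B, x, y, h, hA, hB, rfl⟩ := ih he
        refine ⟨a :: A, B, x, y, by simp [h], ?_, hB, rfl⟩
        rw [List.getLast?_cons, hA]
        rfl

lemma mem_of_mem_pairs {l : List V} {u v : V} (he : s(u, v) ∈ pairs l) : u ∈ l ∧ v ∈ l := by
  obtain ⟨A, B, x, y, rfl, hA, hB, h⟩ := exists_split_of_mem_pairs he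
  have hx := List.mem_of_getLast? hA
  have hy := List.mem_of_head? hB
  rcases Sym2.eq_iff.1 h with ⟨rfl, rfl⟩ | ⟨rfl, rfl⟩ <;> simp [hx, hy]

lemma exists_walk_of_pairs {G : SimpleGraph V} (l : List V) (x z : V)
    (hz : (x :: l).getLast? = some z) (hG : ∀ e ∈ pairs (x :: l), e ∈ G.edgeSet) :
    ∃ w : G.Walk x z, w.support = x :: l ∧ w.edges = pairs (x :: l) := by
  induction l generalizing x with
  | nil =>
    obtain rfl : x = z := by simpa using hz
    exact ⟨.nil, by simp, by simp [pairs]⟩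
  | cons b l ih =>
    obtain ⟨w, hs, he⟩ := ih b (by simpa using hz)
      fun e he ↦ hG e (by simp [pairs, he])
    have hadj : G.Adj x b := hG s(x, b) (by simp [pairs])
    exact ⟨.cons hadj w, by simp [hs], by simp [he, pairs]⟩

/-- The list `l`, seen cyclically, yields a Hamilton cycle. -/
lemma exists_isHamiltonianCycle [DecidableEq V] {G : SimpleGraph V} {l : List V} {a z : V}
    (hnd : l.Nodup) (hmem : ∀ v, v ∈ l) (hlen : 3 ≤ l.length)
    (ha : l.head? = some a) (hz : l.getLast? = some z)
    (hG : ∀ e ∈ pairs l, e ∈ G.edgeSet) (hza : G.Adj z a) :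
    ∃ C : G.Walk z z, C.IsHamiltonianCycle ∧ C.edges = s(z, a) :: pairs l := by
  obtain ⟨m, rfl⟩ := List.head?_eq_some_iff.1 ha
  obtain ⟨w, hs, he⟩ := exists_walk_of_pairs m a z hz hG
  have hw : w.IsPath := by rw [SimpleGraph.Walk.isPath_def, hs]; exact hnd
  refine ⟨.cons hza w, ⟨?_, ?_⟩, by simp [he]⟩
  · rw [SimpleGraph.Walk.cons_isCycle_iff, he]
    refine ⟨hw, fun hmem ↦ ?_⟩
    obtain _ | ⟨b, _ | ⟨c, m⟩⟩ := m
    · simp at hlen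
    · simp at hlen
    have hzm : z ∈ c :: m := List.mem_of_getLast? (by simpa using hz)
    rcases List.mem_cons.1 hmem with h | h
    · rcases Sym2.eq_iff.1 h with ⟨h, _⟩ | ⟨h, _⟩ <;> simp_all
    · have := (mem_of_mem_pairs h).2
      simp_all
  · have : (SimpleGraph.Walk.cons hza w).tail.support = a :: m := by simp [hs]
    intro v
    rw [this]
    exact List.count_eq_one_of_mem hnd (hmem v)

/-- No member of `F` joins the end of `A` to the start of `B`. -/
def Separated (F : Set (Sym2 V)) (A B : List V) : Prop :=
  ∀ x y, A.getLast? = some x → B.head? = some y → s(x, y) ∉ F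

lemma Separated.mem_or {F : Set (Sym2 V)} {A B : List V} (h : Separated F A B)
    {e : Sym2 V} (heF : e ∈ F) (he : e ∈ pairs (A ++ B)) : e ∈ pairs A ∨ e ∈ pairs B := by
  rcases mem_pairs_append.1 he with h' | h' | ⟨x, y, hx, hy, rfl⟩
  · exact .inl h'
  · exact .inr h'
  · exact (h x y hx hy heF).elim

lemma Separated.congr {F : Set (Sym2 V)} {A A' B B' : List V} (h : Separated F A B)
    (hA : A'.getLast? = A.getLast?) (hB : B'.head? = B.head?) : Separated F A' B' :=
  fun x y hx hy ↦ h x y (hA ▸ hx) (hB ▸ hy)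

lemma mem_pairs_append_left {A B : List V} {e : Sym2 V} (h : e ∈ pairs A) :
    e ∈ pairs (A ++ B) := mem_pairs_append.2 (.inl h)

lemma mem_pairs_append_right {A B : List V} {e : Sym2 V} (h : e ∈ pairs B) :
    e ∈ pairs (A ++ B) := mem_pairs_append.2 (.inr (.inl h))

lemma mem_pairs_reverse {l : List V} {e : Sym2 V} : e ∈ pairs l.reverse ↔ e ∈ pairs l := by
  simp [pairs_reverse]

/-- Vertices of degree at most one in `F` have a side on which `F` can be separated. -/
lemma separated_or [DecidableEq V] {F : Finset (Sym2 V)} {A B : List V} {a b : V}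
    (hnd : (A ++ a :: B).Nodup) (hdeg : (F.filter (a ∈ ·)).card ≤ 2)
    (hab : s(a, b) ∈ F) (hA : A.getLast? ≠ some b) (hB : B.head? ≠ some b) :
    Separated F A (a :: B) ∨ Separated F (A ++ [a]) B := by
  by_contra! h
  simp only [Separated, not_forall, not_not] at h
  obtain ⟨⟨x, a', hx, ha', hxa⟩, ⟨a'', y, ha'', hy, hay⟩⟩ := h
  obtain rfl : a = a' := by simpa using ha'
  obtain rfl : a = a'' := by simpa using ha''
  have hxA := List.mem_of_getLast? hx
  have hyB := List.mem_of_head? hy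
  have hxy : x ≠ y := by rintro rfl; exact List.disjoint_of_nodup_append hnd hxA (by simp [hyB])
  have hxb : x ≠ b := by rintro rfl; exact hA hx
  have hyb : y ≠ b := by rintro rfl; exact hB hy
  have hsub : {s(a, x), s(a, y), s(a, b)} ⊆ F.filter (a ∈ ·) := by
    intro e he
    rw [Sym2.eq_swap] at hxa
    simp only [Finset.mem_insert, Finset.mem_singleton] at he
    rcases he with rfl | rfl | rfl <;> simp_all
  have hc : ({s(a, x), s(a, y), s(a, b)} : Finset (Sym2 V)).card = 3 := by
    rw [Finset.card_eq_three]
    exact ⟨_, _, _, fun h ↦ hxy (Sym2.congr_right.1 h),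
      fun h ↦ hxb (Sym2.congr_right.1 h), fun h ↦ hyb (Sym2.congr_right.1 h), rfl⟩
  have := Finset.card_le_card hsub
  omega

/-- A list containing all edges of `F` but one can be rearranged to contain all of them. -/
lemma exists_perm_insert [DecidableEq V] {F : Finset (Sym2 V)} {X Y Z : List V} {a b : V}
    (hnd : (X ++ a :: (Y ++ b :: Z)).Nodup)
    (hac : (SimpleGraph.fromEdgeSet (F : Set (Sym2 V))).IsAcyclic)
    (hdeg : ∀ v, (F.filter (v ∈ ·)).card ≤ 2) (hab : s(a, b) ∈ F)
    (hF : ∀ e ∈ F, e ≠ s(a, b) → e ∈ pairs (X ++ a :: (Y ++ b :: Z))) :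
    ∃ l : List V, l.Perm (X ++ a :: (Y ++ b :: Z)) ∧ ∀ e ∈ F, e ∈ pairs l := by
  by_cases hmem : s(a, b) ∈ pairs (X ++ a :: (Y ++ b :: Z))
  · exact ⟨_, .refl _, fun e he ↦ by
      by_cases h : e = s(a, b)
      · exact h ▸ hmem
      · exact hF e he h⟩
  -- It suffices to exhibit a rearrangement in which `a` and `b` are consecutive.
  suffices ∃ l : List V, l.Perm (X ++ a :: (Y ++ b :: Z)) ∧ s(a, b) ∈ pairs l ∧
      ∀ e ∈ F, e ∈ pairs (X ++ a :: (Y ++ b :: Z)) → e ∈ pairs l by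
    obtain ⟨l, hl, h, h'⟩ := this
    refine ⟨l, hl, fun e he ↦ ?_⟩
    by_cases hne : e = s(a, b)
    · exact hne ▸ h
    · exact h' e he (hF e he hne)
  have hne : a ≠ b := by rintro rfl; simp [List.nodup_append] at hnd
  have hbX : b ∉ X := fun h ↦ List.disjoint_of_nodup_append hnd h (by simp)
  have haYZ : a ∉ Y ++ b :: Z := (List.nodup_cons.1 (List.nodup_append.1 hnd).2.1).1
  have hnd' : (Y ++ b :: Z).Nodup := (List.nodup_cons.1 (List.nodup_append.1 hnd).2.1).2
  have hbY : b ∉ Y := fun h ↦ List.disjoint_of_nodup_append hnd' h (by simp)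
  have hY : Y ≠ [] := by
    rintro rfl
    exact hmem (mem_pairs_append_right (by simp [pairs]))
  have ha := separated_or (A := X) (B := Y ++ b :: Z) (a := a) (b := b) hnd (hdeg a) hab
    (fun h ↦ hbX (List.mem_of_getLast? h)) (fun h ↦ by
      rw [List.head?_append_of_ne_nil _ hY] at h
      exact hbY (List.mem_of_head? h))
  have hb := separated_or (A := X ++ a :: Y) (B := Z) (a := b) (b := a) (by simpa using hnd)
    (hdeg b) (Sym2.eq_swap ▸ hab)
    (fun h ↦ by
      obtain ⟨y, hy⟩ := Option.ne_none_iff_exists'.1 (mt List.getLast?_eq_none_iff.1 hY)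
      have := List.mem_of_getLast? hy
      simp [hy, List.getLast?_cons] at h
      simp_all)
    (fun h ↦ by
      have := List.mem_of_head? h
      simp_all)
  rcases ha with ha | ha <;> rcases hb with hb | hb
  · refine ⟨X ++ ((a :: Y).reverse ++ b :: Z), ?_, ?_, fun e he hel ↦ ?_⟩
    · rw [← List.cons_append]
      exact ((List.reverse_perm _).append_right _).append_left _
    · exact mem_pairs_append_right (mem_pairs_append.2 (.inr (.inr ⟨a, b, by simp, by simp, rfl⟩)))
    · rcases ha.mem_or he hel with h | h
      · exact mem_pairs_append_left h
      · have hb' : Separated (F : Set (Sym2 V)) (a :: Y) (b :: Z) :=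
          hb.congr (by simp [List.getLast?_cons]) rfl
        rcases hb'.mem_or he h with h | h
        · exact mem_pairs_append_right (mem_pairs_append_left (mem_pairs_reverse.2 h))
        · exact mem_pairs_append_right (mem_pairs_append_right h)
  · -- Both free sides point outwards: the segment from `a` to `b` must contain a gap.
    have hgap : ∃ e ∈ pairs (a :: (Y ++ [b])), e ∉ F := by
      by_contra! hall
      have hbr := SimpleGraph.isAcyclic_iff_forall_adj_isBridge.1 hac
        (v := a) (w := b) (by simp [hab, hne])
      rw [SimpleGraph.isBridge_iff] at hbr
      obtain ⟨w, -, -⟩ := exists_walk_of_pairs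
        (G := (SimpleGraph.fromEdgeSet (F : Set (Sym2 V))).deleteEdges {s(a, b)})
        (Y ++ [b]) a b (by simp [List.getLast?_cons]) (fun e he ↦ by
          have hnd'' : (a :: (Y ++ [b])).Nodup := by
            refine List.Nodup.sublist ?_ hnd
            refine List.Sublist.trans ?_ (List.sublist_append_right _ _)
            simp
          have hdiag : ¬ e.IsDiag := by
            obtain ⟨A, B, x, y, h, hA, hB, rfl⟩ := exists_split_of_mem_pairs he
            rw [h] at hnd''
            intro hxy
            obtain rfl : x = y := hxy
            exact List.disjoint_of_nodup_append hnd'' (List.mem_of_getLast? hA)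
              (List.mem_of_head? hB)
          have hne' : e ≠ s(a, b) := by
            rintro rfl
            refine hmem (mem_pairs_append_right ?_)
            have := mem_pairs_append_left (B := Z) he
            simpa using this
          simp [hall e he, hdiag, hne'])
      exact hbr w.reachable
    obtain ⟨e₀, he₀, he₀F⟩ := hgap
    obtain ⟨A, B, x, y, h, hA, hB, rfl⟩ := exists_split_of_mem_pairs he₀
    have hsep : Separated (F : Set (Sym2 V)) A B := fun x' y' hx' hy' ↦ by
      rw [hA] at hx'; rw [hB] at hy'
      cases hx'; cases hy'; exact he₀F
    have hAne : A ≠ [] := by rintro rfl; simp at hA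
    have hBne : B ≠ [] := by rintro rfl; simp at hB
    have hAa : A.head? = some a := by
      rw [← List.head?_append_of_ne_nil A hAne, ← h]; rfl
    have hBb : B.getLast? = some b := by
      rw [← List.getLast?_append_of_ne_nil A hBne, ← h]; simp [List.getLast?_cons]
    have hl : X ++ a :: (Y ++ b :: Z) = X ++ (A ++ B ++ Z) := by
      rw [← h]; simp
    rw [hl]
    refine ⟨X ++ (A.reverse ++ B.reverse ++ Z), ?_, ?_, fun e he hel ↦ ?_⟩
    · exact ((((List.reverse_perm _).append (List.reverse_perm _))).append_right _).append_left _
    · exact mem_pairs_append_right (mem_pairs_append_left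
        (mem_pairs_append.2 (.inr (.inr ⟨a, b, by simpa, by simpa, rfl⟩))))
    · have ha' : Separated (F : Set (Sym2 V)) X (A ++ B ++ Z) :=
        ha.congr rfl (by simp [hAa])
      have hb' : Separated (F : Set (Sym2 V)) (A ++ B) Z :=
        hb.congr (by simp [hBb, List.getLast?_cons]) rfl
      rcases ha'.mem_or he hel with h | h
      · exact mem_pairs_append_left h
      refine mem_pairs_append_right ?_
      rcases hb'.mem_or he h with h | h
      · rcases hsep.mem_or he h with h | h
        · exact mem_pairs_append_left (mem_pairs_append_left (mem_pairs_reverse.2 h))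
        · exact mem_pairs_append_left (mem_pairs_append_right (mem_pairs_reverse.2 h))
      · exact mem_pairs_append_right h
  · refine ⟨(X ++ [a]) ++ (b :: Z ++ Y), ?_, ?_, fun e he hel ↦ ?_⟩
    · rw [List.append_cons X a (Y ++ b :: Z)]
      exact List.perm_append_comm.append_left _
    · exact mem_pairs_append.2 (.inr (.inr ⟨a, b, by simp, by simp, rfl⟩))
    · rw [List.append_cons X a (Y ++ b :: Z)] at hel
      rcases ha.mem_or he hel with h | h
      · exact mem_pairs_append_left h
      · have hb' : Separated (F : Set (Sym2 V)) Y (b :: Z) :=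
          hb.congr (by
            obtain ⟨y, hy⟩ := Option.ne_none_iff_exists'.1 (mt List.getLast?_eq_none_iff.1 hY)
            simp [List.getLast?_cons, hy]) rfl
        rcases hb'.mem_or he h with h | h
        · exact mem_pairs_append_right (mem_pairs_append_right h)
        · exact mem_pairs_append_right (mem_pairs_append_left h)
  · refine ⟨(X ++ [a]) ++ ((Y ++ [b]).reverse ++ Z), ?_, ?_, fun e he hel ↦ ?_⟩
    · rw [List.append_cons X a (Y ++ b :: Z), List.append_cons Y b Z]
      exact ((List.reverse_perm _).append_right _).append_left _
    · exact mem_pairs_append.2 (.inr (.inr ⟨a, b, by simp, by simp, rfl⟩))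
    · rw [List.append_cons X a (Y ++ b :: Z)] at hel
      rcases ha.mem_or he hel with h | h
      · exact mem_pairs_append_left h
      · have hb' : Separated (F : Set (Sym2 V)) (Y ++ [b]) Z :=
          hb.congr (by simp [List.getLast?_cons]) rfl
        rw [List.append_cons Y b Z] at h
        rcases hb'.mem_or he h with h | h
        · exact mem_pairs_append_right (mem_pairs_append_left (mem_pairs_reverse.2 h))
        · exact mem_pairs_append_right (mem_pairs_append_right h)

/-- The edges of a linear forest are consecutive in some enumeration of the vertices. -/
lemma exists_enumeration [Fintype V] [DecidableEq V] (F : Finset (Sym2 V))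
    (hloop : ∀ e ∈ F, ¬ e.IsDiag)
    (hac : (SimpleGraph.fromEdgeSet (F : Set (Sym2 V))).IsAcyclic)
    (hdeg : ∀ v, (F.filter (v ∈ ·)).card ≤ 2) :
    ∃ l : List V, l.Nodup ∧ (∀ v, v ∈ l) ∧ ∀ e ∈ F, e ∈ pairs l := by
  induction F using Finset.induction_on with
  | empty => exact ⟨Finset.univ.toList, Finset.nodup_toList _, by simp, by simp⟩
  | insert e F heF ih =>
    obtain ⟨l, hnd, hmem, hl⟩ := ih (fun e he ↦ hloop e (Finset.mem_insert_of_mem he))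
      (hac.anti (SimpleGraph.fromEdgeSet_mono (by simp)))
      (fun v ↦ (Finset.card_le_card
        (Finset.filter_subset_filter _ (Finset.subset_insert _ _))).trans (hdeg v))
    suffices ∃ l' : List V, l'.Perm l ∧ ∀ e' ∈ insert e F, e' ∈ pairs l' by
      obtain ⟨l', hp, h⟩ := this
      exact ⟨l', hp.nodup_iff.2 hnd, fun v ↦ hp.mem_iff.2 (hmem v), h⟩
    induction e with | _ a b =>
    have hne : b ≠ a := fun h ↦ hloop s(a, b) (by simp) (by simp [h])
    have hlF : ∀ e' ∈ insert s(a, b) F, e' ≠ s(a, b) → e' ∈ pairs l := by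
      intro e' he' hne'
      exact hl e' ((Finset.mem_insert.1 he').resolve_left hne')
    obtain ⟨P, Q, rfl⟩ := List.append_of_mem (hmem a)
    have hb := hmem b
    rw [List.mem_append, List.mem_cons] at hb
    rcases hb with hb | hb | hb
    · obtain ⟨P, R, rfl⟩ := List.append_of_mem hb
      rw [Sym2.eq_swap] at *
      rw [List.append_assoc, List.cons_append] at *
      exact exists_perm_insert hnd hac hdeg (by simp) hlF
    · exact (hne hb).elim
    · obtain ⟨Q, R, rfl⟩ := List.append_of_mem hb
      exact exists_perm_insert hnd hac hdeg (by simp) hlF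

/-- The unordered pairs of cyclically consecutive entries of a list. -/
def cyclicPairs (l : List V) : List (Sym2 V) := pairs (l ++ l.head?.toList)

lemma cyclicPairs_eq {l : List V} {a z : V} (ha : l.head? = some a) (hz : l.getLast? = some z) :
    cyclicPairs l = pairs l ++ [s(z, a)] := by
  rw [cyclicPairs, ha, pairs_append hz (y := a) (by simp)]
  simp [pairs]

lemma exists_head_getLast {l : List V} (hl : l ≠ []) :
    ∃ a z, l.head? = some a ∧ l.getLast? = some z :=
  ⟨_, _, List.head?_eq_some_head hl, List.getLast?_eq_some_getLast hl⟩

/-- Any cyclically consecutive pair can be made the closing pair by a rotation. -/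
lemma exists_rotation {l : List V} {e : Sym2 V} (he : e ∈ cyclicPairs l) :
    ∃ l' a z, l'.Perm l ∧ (cyclicPairs l').Perm (cyclicPairs l) ∧
      l'.head? = some a ∧ l'.getLast? = some z ∧ e = s(z, a) := by
  have hl : l ≠ [] := by rintro rfl; simp [cyclicPairs, pairs] at he
  obtain ⟨a, z, ha, hz⟩ := exists_head_getLast hl
  rw [cyclicPairs_eq ha hz, List.mem_append, List.mem_singleton] at he
  rcases he with he | he
  · obtain ⟨A, B, x, y, rfl, hA, hB, rfl⟩ := exists_split_of_mem_pairs he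
    have hAne : A ≠ [] := by rintro rfl; simp at hA
    have hBne : B ≠ [] := by rintro rfl; simp at hB
    rw [List.head?_append_of_ne_nil _ hAne] at ha
    rw [List.getLast?_append_of_ne_nil _ hBne] at hz
    have hy : (B ++ A).head? = some y := by simp [hB]
    have hx : (B ++ A).getLast? = some x := by simp [hA]
    refine ⟨B ++ A, y, x, List.perm_append_comm, ?_, hy, hx, rfl⟩
    rw [cyclicPairs_eq hy hx, cyclicPairs_eq (a := a) (z := z) (by simp [ha]) (by simp [hz]),
      pairs_append hA hB, pairs_append hz ha]
    rw [← Multiset.coe_eq_coe]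
    simp only [← Multiset.coe_add, ← Multiset.cons_coe, ← Multiset.singleton_add,
      Multiset.coe_nil, add_zero]
    abel
  · exact ⟨l, a, z, .refl _, .refl _, ha, hz, he⟩

/-- The crossing-chords count for a Hamilton path from `a` to `z`, avoiding the edges in `F`. -/
lemma exists_crossing [Fintype V] [DecidableEq V] (G : SimpleGraph V) [DecidableRel G.Adj]
    {F : Finset (Sym2 V)} (hdeg : ∀ v, Fintype.card V + F.card ≤ 2 * G.degree v)
    {l : List V} {a z : V} (hnd : l.Nodup) (hmem : ∀ v, v ∈ l)
    (ha : l.head? = some a) (hz : l.getLast? = some z) :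
    ∃ A B x y, l = A ++ B ∧ A.getLast? = some x ∧ B.head? = some y ∧
      G.Adj a y ∧ G.Adj x z ∧ s(x, y) ∉ F := by
  have hlen : l.length = Fintype.card V := by
    rw [← List.toFinset_card_of_nodup hnd, ← Finset.card_univ]
    congr 1
    ext v
    simp [hmem v]
  have hne : l ≠ [] := by rintro rfl; simp at ha
  have hpos : 0 < l.length := List.length_pos_iff.2 hne
  set f : ℕ → V := fun i ↦ l.getD i a with hf
  have hfi : ∀ i (h : i < l.length), f i = l[i] := fun i h ↦ by simp [hf, h]
  have hinj : ∀ i j, i < l.length → j < l.length → f i = f j → i = j := fun i j hi hj h ↦ by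
    rw [hfi i hi, hfi j hj] at h
    exact (hnd.getElem_inj_iff).1 h
  have hsurj : ∀ v, ∃ i < l.length, f i = v := fun v ↦ by
    obtain ⟨i, hi, h⟩ := List.getElem_of_mem (hmem v)
    exact ⟨i, hi, (hfi i hi).trans h⟩
  have hf0 : f 0 = a := by
    rw [hfi 0 hpos]
    rw [List.head?_eq_getElem?, List.getElem?_eq_getElem hpos] at ha
    exact Option.some.inj ha
  have hfl : f (l.length - 1) = z := by
    rw [hfi _ (by omega)]
    rw [List.getLast?_eq_getElem?, List.getElem?_eq_getElem (by omega)] at hz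
    exact Option.some.inj hz
  let I := Finset.range (l.length - 1)
  let S := I.filter fun i ↦ G.Adj a (f (i + 1))
  let T := I.filter fun i ↦ G.Adj (f i) z
  let U := I.filter fun i ↦ s(f i, f (i + 1)) ∈ F
  have hS : G.degree a ≤ S.card := by
    refine (Finset.card_le_card fun w hw ↦ ?_).trans
      (Finset.card_image_le (s := S) (f := fun i ↦ f (i + 1)))
    rw [SimpleGraph.mem_neighborFinset] at hw
    obtain ⟨_ | i, hi, rfl⟩ := hsurj w
    · rw [hf0] at hw
      exact (G.irrefl hw).elim
    · exact Finset.mem_image.2 ⟨i, by simp [S, I, hw]; omega, rfl⟩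
  have hT : G.degree z ≤ T.card := by
    refine (Finset.card_le_card fun w hw ↦ ?_).trans (Finset.card_image_le (s := T) (f := f))
    rw [SimpleGraph.mem_neighborFinset] at hw
    obtain ⟨i, hi, rfl⟩ := hsurj w
    have : i ≠ l.length - 1 := by
      rintro rfl
      rw [hfl] at hw
      exact G.irrefl hw
    exact Finset.mem_image.2 ⟨i, by simp [T, I, hw.symm]; omega, rfl⟩
  have hU : U.card ≤ F.card := by
    refine Finset.card_le_card_of_injOn (fun i ↦ s(f i, f (i + 1)))
      (fun i hi ↦ (Finset.mem_filter.1 hi).2) fun i hi j hj h ↦ ?_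
    have hi' := Finset.mem_range.1 (Finset.mem_filter.1 hi).1
    have hj' := Finset.mem_range.1 (Finset.mem_filter.1 hj).1
    rcases Sym2.eq_iff.1 h with ⟨h, -⟩ | ⟨h₁, h₂⟩
    · exact hinj i j (by omega) (by omega) h
    · have := hinj _ _ (by omega) (by omega) h₁
      have := hinj _ _ (by omega) (by omega) h₂
      omega
  have hunion : (S ∪ T).card ≤ l.length - 1 := by
    rw [← Finset.card_range (l.length - 1)]
    exact Finset.card_le_card
      (Finset.union_subset (Finset.filter_subset _ _) (Finset.filter_subset _ _))
  have hcard := Finset.card_union_add_card_inter S T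
  have hda := hdeg a
  have hdz := hdeg z
  obtain ⟨i, hi, hiU⟩ := Finset.exists_mem_notMem_of_card_lt_card
    (s := U) (t := S ∩ T) (by omega)
  simp only [S, T, U, I, Finset.mem_inter, Finset.mem_filter, Finset.mem_range, not_and] at hi hiU
  obtain ⟨⟨hiI, hiS⟩, -, hiT⟩ := hi
  refine ⟨l.take (i + 1), l.drop (i + 1), f i, f (i + 1), (List.take_append_drop _ _).symm,
    ?_, ?_, hiS, hiT, hiU hiI⟩
  · rw [List.getLast?_take, hfi i (by omega)]
    simp [show i < l.length by omega]
  · rw [List.head?_drop, hfi (i + 1) (by omega), List.getElem?_eq_getElem]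

/-- Chord exchanges turn a cyclic enumeration containing `F` into one using only edges of `G`. -/
lemma exists_cyclic_enumeration [Fintype V] [DecidableEq V] (G : SimpleGraph V)
    [DecidableRel G.Adj] {F : Finset (Sym2 V)} (hFG : ∀ e ∈ F, e ∈ G.edgeSet)
    (hdeg : ∀ v, Fintype.card V + F.card ≤ 2 * G.degree v)
    (l : List V) (hnd : l.Nodup) (hmem : ∀ v, v ∈ l) (hF : ∀ e ∈ F, e ∈ cyclicPairs l) :
    ∃ l' : List V, l'.Nodup ∧ (∀ v, v ∈ l') ∧ (∀ e ∈ F, e ∈ cyclicPairs l') ∧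
      ∀ e ∈ cyclicPairs l', e ∈ G.edgeSet := by
  induction hk : (cyclicPairs l).countP (· ∉ G.edgeSet) using Nat.strong_induction_on
    generalizing l with
  | _ k ih =>
  by_cases hall : ∀ e ∈ cyclicPairs l, e ∈ G.edgeSet
  · exact ⟨l, hnd, hmem, hF, hall⟩
  push Not at hall
  obtain ⟨e, he, heG⟩ := hall
  obtain ⟨r, a, z, hp, hcp, ha, hz, rfl⟩ := exists_rotation he
  obtain ⟨A, B, x, y, rfl, hA, hB, hay, hxz, hxy⟩ := exists_crossing G hdeg
    (hp.nodup_iff.2 hnd) (fun v ↦ hp.mem_iff.2 (hmem v)) ha hz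
  have hAne : A ≠ [] := by rintro rfl; simp at hA
  have hBne : B ≠ [] := by rintro rfl; simp at hB
  have hAa := ha
  have hBz := hz
  rw [List.head?_append_of_ne_nil _ hAne] at hAa
  rw [List.getLast?_append_of_ne_nil _ hBne] at hBz
  have hold : cyclicPairs (A ++ B) = pairs A ++ s(x, y) :: pairs B ++ [s(z, a)] := by
    rw [cyclicPairs_eq ha hz, pairs_append hA hB]
  have hnew : cyclicPairs (A ++ B.reverse) =
      pairs A ++ s(x, z) :: (pairs B).reverse ++ [s(y, a)] := by
    rw [cyclicPairs_eq (a := a) (z := y) (by simp [hAa]) (by simp [hB]),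
      pairs_append hA (y := z) (by simp [hBz]), pairs_reverse]
  have hperm : (A ++ B.reverse).Perm l := ((List.reverse_perm B).append_left A).trans hp
  refine ih _ ?_ (A ++ B.reverse) (hperm.nodup_iff.2 hnd) (fun v ↦ hperm.mem_iff.2 (hmem v))
    (fun e he ↦ ?_) rfl
  · have hya : G.Adj y a := hay.symm
    have hza : ¬ G.Adj z a := heG
    rw [← hk, ← hcp.countP_eq, hold, hnew]
    simp only [List.countP_append, List.countP_cons, List.countP_reverse, List.countP_nil,
      SimpleGraph.mem_edgeSet, hya, hza, hxz]
    simp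
  · have h := hcp.mem_iff.2 (hF e he)
    rw [hold] at h
    rw [hnew]
    have h₁ : e ≠ s(x, y) := by rintro rfl; exact hxy he
    have h₂ : e ≠ s(z, a) := by rintro rfl; exact heG (hFG _ he)
    simp only [List.mem_append, List.mem_cons, h₁, h₂, List.mem_reverse] at h ⊢
    simp at h
    tauto

end LinearForestHamilton

theorem posa_linear_forest_hamilton (n t : ℕ) (ht₁ : 1 ≤ t) (ht₂ : 2 * t ≤ n)
    (G : SimpleGraph (Fin n)) [DecidableRel G.Adj]
    (hδ : (n : ℝ) / 2 + t ≤ G.minDegree)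
    (E' : Finset (Sym2 (Fin n))) (hE'G : ↑E' ⊆ G.edgeSet)
    (hacyclic : (SimpleGraph.fromEdgeSet (↑E' : Set (Sym2 (Fin n)))).IsAcyclic)
    (hmaxdeg : ∀ v : Fin n, (E'.filter (fun e => v ∈ e)).card ≤ 2)
    (hcard : E'.card ≤ 2 * t) :
    ∃ (v : Fin n) (C : G.Walk v v), C.IsHamiltonianCycle ∧ ∀ e ∈ E', e ∈ C.edges := by
  have hmin : n + 2 * t ≤ 2 * G.minDegree := by
    have : (n : ℝ) + 2 * t ≤ 2 * G.minDegree := by linarith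
    exact_mod_cast this
  have hdeg : ∀ v, n + 2 * t ≤ 2 * G.degree v := fun v ↦ by
    have := G.minDegree_le_degree v
    omega
  have hE' : ∀ e ∈ E', e ∈ G.edgeSet := fun e he ↦ hE'G he
  have hn : 3 ≤ n := by
    have h₁ := hdeg ⟨0, by omega⟩
    have h₂ := G.degree_lt_card_verts ⟨0, by omega⟩
    rw [Fintype.card_fin] at h₂
    omega
  obtain ⟨l₀, hnd₀, hmem₀, hl₀⟩ := LinearForestHamilton.exists_enumeration E'
    (fun e he ↦ G.not_isDiag_of_mem_edgeSet (hE' e he)) hacyclic hmaxdeg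
  obtain ⟨l, hnd, hmem, hl, hlG⟩ := LinearForestHamilton.exists_cyclic_enumeration G hE'
    (fun v ↦ by have := hdeg v; rw [Fintype.card_fin]; omega) l₀ hnd₀ hmem₀
    (fun e he ↦ LinearForestHamilton.mem_pairs_append_left (hl₀ e he))
  have hlen : 3 ≤ l.length := by
    have : Fintype.card (Fin n) ≤ l.length := by
      rw [← Finset.card_univ]
      exact (Finset.card_le_card fun v _ ↦ List.mem_toFinset.2 (hmem v)).trans
        (List.toFinset_card_le l)
    rw [Fintype.card_fin] at this
    omega
  obtain ⟨a, z, ha, hz⟩ := LinearForestHamilton.exists_head_getLast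
    (l := l) (by rintro rfl; simp at hlen)
  rw [LinearForestHamilton.cyclicPairs_eq ha hz] at hl hlG
  obtain ⟨C, hC, hCe⟩ := LinearForestHamilton.exists_isHamiltonianCycle hnd hmem hlen ha hz
    (fun e he ↦ hlG e (by simp [he])) (hlG s(z, a) (by simp))
  refine ⟨z, C, hC, fun e he ↦ ?_⟩
  have := hl e he
  rw [hCe]
  simpa [or_comm] using this
end

section
/- Let 0 < c < 1/4 and let n be a positive integer with cn ≥ 24. If G is an n-vertex graph with minimum degree δ(G) ≥ (3/4 + c)·n, then for every 2-colouring of the edges of G there is a Hamilton cycle in G with at least n/2 + ⌊cn/24⌋ edges of the same colour. -/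
namespace HamiltonBias

variable {V : Type*}

/-- The weight of the pair joining the end of `l₁` to the start of `l₂` (`0` if either is empty). -/
def joinWeight (f : V → V → ℕ) (l₁ l₂ : List V) : ℕ :=
  match l₁.getLast?, l₂.head? with
  | some x, some y => f x y
  | _, _ => 0

/-- The total weight of the consecutive pairs of a list. -/
def pathWeight (f : V → V → ℕ) : List V → ℕ
  | [] => 0
  | x :: l => joinWeight f [x] l + pathWeight f l

/-- The total weight of the consecutive pairs of a list read cyclically. -/
def cycleWeight (f : V → V → ℕ) (l : List V) : ℕ :=
  pathWeight f l + joinWeight f l l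

section weights

variable (f : V → V → ℕ)

@[simp] lemma joinWeight_nil_left (l : List V) : joinWeight f [] l = 0 := rfl

@[simp] lemma joinWeight_nil_right (l : List V) : joinWeight f l [] = 0 := by
  unfold joinWeight; split <;> simp_all

lemma joinWeight_eq {l₁ l₂ : List V} (h₁ : l₁ ≠ []) (h₂ : l₂ ≠ []) :
    joinWeight f l₁ l₂ = f (l₁.getLast h₁) (l₂.head h₂) := by
  simp [joinWeight, List.getLast?_eq_some_getLast h₁, List.head?_eq_some_head h₂]

variable {f} in
lemma joinWeight_of_eq_some {l₁ l₂ : List V} {x y : V} (h₁ : l₁.getLast? = some x)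
    (h₂ : l₂.head? = some y) : joinWeight f l₁ l₂ = f x y := by
  simp [joinWeight, h₁, h₂]

lemma joinWeight_append_left (l : List V) {l₁ : List V} (h : l₁ ≠ []) (l₂ : List V) :
    joinWeight f (l ++ l₁) l₂ = joinWeight f l₁ l₂ := by
  simp [joinWeight, List.getLast?_append, List.getLast?_eq_some_getLast h]

lemma joinWeight_append_right (l₁ : List V) {l₂ : List V} (h : l₂ ≠ []) (l : List V) :
    joinWeight f l₁ (l₂ ++ l) = joinWeight f l₁ l₂ := by
  simp [joinWeight, List.head?_append, List.head?_eq_some_head h]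

lemma joinWeight_congr {l₁ l₁' l₂ l₂' : List V} (h₁ : l₁.getLast? = l₁'.getLast?)
    (h₂ : l₂.head? = l₂'.head?) : joinWeight f l₁ l₂ = joinWeight f l₁' l₂' := by
  simp [joinWeight, h₁, h₂]

variable {f} in
lemma joinWeight_reverse (hf : ∀ x y, f x y = f y x) (l₁ l₂ : List V) :
    joinWeight f l₁.reverse l₂.reverse = joinWeight f l₂ l₁ := by
  rcases eq_or_ne l₁ [] with rfl | h₁
  · simp
  rcases eq_or_ne l₂ [] with rfl | h₂
  · simp
  rw [joinWeight_eq _ (by simpa) (by simpa), joinWeight_eq _ h₂ h₁, hf]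
  simp

@[simp] lemma pathWeight_nil : pathWeight f [] = 0 := rfl

@[simp] lemma pathWeight_singleton (x : V) : pathWeight f [x] = 0 := by simp [pathWeight]

@[simp] lemma pathWeight_cons_cons (x y : V) (l : List V) :
    pathWeight f (x :: y :: l) = f x y + pathWeight f (y :: l) := rfl

lemma pathWeight_append (l₁ l₂ : List V) :
    pathWeight f (l₁ ++ l₂) = pathWeight f l₁ + joinWeight f l₁ l₂ + pathWeight f l₂ := by
  induction l₁ with
  | nil => simp
  | cons x l ih =>
    rcases eq_or_ne l [] with rfl | h
    · simp [pathWeight]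
    · have := joinWeight_append_left f [x] h l₂
      simp only [List.cons_append, List.nil_append] at this
      simp only [List.cons_append, pathWeight, ih, joinWeight_append_right f [x] h, this]
      omega

variable {f} in
lemma pathWeight_reverse (hf : ∀ x y, f x y = f y x) (l : List V) :
    pathWeight f l.reverse = pathWeight f l := by
  induction l with
  | nil => simp
  | cons x l ih =>
    have := joinWeight_reverse hf l [x]
    simp only [List.reverse_singleton] at this
    simp [pathWeight_append, pathWeight, ih, this]
    omega

lemma cycleWeight_append {l₁ l₂ : List V} (h₁ : l₁ ≠ []) (h₂ : l₂ ≠ []) :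
    cycleWeight f (l₁ ++ l₂) =
      pathWeight f l₁ + pathWeight f l₂ + joinWeight f l₁ l₂ + joinWeight f l₂ l₁ := by
  rw [cycleWeight, pathWeight_append, joinWeight_append_left f _ h₂,
    joinWeight_append_right f _ h₁]
  omega

lemma cycleWeight_append_comm (l₁ l₂ : List V) :
    cycleWeight f (l₁ ++ l₂) = cycleWeight f (l₂ ++ l₁) := by
  rcases eq_or_ne l₁ [] with rfl | h₁
  · simp
  rcases eq_or_ne l₂ [] with rfl | h₂
  · simp
  rw [cycleWeight_append f h₁ h₂, cycleWeight_append f h₂ h₁]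
  omega

lemma pathWeight_add (g : V → V → ℕ) (l : List V) :
    pathWeight (fun x y => f x y + g x y) l = pathWeight f l + pathWeight g l := by
  induction l with
  | nil => simp
  | cons x l ih => cases l <;> simp_all; omega

lemma cycleWeight_add (g : V → V → ℕ) (l : List V) :
    cycleWeight (fun x y => f x y + g x y) l = cycleWeight f l + cycleWeight g l := by
  rcases eq_or_ne l [] with rfl | h
  · simp [cycleWeight]
  · simp only [cycleWeight, pathWeight_add, joinWeight_eq _ h h]
    omega

variable {f} in
lemma cycleWeight_mono {g : V → V → ℕ} (h : ∀ x y, f x y ≤ g x y) (l : List V) :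
    cycleWeight f l ≤ cycleWeight g l := by
  have hg : g = fun x y => f x y + (g x y - f x y) := by
    ext x y; have := h x y; omega
  rw [hg, cycleWeight_add]
  omega

lemma cycleWeight_fst (p : V → ℕ) (l : List V) :
    cycleWeight (fun x _ => p x) l = (l.map p).sum := by
  have key : ∀ (l : List V) (h : l ≠ []),
      pathWeight (fun x _ => p x) l + p (l.getLast h) = (l.map p).sum := by
    intro l
    induction l with
    | nil => simp
    | cons x l ih => cases l <;> simp_all [add_assoc]
  rcases eq_or_ne l [] with rfl | h
  · simp [cycleWeight]
  · rw [cycleWeight, joinWeight_eq _ h h, key l h]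

lemma cycleWeight_snd (p : V → ℕ) (l : List V) :
    cycleWeight (fun _ y => p y) l = (l.map p).sum := by
  have key : ∀ (l : List V) (h : l ≠ []),
      pathWeight (fun _ y => p y) l + p (l.head h) = (l.map p).sum := by
    intro l
    induction l with
    | nil => simp
    | cons x l ih => cases l <;> simp_all [add_comm]
  rcases eq_or_ne l [] with rfl | h
  · simp [cycleWeight]
  · rw [cycleWeight, joinWeight_eq _ h h, key l h]

end weights

/-- The indicator of a non-edge. -/
noncomputable def nonAdj (G : SimpleGraph V) (x y : V) : ℕ :=
  open Classical in if G.Adj x y then 0 else 1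

lemma nonAdj_comm (G : SimpleGraph V) (x y : V) : nonAdj G x y = nonAdj G y x := by
  by_cases h : G.Adj x y <;> simp [nonAdj, h, G.adj_comm y x]

lemma nonAdj_eq_zero {G : SimpleGraph V} {x y : V} : nonAdj G x y = 0 ↔ G.Adj x y := by
  simp [nonAdj]

lemma exists_walk_of_pathWeight_nonAdj_eq_zero {G : SimpleGraph V} (x z : V) (l : List V)
    (hz : (x :: l).getLast? = some z) (h : pathWeight (nonAdj G) (x :: l) = 0) :
    ∃ p : G.Walk x z, p.support = x :: l ∧
      ∀ q : Sym2 V → Bool, p.edges.countP q =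
        pathWeight (fun a b => if q s(a, b) then 1 else 0) (x :: l) := by
  induction l generalizing x with
  | nil =>
    obtain rfl : x = z := by simpa using hz
    exact ⟨.nil, by simp⟩
  | cons y l ih =>
    simp only [pathWeight_cons_cons, Nat.add_eq_zero_iff, nonAdj_eq_zero] at h
    obtain ⟨p, hp, hq⟩ := ih y (by simpa using hz) h.2
    refine ⟨.cons h.1 p, by simp [hp], fun q => ?_⟩
    simp [List.countP_cons, hq, add_comm]

lemma exists_isHamiltonianCycle_of_cycleWeight_nonAdj_eq_zero [DecidableEq V]
    {G : SimpleGraph V} {l : List V} (hl : l.Nodup) (hmem : ∀ v, v ∈ l) (h3 : 3 ≤ l.length)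
    (h : cycleWeight (nonAdj G) l = 0) :
    ∃ (v : V) (C : G.Walk v v), C.IsHamiltonianCycle ∧
      ∀ q : Sym2 V → Bool, C.edges.countP q =
        cycleWeight (fun a b => if q s(a, b) then 1 else 0) l := by
  obtain ⟨x, l, rfl⟩ : ∃ x l', l = x :: l' := by
    match l, h3 with
    | x :: l, _ => exact ⟨x, l, rfl⟩
  obtain ⟨z, hz⟩ : ∃ z, (x :: l).getLast? = some z := ⟨_, List.getLast?_eq_some_getLast (by simp)⟩
  have hjoin (f : V → V → ℕ) : joinWeight f (x :: l) (x :: l) = f z x := by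
    simp [joinWeight, hz]
  rw [cycleWeight, Nat.add_eq_zero_iff, hjoin, nonAdj_eq_zero] at h
  obtain ⟨hpath, hclose⟩ := h
  obtain ⟨p, hp, hq⟩ := exists_walk_of_pathWeight_nonAdj_eq_zero x z l hz hpath
  have hpp : p.IsPath := by rw [SimpleGraph.Walk.isPath_def, hp]; exact hl
  have hlen : 2 ≤ p.length := by
    have := p.length_support
    rw [hp] at this
    omega
  have hnot : s(z, x) ∉ p.edges := by
    cases p with
    | nil => simp
    | @cons _ w _ hxw p =>
      rw [SimpleGraph.Walk.cons_isPath_iff] at hpp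
      simp only [SimpleGraph.Walk.edges_cons, List.mem_cons, not_or]
      refine ⟨fun heq => ?_, fun hmem => hpp.2 (p.snd_mem_support_of_mem_edges hmem)⟩
      have hwz : w = z := by
        rw [Sym2.eq_swap, Sym2.congr_right] at heq
        exact heq.symm
      subst hwz
      have := SimpleGraph.Walk.length_eq_zero_iff.2 (SimpleGraph.Walk.isPath_iff_nil.1 hpp.1)
      simp at hlen
      omega
  refine ⟨z, .cons hclose p, ?_, fun q => ?_⟩
  · rw [SimpleGraph.Walk.isHamiltonianCycle_iff_isCycle_and_support_count_tail_eq_one]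
    refine ⟨(SimpleGraph.Walk.cons_isCycle_iff _ _).2 ⟨hpp, hnot⟩, fun a => ?_⟩
    rw [SimpleGraph.Walk.support_cons, List.tail_cons, hp]
    exact List.count_eq_one_of_mem hl (hmem a)
  · rw [cycleWeight, hjoin, SimpleGraph.Walk.edges_cons, List.countP_cons, hq]

/-- Two lists of blocks agree up to reordering the blocks and reversing some of them. -/
def BlockEquiv (Bs Cs : List (List V)) : Prop :=
  (Bs.map fun B => s(B, B.reverse)).Perm (Cs.map fun B => s(B, B.reverse))

namespace BlockEquiv

variable {Bs Cs Ds : List (List V)}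

lemma refl (Bs : List (List V)) : BlockEquiv Bs Bs := List.Perm.refl _

lemma trans (h₁ : BlockEquiv Bs Cs) (h₂ : BlockEquiv Cs Ds) : BlockEquiv Bs Ds :=
  List.Perm.trans h₁ h₂

lemma of_perm (h : Bs.Perm Cs) : BlockEquiv Bs Cs := h.map _

lemma append_reverse_right (Xs Ys : List (List V)) :
    BlockEquiv (Xs ++ Ys) (Xs ++ (Ys.map List.reverse).reverse) := by
  have : (fun B : List V => s(B, B.reverse)) ∘ List.reverse = fun B => s(B, B.reverse) := by
    ext1 B
    simp [Sym2.eq_swap]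
  rw [BlockEquiv, List.map_append, List.map_append, List.map_reverse, List.map_map, this]
  exact (List.reverse_perm _).symm.append_left _

lemma length_eq (h : BlockEquiv Bs Cs) : Bs.length = Cs.length := by
  simpa using List.Perm.length_eq h

lemma sum_map_eq {M : Type*} [AddCommMonoid M] (h : BlockEquiv Bs Cs) (g : List V → M)
    (hg : ∀ B, g B.reverse = g B) : (Bs.map g).sum = (Cs.map g).sum := by
  have key (B : List V) : g (s(B, B.reverse)).out.1 = g B := by
    have := Sym2.out_fst_mem s(B, B.reverse)
    rcases Sym2.mem_iff.1 this with h | h <;> simp [h, hg]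
  have := (h.map fun e => g e.out.1).sum_eq
  simpa [Function.comp_def, key] using this

lemma forall_mem (h : BlockEquiv Bs Cs) {p : List V → Prop} (hp : ∀ B, p B → p B.reverse)
    (hB : ∀ B ∈ Bs, p B) : ∀ B ∈ Cs, p B := by
  intro C hC
  have : s(C, C.reverse) ∈ Bs.map fun B => s(B, B.reverse) :=
    h.mem_iff.2 (List.mem_map_of_mem hC)
  obtain ⟨B, hBmem, hBC⟩ := List.mem_map.1 this
  have hCB : C ∈ s(B, B.reverse) := hBC ▸ Sym2.mem_mk_left _ _
  rcases Sym2.mem_iff.1 hCB with rfl | rfl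
  · exact hB _ hBmem
  · exact hp _ (hB _ hBmem)

lemma flatten_perm (h : BlockEquiv Bs Cs) : Bs.flatten.Perm Cs.flatten := by
  have := h.sum_map_eq (Multiset.ofList (α := V)) fun B => by simp
  have key (As : List (List V)) :
      (As.map (Multiset.ofList (α := V))).sum = Multiset.ofList As.flatten := by
    induction As with
    | nil => rfl
    | cons A As ih => rw [List.map_cons, List.sum_cons, ih, List.flatten_cons, Multiset.coe_add]
  rwa [key, key, Multiset.coe_eq_coe] at this

end BlockEquiv

lemma exists_append_joinWeight_pos {f : V → V → ℕ} (Bs : List (List V))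
    (hpath : ∀ B ∈ Bs, pathWeight f B = 0) (h : 0 < pathWeight f Bs.flatten) :
    ∃ Xs Ys, Bs = Xs ++ Ys ∧ 0 < joinWeight f Xs.flatten Ys.flatten := by
  induction Bs with
  | nil => simp at h
  | cons B Bs ih =>
    rw [List.flatten_cons, pathWeight_append, hpath B (by simp), zero_add] at h
    rcases Nat.eq_zero_or_pos (joinWeight f B Bs.flatten) with h0 | h0
    · rw [h0, zero_add] at h
      obtain ⟨Xs, Ys, rfl, hXY⟩ := ih (fun C hC => hpath C (by simp [hC])) h
      refine ⟨B :: Xs, Ys, rfl, ?_⟩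
      have : Xs.flatten ≠ [] := fun h => by simp [h] at hXY
      rwa [List.flatten_cons, joinWeight_append_left _ _ this]
    · exact ⟨[B], Bs, rfl, by simpa using h0⟩

lemma exists_perm_joinWeight_pos {f : V → V → ℕ} (Bs : List (List V))
    (hpath : ∀ B ∈ Bs, pathWeight f B = 0) (h : 0 < cycleWeight f Bs.flatten) :
    ∃ Cs, Bs.Perm Cs ∧ cycleWeight f Cs.flatten = cycleWeight f Bs.flatten ∧
      0 < joinWeight f Cs.flatten Cs.flatten := by
  rcases Nat.eq_zero_or_pos (joinWeight f Bs.flatten Bs.flatten) with h0 | h0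
  · rw [cycleWeight, h0, add_zero] at h
    obtain ⟨Xs, Ys, rfl, hXY⟩ := exists_append_joinWeight_pos Bs hpath h
    refine ⟨Ys ++ Xs, List.perm_append_comm, ?_, ?_⟩
    · simp only [List.flatten_append]
      exact cycleWeight_append_comm f _ _
    · have hX : Xs.flatten ≠ [] := fun h => by simp [h] at hXY
      have hY : Ys.flatten ≠ [] := fun h => by simp [h] at hXY
      rwa [List.flatten_append, joinWeight_append_left _ _ hX, joinWeight_append_right _ _ hY]
  · exact ⟨Bs, .refl _, rfl, h0⟩

lemma degree_add_le_card_filter_add_card [Fintype V] [DecidableEq V] (G : SimpleGraph V)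
    [DecidableRel G.Adj] {N : ℕ} (g : Fin N → V) (hg : Function.Injective g) (v : V) :
    G.degree v + N ≤ (Finset.univ.filter fun i => G.Adj (g i) v).card + Fintype.card V := by
  have h1 : ((Finset.univ.filter fun i => G.Adj (g i) v).image g).card =
      (Finset.univ.filter fun i => G.Adj (g i) v).card := Finset.card_image_of_injective _ hg
  have h2 : (Finset.univ.image g).card = N := by
    rw [Finset.card_image_of_injective _ hg, Finset.card_univ, Fintype.card_fin]
  have h3 : (Finset.univ.filter fun i => G.Adj (g i) v).image g =
      G.neighborFinset v ∩ Finset.univ.image g := by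
    ext w
    simp only [Finset.mem_image, Finset.mem_filter, Finset.mem_univ, true_and, Finset.mem_inter,
      SimpleGraph.mem_neighborFinset]
    constructor
    · rintro ⟨i, hi, rfl⟩
      exact ⟨hi.symm, i, rfl⟩
    · rintro ⟨hw, i, rfl⟩
      exact ⟨i, hw.symm, rfl⟩
  have h4 := Finset.card_union_add_card_inter (G.neighborFinset v) (Finset.univ.image g)
  have h5 := Finset.card_le_univ (G.neighborFinset v ∪ Finset.univ.image g)
  rw [SimpleGraph.card_neighborFinset_eq_degree] at h4
  rw [h3] at h1
  omega

lemma exists_consecutive {N : ℕ} (A C : Finset (Fin N)) (hA : ∀ i ∈ A, (i : ℕ) + 1 ≠ N)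
    (hC : ∀ i ∈ C, (i : ℕ) ≠ 0) (hN : 0 < N) (h : N ≤ A.card + C.card) :
    ∃ i j : Fin N, (j : ℕ) = i + 1 ∧ i ∈ A ∧ j ∈ C := by
  by_contra! hne
  let A' : Finset ℕ := A.image fun i : Fin N => (i : ℕ) + 1
  let C' : Finset ℕ := C.image fun i : Fin N => (i : ℕ)
  have hA' : A'.card = A.card := Finset.card_image_of_injective _ fun i j hij => by
    simpa [Fin.ext_iff] using hij
  have hC' : C'.card = C.card := Finset.card_image_of_injective _ Fin.val_injective
  have hd : Disjoint A' C' := by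
    rw [Finset.disjoint_left]
    intro k hk hk'
    simp only [A', C', Finset.mem_image] at hk hk'
    obtain ⟨i, hi, rfl⟩ := hk
    obtain ⟨j, hj, hij⟩ := hk'
    exact hne i j hij hi hj
  have hs : A' ∪ C' ⊆ Finset.Ico 1 N := by
    intro k hk
    simp only [A', C', Finset.mem_union, Finset.mem_image] at hk
    rw [Finset.mem_Ico]
    rcases hk with ⟨i, hi, rfl⟩ | ⟨i, hi, rfl⟩
    · have := hA i hi; omega
    · have := hC i hi; omega
  have := Finset.card_le_card hs
  rw [Finset.card_union_of_disjoint hd, Nat.card_Ico] at this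
  omega

lemma injective_of_mem_getElem {Bs : List (List V)} (hnd : Bs.flatten.Nodup)
    (g : Fin Bs.length → V) (hg : ∀ i, g i ∈ Bs[i]) : Function.Injective g := by
  have hd := List.pairwise_iff_getElem.1 (List.nodup_flatten.1 hnd).2
  intro i j hij
  by_contra hne
  rcases lt_or_gt_of_ne (fun h => hne (Fin.ext h) : (i : ℕ) ≠ j) with h | h
  · exact hd i j i.2 j.2 h (hg i) (hij ▸ hg j)
  · exact hd j i j.2 i.2 h (hg j) (hij ▸ hg i)

lemma getLast?_flatten_take {Bs : List (List V)} {i : ℕ} (hi : i < Bs.length) (h : Bs[i] ≠ []) :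
    (Bs.take (i + 1)).flatten.getLast? = Bs[i].getLast? := by
  rw [List.take_succ_eq_append_getElem hi, List.flatten_append, List.flatten_singleton,
    List.getLast?_append_of_ne_nil _ h]

lemma head?_flatten_drop {Bs : List (List V)} {i : ℕ} (hi : i < Bs.length) (h : Bs[i] ≠ []) :
    (Bs.drop i).flatten.head? = Bs[i].head? := by
  rw [List.drop_eq_getElem_cons hi, List.flatten_cons, List.head?_append_of_ne_nil _ h]

lemma exists_blockEquiv_cycleWeight_nonAdj_lt [Fintype V] [DecidableEq V] {G : SimpleGraph V}
    [DecidableRel G.Adj] {Bs : List (List V)} (hnd : Bs.flatten.Nodup) (hne : ∀ B ∈ Bs, B ≠ [])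
    (hdeg : ∀ v, 2 * Fintype.card V ≤ 2 * G.degree v + Bs.length)
    (h : 0 < joinWeight (nonAdj G) Bs.flatten Bs.flatten) :
    ∃ Cs, BlockEquiv Bs Cs ∧
      cycleWeight (nonAdj G) Cs.flatten < cycleWeight (nonAdj G) Bs.flatten := by
  have hflat : Bs.flatten ≠ [] := fun h' => by simp [h'] at h
  have hN : 0 < Bs.length := List.length_pos_iff.2 fun h' => by simp [h'] at hflat
  obtain ⟨u, hu⟩ : ∃ u, Bs.flatten.head? = some u := ⟨_, List.head?_eq_some_head hflat⟩
  obtain ⟨v, hv⟩ : ∃ v, Bs.flatten.getLast? = some v := ⟨_, List.getLast?_eq_some_getLast hflat⟩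
  have hne' (i : Fin Bs.length) : Bs[(i : ℕ)] ≠ [] := hne _ (List.getElem_mem i.2)
  let hd : Fin Bs.length → V := fun i => Bs[(i : ℕ)].head (hne' i)
  let lst : Fin Bs.length → V := fun i => Bs[(i : ℕ)].getLast (hne' i)
  have hhd (i : Fin Bs.length) : (Bs.drop i).flatten.head? = some (hd i) := by
    rw [head?_flatten_drop i.2 (hne' i), List.head?_eq_some_head]
  have hlst (i : Fin Bs.length) : (Bs.take (i + 1)).flatten.getLast? = some (lst i) := by
    rw [getLast?_flatten_take i.2 (hne' i), List.getLast?_eq_some_getLast]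
  have hA := degree_add_le_card_filter_add_card G lst
    (injective_of_mem_getElem hnd lst fun i => List.getLast_mem _) v
  have hC := degree_add_le_card_filter_add_card G hd
    (injective_of_mem_getElem hnd hd fun i => List.head_mem _) u
  have hdu := hdeg u
  have hdv := hdeg v
  obtain ⟨i, j, hij, hi, hj⟩ := exists_consecutive
    (Finset.univ.filter fun i => G.Adj (lst i) v) (Finset.univ.filter fun i => G.Adj (hd i) u)
    (fun i hi hlast => by
      have : lst i = v := by
        have := hlst i
        rw [hlast, List.take_length, hv, Option.some_inj] at this
        exact this.symm
      simp [this] at hi)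
    (fun i hi h0 => by
      have : hd i = u := by
        have := hhd i
        rw [h0, List.drop_zero, hu, Option.some_inj] at this
        exact this.symm
      simp [this] at hi)
    hN (by omega)
  simp only [Finset.mem_filter, Finset.mem_univ, true_and] at hi hj
  obtain ⟨X, Y, hX, hY⟩ : ∃ X Y, X = (Bs.take j).flatten ∧ Y = (Bs.drop j).flatten :=
    ⟨_, _, rfl, rfl⟩
  have hXY : Bs.flatten = X ++ Y := by
    rw [hX, hY, ← List.flatten_append, List.take_append_drop]
  have hXl : X.getLast? = some (lst i) := by rw [hX, hij, hlst]
  have hYh : Y.head? = some (hd j) := by rw [hY, hhd]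
  have hXne : X ≠ [] := by rintro rfl; simp at hXl
  have hYne : Y ≠ [] := by rintro rfl; simp at hYh
  have hXh : X.head? = some u := by rw [← hu, hXY, List.head?_append_of_ne_nil _ hXne]
  have hYl : Y.getLast? = some v := by rw [← hv, hXY, List.getLast?_append_of_ne_nil _ hYne]
  refine ⟨Bs.take j ++ ((Bs.drop j).map List.reverse).reverse, ?_, ?_⟩
  · conv_lhs => rw [← List.take_append_drop j Bs]
    exact .append_reverse_right _ _
  · have hYr : Y.reverse ≠ [] := by simpa using hYne
    have hvu : 0 < joinWeight (nonAdj G) Y X := by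
      rw [joinWeight_of_eq_some hYl hXh]
      rwa [joinWeight_of_eq_some hv hu] at h
    have h1 : joinWeight (nonAdj G) X Y.reverse = 0 := by
      rw [joinWeight_of_eq_some hXl (by rw [List.head?_reverse, hYl]), nonAdj_eq_zero]
      exact hi
    have h2 : joinWeight (nonAdj G) Y.reverse X = 0 := by
      rw [joinWeight_of_eq_some (by rw [List.getLast?_reverse, hYh]) hXh, nonAdj_eq_zero]
      exact hj
    rw [List.flatten_append, ← List.reverse_flatten, ← hX, ← hY, cycleWeight_append _ hXne hYr,
      h1, h2, pathWeight_reverse (nonAdj_comm G), hXY, cycleWeight_append _ hXne hYne]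
    omega

theorem exists_blockEquiv_cycleWeight_nonAdj_eq_zero [Fintype V] [DecidableEq V]
    {G : SimpleGraph V} [DecidableRel G.Adj] (Bs : List (List V)) (hnd : Bs.flatten.Nodup)
    (hne : ∀ B ∈ Bs, B ≠ []) (hpath : ∀ B ∈ Bs, pathWeight (nonAdj G) B = 0)
    (hdeg : ∀ v, 2 * Fintype.card V ≤ 2 * G.degree v + Bs.length) :
    ∃ Cs, BlockEquiv Bs Cs ∧ cycleWeight (nonAdj G) Cs.flatten = 0 := by
  induction hk : cycleWeight (nonAdj G) Bs.flatten using Nat.strong_induction_on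
    generalizing Bs with
  | _ k ih =>
    rcases Nat.eq_zero_or_pos k with rfl | hpos
    · exact ⟨Bs, .refl _, hk⟩
    obtain ⟨Cs, hperm, hcyc, hjoin⟩ := exists_perm_joinWeight_pos Bs hpath (hk ▸ hpos)
    have hBC := BlockEquiv.of_perm hperm
    obtain ⟨Ds, hCD, hlt⟩ := exists_blockEquiv_cycleWeight_nonAdj_lt
      (hBC.flatten_perm.nodup_iff.1 hnd) (hBC.forall_mem (by simp) hne)
      (fun v => hBC.length_eq ▸ hdeg v) hjoin
    have hBD := hBC.trans hCD
    obtain ⟨Es, hDE, hE⟩ := ih _ (by omega) Ds (hBD.flatten_perm.nodup_iff.1 hnd)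
      (hBD.forall_mem (by simp) hne)
      (hBD.forall_mem (fun B hB => by rwa [pathWeight_reverse (nonAdj_comm G)]) hpath)
      (fun v => hBD.length_eq ▸ hdeg v) rfl
    exact ⟨Es, hBD.trans hDE, hE⟩

/-- Exchanges the two inner vertices of a list of length four. -/
def swapMiddle : List V → List V
  | [a, b, c, d] => [a, c, b, d]
  | l => l

lemma swapMiddle_eq_or (l : List V) :
    (∃ a b c d, l = [a, b, c, d]) ∨ swapMiddle l = l ∧ l.length ≠ 4 := by
  match l with
  | [] | [_] | [_, _] | [_, _, _] | _ :: _ :: _ :: _ :: _ :: _ => right; simp [swapMiddle]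
  | [a, b, c, d] => exact .inl ⟨a, b, c, d, rfl⟩

lemma swapMiddle_of_length_ne {l : List V} (h : l.length ≠ 4) : swapMiddle l = l := by
  rcases swapMiddle_eq_or l with ⟨a, b, c, d, rfl⟩ | h'
  · simp at h
  · exact h'.1

lemma swapMiddle_reverse (l : List V) : swapMiddle l.reverse = (swapMiddle l).reverse := by
  rcases swapMiddle_eq_or l with ⟨a, b, c, d, rfl⟩ | ⟨h, h'⟩
  · simp [swapMiddle]
  · rw [h, swapMiddle_of_length_ne (by simpa using h')]

lemma head?_swapMiddle (l : List V) : (swapMiddle l).head? = l.head? := by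
  rcases swapMiddle_eq_or l with ⟨a, b, c, d, rfl⟩ | ⟨h, -⟩
  · simp [swapMiddle]
  · rw [h]

lemma getLast?_swapMiddle (l : List V) : (swapMiddle l).getLast? = l.getLast? := by
  rcases swapMiddle_eq_or l with ⟨a, b, c, d, rfl⟩ | ⟨h, -⟩
  · simp [swapMiddle]
  · rw [h]

lemma swapMiddle_perm (l : List V) : (swapMiddle l).Perm l := by
  rcases swapMiddle_eq_or l with ⟨a, b, c, d, rfl⟩ | ⟨h, -⟩
  · exact .cons _ (.swap _ _ _)
  · rw [h]

lemma head?_flatten_map_swapMiddle (Bs : List (List V)) :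
    (Bs.map swapMiddle).flatten.head? = Bs.flatten.head? := by
  induction Bs with
  | nil => rfl
  | cons B Bs ih => simp [List.head?_append, head?_swapMiddle, ih]

lemma getLast?_flatten_map_swapMiddle (Bs : List (List V)) :
    (Bs.map swapMiddle).flatten.getLast? = Bs.flatten.getLast? := by
  induction Bs with
  | nil => rfl
  | cons B Bs ih => simp [List.getLast?_append, getLast?_swapMiddle, ih]

lemma flatten_map_swapMiddle_perm (Bs : List (List V)) :
    (Bs.map swapMiddle).flatten.Perm Bs.flatten := by
  induction Bs with
  | nil => rfl
  | cons B Bs ih => exact (swapMiddle_perm B).append ih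

lemma cycleWeight_flatten_map_swapMiddle (f : V → V → ℕ) (Bs : List (List V)) :
    cycleWeight f (Bs.map swapMiddle).flatten + (Bs.map (pathWeight f)).sum =
      cycleWeight f Bs.flatten + (Bs.map fun B => pathWeight f (swapMiddle B)).sum := by
  have key : pathWeight f (Bs.map swapMiddle).flatten + (Bs.map (pathWeight f)).sum =
      pathWeight f Bs.flatten + (Bs.map fun B => pathWeight f (swapMiddle B)).sum := by
    induction Bs with
    | nil => simp
    | cons B Bs ih =>
      have := joinWeight_congr f (getLast?_swapMiddle B) (head?_flatten_map_swapMiddle Bs)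
      simp only [List.map_cons, List.flatten_cons, List.sum_cons, pathWeight_append, this]
      omega
  rw [cycleWeight, cycleWeight, joinWeight_congr f (getLast?_flatten_map_swapMiddle Bs)
    (head?_flatten_map_swapMiddle Bs)]
  omega

/-- The list enumerates the vertices of a `K₄` in such an order that exchanging the two inner
vertices increases the weight of the path it traverses. -/
def IsGadget (G : SimpleGraph V) (w : V → V → ℕ) (B : List V) : Prop :=
  ∃ a b c d, B = [a, b, c, d] ∧ G.Adj a b ∧ G.Adj a c ∧ G.Adj a d ∧ G.Adj b c ∧ G.Adj b d ∧
    G.Adj c d ∧ w a b + w c d < w a c + w b d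

namespace IsGadget

variable {G : SimpleGraph V} {w : V → V → ℕ} {B : List V}

lemma length_eq (h : IsGadget G w B) : B.length = 4 := by
  obtain ⟨a, b, c, d, rfl, -⟩ := h
  rfl

lemma nodup (h : IsGadget G w B) : B.Nodup := by
  obtain ⟨a, b, c, d, rfl, hab, hac, had, hbc, hbd, hcd, -⟩ := h
  simp [hab.ne, hac.ne, had.ne, hbc.ne, hbd.ne, hcd.ne]

lemma pathWeight_nonAdj (h : IsGadget G w B) : pathWeight (nonAdj G) B = 0 := by
  obtain ⟨a, b, c, d, rfl, hab, hac, had, hbc, hbd, hcd, -⟩ := h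
  simp [nonAdj, hab, hbc, hcd]

lemma pathWeight_nonAdj_swapMiddle (h : IsGadget G w B) :
    pathWeight (nonAdj G) (swapMiddle B) = 0 := by
  obtain ⟨a, b, c, d, rfl, hab, hac, had, hbc, hbd, hcd, -⟩ := h
  simp [swapMiddle, nonAdj, hac, hbc.symm, hbd]

lemma pathWeight_lt (hw : ∀ x y, w x y = w y x) (h : IsGadget G w B) :
    pathWeight w B < pathWeight w (swapMiddle B) := by
  obtain ⟨a, b, c, d, rfl, hab, hac, had, hbc, hbd, hcd, hlt⟩ := h
  have := hw b c
  simp only [swapMiddle, pathWeight_cons_cons, pathWeight_singleton]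
  omega

end IsGadget

lemma exists_gadgets_or_exists_cover [DecidableEq V] (G : SimpleGraph V) (w : V → V → ℕ) (k : ℕ) :
    (∃ Bs : List (List V), Bs.length = k ∧ (∀ B ∈ Bs, IsGadget G w B) ∧ Bs.flatten.Nodup) ∨
      ∃ U : Finset V, U.card ≤ 4 * k ∧ ∀ B, IsGadget G w B → ∃ x ∈ B, x ∈ U := by
  induction k with
  | zero => exact .inl ⟨[], by simp⟩
  | succ k ih =>
    rcases ih with ⟨Bs, hlen, hB, hnd⟩ | ⟨U, hU, hB⟩
    · by_cases h : ∃ B, IsGadget G w B ∧ ∀ x ∈ B, x ∉ Bs.flatten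
      · obtain ⟨B, hG, hdisj⟩ := h
        refine .inl ⟨B :: Bs, by simp [hlen], by simpa using ⟨hG, hB⟩, ?_⟩
        rw [List.flatten_cons, List.nodup_append']
        exact ⟨hG.nodup, hnd, hdisj⟩
      · push Not at h
        refine .inr ⟨Bs.flatten.toFinset, ?_, fun B hG => by simpa using h B hG⟩
        have : Bs.flatten.length = 4 * k := by
          rw [List.length_flatten, List.map_congr_left fun B h => (hB B h).length_eq]
          simp [hlen, mul_comm]
        have := Bs.flatten.toFinset_card_le
        omega
    · exact .inr ⟨U, by omega, hB⟩

lemma length_eq_card [Fintype V] [DecidableEq V] {l : List V} (hl : l.Nodup)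
    (hmem : ∀ v, v ∈ l) : l.length = Fintype.card V := by
  rw [← List.toFinset_card_of_nodup hl, ← Finset.card_univ]
  congr 1
  ext v
  simpa using hmem v

/-- A Hamilton cycle traversing each of the given gadgets, together with the one obtained from it
by exchanging the inner vertices of every gadget. -/
lemma exists_cycleWeight_add_le [Fintype V] [DecidableEq V] {G : SimpleGraph V}
    [DecidableRel G.Adj] {w : V → V → ℕ} (hw : ∀ x y, w x y = w y x) (Bs : List (List V))
    (hB : ∀ B ∈ Bs, IsGadget G w B) (hnd : Bs.flatten.Nodup)
    (hdeg : ∀ v, Fintype.card V + 3 * Bs.length ≤ 2 * G.degree v) :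
    ∃ l l' : List V, (l.Nodup ∧ (∀ v, v ∈ l) ∧ cycleWeight (nonAdj G) l = 0) ∧
      (l'.Nodup ∧ (∀ v, v ∈ l') ∧ cycleWeight (nonAdj G) l' = 0) ∧
      cycleWeight w l + Bs.length ≤ cycleWeight w l' := by
  let R := (Bs.flatten.toFinsetᶜ).toList
  let Cs := Bs ++ R.map fun v => [v]
  have hRflat : (R.map fun v => [v]).flatten = R := by
    induction R with
    | nil => rfl
    | cons v R ih => simpa using ih
  have hflat : Cs.flatten = Bs.flatten ++ R := by rw [List.flatten_append, hRflat]
  have hCnd : Cs.flatten.Nodup := by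
    rw [hflat, List.nodup_append']
    exact ⟨hnd, Finset.nodup_toList _, fun v hv hR => by
      simp only [R, Finset.mem_toList, Finset.mem_compl, List.mem_toFinset] at hR
      exact hR hv⟩
  have hCmem (v : V) : v ∈ Cs.flatten := by
    rw [hflat, List.mem_append]
    by_cases hv : v ∈ Bs.flatten
    · exact .inl hv
    · exact .inr (by simpa [R] using hv)
  have hcard := length_eq_card hCnd hCmem
  have hClen : Fintype.card V = Cs.length + 3 * Bs.length := by
    have : Bs.flatten.length = 4 * Bs.length := by
      rw [List.length_flatten, List.map_congr_left fun B h => (hB B h).length_eq]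
      simp [mul_comm]
    rw [hflat, List.length_append] at hcard
    simp only [Cs, List.length_append, List.length_map]
    omega
  have hC : ∀ B ∈ Cs, IsGadget G w B ∨ ∃ v, B = [v] := by
    intro B hBC
    rcases List.mem_append.1 hBC with h | h
    · exact .inl (hB B h)
    · obtain ⟨v, -, rfl⟩ := List.mem_map.1 h
      exact .inr ⟨v, rfl⟩
  obtain ⟨Ds, hCD, hD⟩ := exists_blockEquiv_cycleWeight_nonAdj_eq_zero (G := G) Cs hCnd
    (fun B hBC => by
      rcases hC B hBC with h | ⟨v, rfl⟩
      exacts [fun h' => by simpa [h'] using h.length_eq, by simp])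
    (fun B hBC => by
      rcases hC B hBC with h | ⟨v, rfl⟩
      exacts [h.pathWeight_nonAdj, by simp])
    (fun v => by have := hdeg v; omega)
  have hDnd := hCD.flatten_perm.nodup_iff.1 hCnd
  have hDmem (v : V) : v ∈ Ds.flatten := hCD.flatten_perm.mem_iff.1 (hCmem v)
  have hswap := flatten_map_swapMiddle_perm Ds
  have hsum {f : V → V → ℕ} (hf : ∀ x y, f x y = f y x) :
      (Cs.map (pathWeight f)).sum = (Ds.map (pathWeight f)).sum ∧
      (Cs.map fun B => pathWeight f (swapMiddle B)).sum =
        (Ds.map fun B => pathWeight f (swapMiddle B)).sum :=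
    ⟨hCD.sum_map_eq _ fun B => pathWeight_reverse hf B,
      hCD.sum_map_eq _ fun B => by rw [swapMiddle_reverse, pathWeight_reverse hf]⟩
  refine ⟨Ds.flatten, (Ds.map swapMiddle).flatten, ⟨hDnd, hDmem, hD⟩,
    ⟨hswap.nodup_iff.2 hDnd, fun v => hswap.mem_iff.2 (hDmem v), ?_⟩, ?_⟩
  · have h1 := cycleWeight_flatten_map_swapMiddle (nonAdj G) Ds
    have h2 : (Cs.map fun B => pathWeight (nonAdj G) (swapMiddle B)).sum = 0 := by
      rw [List.sum_eq_zero_iff]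
      simp only [List.mem_map, forall_exists_index, and_imp, forall_apply_eq_imp_iff₂]
      intro B hBC
      rcases hC B hBC with h | ⟨v, rfl⟩
      exacts [h.pathWeight_nonAdj_swapMiddle, by simp [swapMiddle]]
    have := (hsum (nonAdj_comm G)).2
    omega
  · have h1 := cycleWeight_flatten_map_swapMiddle w Ds
    have h2 : (Cs.map (pathWeight w)).sum + Bs.length ≤
        (Cs.map fun B => pathWeight w (swapMiddle B)).sum := by
      have key : ∀ As : List (List V), (∀ B ∈ As, IsGadget G w B) →
          (As.map (pathWeight w)).sum + As.length ≤
            (As.map fun B => pathWeight w (swapMiddle B)).sum := by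
        intro As hAs
        induction As with
        | nil => simp
        | cons A As ih =>
          have := (hAs A (by simp)).pathWeight_lt hw
          have := ih fun B hB => hAs B (by simp [hB])
          simp only [List.map_cons, List.sum_cons, List.length_cons]
          omega
      have := key Bs hB
      have hs (v : V) : swapMiddle [v] = [v] := rfl
      simp only [Cs, List.map_append, List.sum_append, List.map_map, Function.comp_def, hs,
        pathWeight_singleton]
      omega
    have := hsum hw
    omega

section balanced

variable {H : SimpleGraph V} {w : V → V → ℕ}

/-- If every `K₄` is balanced, all triangles have the same parity. -/
lemma triangle_parity_eq (hw : ∀ x y, w x y = w y x)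
    (hcn : ∀ a b c d, ∃ t, H.Adj a t ∧ H.Adj b t ∧ H.Adj c t ∧ H.Adj d t)
    (hK : ∀ a b c d, H.Adj a b → H.Adj a c → H.Adj a d → H.Adj b c → H.Adj b d → H.Adj c d →
      w a b + w c d = w a c + w b d) {x y z x' y' z' : V}
    (hxy : H.Adj x y) (hxz : H.Adj x z) (hyz : H.Adj y z)
    (hxy' : H.Adj x' y') (hxz' : H.Adj x' z') (hyz' : H.Adj y' z') :
    (w x y + w x z + w y z) % 2 = (w x' y' + w x' z' + w y' z') % 2 := by
  have edge {x y z z' : V} (hxy : H.Adj x y) (hxz : H.Adj x z) (hyz : H.Adj y z)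
      (hxz' : H.Adj x z') (hyz' : H.Adj y z') :
      (w x y + w x z + w y z) % 2 = (w x y + w x z' + w y z') % 2 := by
    obtain ⟨s, hx, hy, hz, hz'⟩ := hcn x y z z'
    have h1 := hK z y x s hyz.symm hxz.symm hz hxy.symm hy hx
    have h2 := hK z' y x s hyz'.symm hxz'.symm hz' hxy.symm hy hx
    have := hw z x
    have := hw z y
    have := hw z' x
    have := hw z' y
    omega
  have vertex {x y z y' z' : V} (hxy : H.Adj x y) (hxz : H.Adj x z) (hyz : H.Adj y z)
      (hxy' : H.Adj x y') (hxz' : H.Adj x z') (hyz' : H.Adj y' z') :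
      (w x y + w x z + w y z) % 2 = (w x y' + w x z' + w y' z') % 2 := by
    obtain ⟨s, hx, hy, hy', -⟩ := hcn x y y' y'
    have h1 := edge hxy hxz hyz hx hy
    have h2 := edge hx hxy hy.symm hxy' hy'.symm
    have h3 := edge hxy' hx hy' hxz' hyz'
    have := hw s y
    have := hw s y'
    omega
  obtain ⟨t, hx, hx', -⟩ := hcn x x' x x
  obtain ⟨r, hxr, htr, -⟩ := hcn x t x x
  obtain ⟨r', hxr', htr', -⟩ := hcn x' t x x
  have h1 := vertex hxy hxz hyz hx hxr htr
  have h2 := vertex hxy' hxz' hyz' hx' hxr' htr'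
  have h3 := vertex hx.symm htr hxr hx'.symm htr' hxr'
  have := hw t x
  have := hw t x'
  omega

lemma exists_independent_of_even_triangles (hw : ∀ x y, w x y = w y x) (hw1 : ∀ x y, w x y ≤ 1)
    (hcn : ∀ a b c d, ∃ t, H.Adj a t ∧ H.Adj b t ∧ H.Adj c t ∧ H.Adj d t)
    (hK : ∀ a b c d, H.Adj a b → H.Adj a c → H.Adj a d → H.Adj b c → H.Adj b d → H.Adj c d →
      w a b + w c d = w a c + w b d)
    (heven : ∀ x y z, H.Adj x y → H.Adj x z → H.Adj y z → (w x y + w x z + w y z) % 2 = 0) :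
    ∃ B : Set V, (∀ x ∈ B, ∀ y ∈ B, ¬ H.Adj x y) ∧
      ∀ x y, H.Adj x y → w x y = 1 → x ∈ B ∨ y ∈ B := by
  have spread {u p q t : V} (hup : H.Adj u p) (huq : H.Adj u q) (hut : H.Adj u t)
      (hpq : H.Adj p q) (hpt : H.Adj p t) (hqt : H.Adj q t) (hp : w u p = 1) (hq : w u q = 1) :
      w u t = 1 := by
    have h1 := hK u p q t hup huq hut hpq hpt hqt
    have h2 := hK u t q p hut huq hup hqt.symm hpt.symm hpq.symm
    have h3 := heven u p q hup huq hpq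
    have := hw1 u t
    have := hw1 p q
    have := hw1 p t
    have := hw1 q t
    have := hw t p
    have := hw q p
    omega
  have star {u p q z : V} (hup : H.Adj u p) (huq : H.Adj u q) (hpq : H.Adj p q)
      (hp : w u p = 1) (hq : w u q = 1) (huz : H.Adj u z) : w u z = 1 := by
    obtain ⟨t, hut, hpt, hqt, hzt⟩ := hcn u p q z
    obtain ⟨s, hus, hps, hts, hzs⟩ := hcn u p t z
    have ht := spread hup huq hut hpq hpt hqt hp hq
    have hs := spread hup hut hus hpt hps hts hp ht
    exact spread hut hus huz hts hzt.symm hzs.symm ht hs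
  refine ⟨{u | ∃ p q, H.Adj u p ∧ H.Adj u q ∧ H.Adj p q ∧ w u p = 1 ∧ w u q = 1}, ?_, ?_⟩
  · rintro x ⟨p, q, hxp, hxq, hpq, hp, hq⟩ y ⟨p', q', hyp, hyq, hpq', hp', hq'⟩ hxy
    obtain ⟨t, hx, hy, -⟩ := hcn x y x x
    have h1 := star hxp hxq hpq hp hq hxy
    have h2 := star hxp hxq hpq hp hq hx
    have h3 := star hyp hyq hpq' hp' hq' hy
    have := heven x y t hxy hx hy
    omega
  · intro x y hxy h1
    obtain ⟨t, hx, hy, -⟩ := hcn x y x x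
    have := heven x y t hxy hx hy
    have := hw1 x t
    have := hw1 y t
    by_cases h : w x t = 1
    · exact .inl ⟨y, t, hxy, hx, hy, h1, h⟩
    · refine .inr ⟨x, t, hxy.symm, hy, hx, by rw [hw, h1], by omega⟩

/-- If every `K₄` is balanced, then the weighting is constant on the edges avoiding some
independent set. -/
lemma exists_independent_of_balanced (hw : ∀ x y, w x y = w y x) (hw1 : ∀ x y, w x y ≤ 1)
    (hcn : ∀ a b c d, ∃ t, H.Adj a t ∧ H.Adj b t ∧ H.Adj c t ∧ H.Adj d t)
    (hK : ∀ a b c d, H.Adj a b → H.Adj a c → H.Adj a d → H.Adj b c → H.Adj b d → H.Adj c d →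
      w a b + w c d = w a c + w b d) :
    ∃ B : Set V, (∀ x ∈ B, ∀ y ∈ B, ¬ H.Adj x y) ∧
      ∃ k, ∀ x y, H.Adj x y → x ∉ B → y ∉ B → w x y = k := by
  by_cases heven : ∀ x y z, H.Adj x y → H.Adj x z → H.Adj y z → (w x y + w x z + w y z) % 2 = 0
  · obtain ⟨B, hB, h⟩ := exists_independent_of_even_triangles hw hw1 hcn hK heven
    refine ⟨B, hB, 0, fun x y hxy hx hy => ?_⟩
    have := hw1 x y
    have : w x y ≠ 1 := fun h1 => (h x y hxy h1).elim hx hy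
    omega
  · push Not at heven
    obtain ⟨a, b, c, hab, hac, hbc, hodd⟩ := heven
    obtain ⟨B, hB, h⟩ := exists_independent_of_even_triangles (H := H)
      (w := fun x y => 1 - w x y) (fun x y => by rw [hw]) (fun x y => Nat.sub_le _ _) hcn
      (fun a b c d hab hac had hbc hbd hcd => by
        have := hK a b c d hab hac had hbc hbd hcd
        have := hw1 a b
        have := hw1 c d
        have := hw1 a c
        have := hw1 b d
        omega)
      (fun x y z hxy hxz hyz => by
        have := triangle_parity_eq hw hcn hK hxy hxz hyz hab hac hbc
        have := hw1 x y
        have := hw1 x z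
        have := hw1 y z
        omega)
    refine ⟨B, hB, 1, fun x y hxy hx hy => ?_⟩
    have := hw1 x y
    have : 1 - w x y ≠ 1 := fun h1 => (h x y hxy h1).elim hx hy
    omega

end balanced

/-- If no four vertices outside `U` carry a gadget, then outside a small set all edges have the
same weight. -/
lemma exists_finset_weight_eq_of_cover [Fintype V] [DecidableEq V] {G : SimpleGraph V}
    [DecidableRel G.Adj] {w : V → V → ℕ} (hw : ∀ x y, w x y = w y x) (hw1 : ∀ x y, w x y ≤ 1)
    {U : Finset V} (hU : ∀ B, IsGadget G w B → ∃ x ∈ B, x ∈ U) {δ : ℕ} (hδ : ∀ v, δ ≤ G.degree v)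
    (hδn : δ ≤ Fintype.card V) (hcard : 3 * Fintype.card V + U.card < 4 * δ) :
    ∃ D : Finset V, D.card + δ ≤ Fintype.card V + U.card ∧
      ∃ k, ∀ x y, G.Adj x y → x ∉ D → y ∉ D → w x y = k := by
  let H := G.induce {v | v ∉ U}
  have hcn (a b c d : {v | v ∉ U}) : ∃ t, H.Adj a t ∧ H.Adj b t ∧ H.Adj c t ∧ H.Adj d t := by
    by_contra! hne
    have hcover : (Finset.univ : Finset V) ⊆ U ∪ ((G.neighborFinset a)ᶜ ∪ (G.neighborFinset b)ᶜ ∪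
        ((G.neighborFinset c)ᶜ ∪ (G.neighborFinset d)ᶜ)) := by
      intro t _
      by_contra h
      simp only [Finset.mem_union, Finset.mem_compl, SimpleGraph.mem_neighborFinset, not_or,
        not_not] at h
      exact hne ⟨t, h.1⟩ h.2.1.1 h.2.1.2 h.2.2.1 h.2.2.2
    have h0 := Finset.card_le_card hcover
    have hle (v : V) : ((G.neighborFinset v)ᶜ).card + δ ≤ Fintype.card V := by
      have := hδ v
      have := Finset.card_add_card_compl (G.neighborFinset v)
      rw [SimpleGraph.card_neighborFinset_eq_degree] at this
      omega
    have := hle a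
    have := hle b
    have := hle c
    have := hle d
    have := Finset.card_union_le U ((G.neighborFinset a)ᶜ ∪ (G.neighborFinset b)ᶜ ∪
        ((G.neighborFinset c)ᶜ ∪ (G.neighborFinset d)ᶜ))
    have := Finset.card_union_le ((G.neighborFinset (a : V))ᶜ ∪ (G.neighborFinset b)ᶜ)
        ((G.neighborFinset c)ᶜ ∪ (G.neighborFinset d)ᶜ)
    have := Finset.card_union_le (G.neighborFinset (a : V))ᶜ (G.neighborFinset b)ᶜ
    have := Finset.card_union_le (G.neighborFinset (c : V))ᶜ (G.neighborFinset d)ᶜ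
    rw [Finset.card_univ] at h0
    omega
  have hle (a b c d : V) (ha : a ∉ U) (hb : b ∉ U) (hc : c ∉ U) (hd : d ∉ U) (hab : G.Adj a b)
      (hac : G.Adj a c) (had : G.Adj a d) (hbc : G.Adj b c) (hbd : G.Adj b d) (hcd : G.Adj c d) :
      w a c + w b d ≤ w a b + w c d := by
    by_contra! hlt
    obtain ⟨x, hx, hxU⟩ := hU [a, b, c, d] ⟨a, b, c, d, rfl, hab, hac, had, hbc, hbd, hcd, hlt⟩
    simp only [List.mem_cons, List.not_mem_nil, or_false] at hx
    rcases hx with rfl | rfl | rfl | rfl <;> contradiction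
  obtain ⟨B, hB, k, hk⟩ := exists_independent_of_balanced (H := H) (w := fun x y => w x y)
    (fun x y => hw x y) (fun x y => hw1 x y) hcn
    (fun a b c d hab hac had hbc hbd hcd => by
      have h1 := hle a b c d a.2 b.2 c.2 d.2 hab hac had hbc hbd hcd
      have h2 := hle a c b d a.2 c.2 b.2 d.2 hac hab had hbc.symm hcd hbd
      omega)
  classical
  let B' : Finset V := Finset.univ.filter fun v => ∃ h : v ∉ U, (⟨v, h⟩ : {v | v ∉ U}) ∈ B
  have hB' : B'.card + δ ≤ Fintype.card V := by
    rcases B'.eq_empty_or_nonempty with h | ⟨b, hb⟩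
    · simpa [h] using hδn
    · have hd : Disjoint B' (G.neighborFinset b) := by
        rw [Finset.disjoint_left]
        intro v hv hbv
        rw [SimpleGraph.mem_neighborFinset] at hbv
        simp only [B', Finset.mem_filter, Finset.mem_univ, true_and] at hb hv
        obtain ⟨hbU, hb⟩ := hb
        obtain ⟨hvU, hv⟩ := hv
        exact hB _ hb _ hv hbv
      have := Finset.card_le_univ (B' ∪ G.neighborFinset b)
      rw [Finset.card_union_of_disjoint hd, SimpleGraph.card_neighborFinset_eq_degree] at this
      have := hδ b
      omega
  refine ⟨B' ∪ U, by have := Finset.card_union_le B' U; omega, k, fun x y hxy hx hy => ?_⟩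
  simp only [B', Finset.mem_union, Finset.mem_filter, Finset.mem_univ, true_and, not_or,
    not_exists] at hx hy
  exact hk ⟨x, hx.2⟩ ⟨y, hy.2⟩ hxy (hx.1 _) (hy.1 _)

/-- In a two-colouring given by complementary weights, some Hamilton cycle (written as a cyclic
list) has large weight in one of the colours. -/
theorem exists_biased_cycle [Fintype V] [DecidableEq V] {G : SimpleGraph V} [DecidableRel G.Adj]
    (w : Fin 2 → V → V → ℕ) (hw : ∀ i x y, w i x y = w i y x)
    (hw1 : ∀ x y, w 0 x y + w 1 x y = 1) {d δ : ℕ} (hd : 0 < d) (hδ : ∀ v, δ ≤ G.degree v)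
    (hδn : δ ≤ Fintype.card V) (h : 3 * Fintype.card V + 34 * d ≤ 4 * δ) :
    ∃ l : List V, (l.Nodup ∧ (∀ v, v ∈ l) ∧ cycleWeight (nonAdj G) l = 0) ∧
      ∃ i, Fintype.card V + 2 * d ≤ 2 * cycleWeight (w i) l := by
  have htotal {l : List V} (hl : l.Nodup) (hmem : ∀ v, v ∈ l) :
      cycleWeight (w 0) l + cycleWeight (w 1) l = Fintype.card V := by
    rw [← cycleWeight_add]
    simp only [hw1]
    rw [cycleWeight_fst fun _ => 1]
    simpa using length_eq_card hl hmem
  rcases exists_gadgets_or_exists_cover G (w 0) (2 * d) with ⟨Bs, hlen, hB, hnd⟩ | ⟨U, hU, hcov⟩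
  · obtain ⟨l, l', hl, hl', hle⟩ := exists_cycleWeight_add_le (hw 0) Bs hB hnd
      (fun v => by have := hδ v; omega)
    have := htotal hl.1 hl.2.1
    by_cases hbig : Fintype.card V + 2 * d ≤ 2 * cycleWeight (w 0) l'
    · exact ⟨l', hl', 0, hbig⟩
    · exact ⟨l, hl, 1, by omega⟩
  · obtain ⟨D, hD, k, hk⟩ := exists_finset_weight_eq_of_cover (hw 0)
      (fun x y => by have := hw1 x y; omega) hcov hδ hδn (by omega)
    obtain ⟨l, -, hl, -⟩ := exists_cycleWeight_add_le (G := G) (hw 0) [] (by simp) (by simp)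
      (fun v => by have := hδ v; simp only [List.length_nil]; omega)
    have hsum : (l.map fun v => if v ∈ D then 1 else 0).sum ≤ D.card := by
      rw [← List.sum_toFinset _ hl.1, Finset.sum_boole]
      exact Finset.card_le_card fun v hv => (Finset.mem_filter.1 hv).2
    have hbound (f : V → V → ℕ) (hf1 : ∀ x y, f x y ≤ 1)
        (hf : ∀ x y, G.Adj x y → x ∉ D → y ∉ D → f x y = 0) : cycleWeight f l ≤ 2 * D.card := by
      have hmono : cycleWeight f l ≤ cycleWeight (fun x y => nonAdj G x y +
          ((if x ∈ D then 1 else 0) + (if y ∈ D then 1 else 0))) l := by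
        refine cycleWeight_mono (fun x y => ?_) l
        have := hf1 x y
        by_cases hxy : G.Adj x y
        · by_cases hx : x ∈ D
          · simp [hx]; omega
          by_cases hy : y ∈ D
          · simp [hy]; omega
          simp [hf x y hxy hx hy]
        · simp [nonAdj, hxy]; omega
      rw [cycleWeight_add, cycleWeight_add, hl.2.2, cycleWeight_fst fun x => if x ∈ D then 1 else 0,
        cycleWeight_snd fun x => if x ∈ D then 1 else 0] at hmono
      omega
    have := htotal hl.1 hl.2.1
    rcases Nat.eq_zero_or_pos k with rfl | hkpos
    · have := hbound (w 0) (fun x y => by have := hw1 x y; omega) hk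
      exact ⟨l, hl, 1, by omega⟩
    · have := hbound (w 1) (fun x y => by have := hw1 x y; omega) fun x y hxy hx hy => by
        have := hk x y hxy hx hy
        have := hw1 x y
        omega
      exact ⟨l, hl, 0, by omega⟩

end HamiltonBias

theorem colour_bias_hamilton_two_colours_explicit (c : ℝ) (hc₀ : 0 < c) (hc : c < 1 / 4)
    (n : ℕ) (hn : 0 < n) (hcn : 24 ≤ c * n)
    (G : SimpleGraph (Fin n)) [DecidableRel G.Adj]
    (hδ : ((3 : ℝ) / 4 + c) * n ≤ G.minDegree)
    (col : Sym2 (Fin n) → Fin 2) :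
    ∃ (v : Fin n) (C : G.Walk v v), C.IsHamiltonianCycle ∧
      ∃ i : Fin 2, (n : ℝ) / 2 + ⌊c * n / 24⌋₊ ≤ colourCount col C.edges i := by
  set d := ⌊c * n / 24⌋₊ with hd
  have hd0 : 0 < d := Nat.floor_pos.2 (by linarith)
  have hdle : (d : ℝ) ≤ c * n / 24 := Nat.floor_le (by positivity)
  have hδd : 3 * n + 34 * d ≤ 4 * G.minDegree := by
    have : (3 * n + 34 * d : ℝ) ≤ 4 * G.minDegree := by linarith
    exact_mod_cast this
  have hδn : G.minDegree ≤ n := by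
    have := (G.minDegree_le_degree ⟨0, hn⟩).trans (G.degree_lt_card_verts ⟨0, hn⟩).le
    simpa using this
  obtain ⟨l, ⟨hnd, hmem, hadj⟩, i, hi⟩ := HamiltonBias.exists_biased_cycle (G := G)
    (fun i x y => if decide (col s(x, y) = i) then 1 else 0) (fun i x y => by rw [Sym2.eq_swap])
    (fun x y => by
      have : col s(x, y) = 0 ∨ col s(x, y) = 1 := by omega
      rcases this with h | h <;> simp [h])
    hd0 G.minDegree_le_degree (by simpa using hδn) (by simpa using hδd)
  have hlen : 3 ≤ l.length := by
    rw [HamiltonBias.length_eq_card hnd hmem, Fintype.card_fin]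
    omega
  obtain ⟨v, C, hC, hcount⟩ :=
    HamiltonBias.exists_isHamiltonianCycle_of_cycleWeight_nonAdj_eq_zero hnd hmem hlen hadj
  refine ⟨v, C, hC, i, ?_⟩
  rw [Fintype.card_fin, ← hcount fun e => decide (col e = i)] at hi
  have : ((n + 2 * d : ℕ) : ℝ) ≤ (2 * colourCount col C.edges i : ℕ) := by exact_mod_cast hi
  push_cast at this
  linarith
end
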